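/- Let α be an irrational number which is strong Diophantine, i.e. there exist γ > 0 and τ > 0 such that q_{n+1} ≤ γ^{-1} q_n (log q_n)^τ for all n ∈ ℕ, and fix E ∈ ℝ. Then for every s > 2 there exist v₀ ∈ G^s(S¹, ℝ), a constant K > 0, and a sequence v_j ∈ G^{s,K}(S¹, ℝ) such that ‖v_j − v₀‖_{s,K} → 0 as j → ∞ but L(α, S_{E,v_j}) does not converge to L(α, S_{E,v₀}); that is, the Lyapunov exponent of the Schrödinger cocycle is discontinuous in the potential v at v₀ in the G^s topology. -/

import Mathlib

open Filter MeasureTheory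

noncomputable section

attribute [local instance] Matrix.normedAddCommGroup Matrix.normedSpace

/-- The Euclidean operator norm of a 2×2 real matrix. -/
def opNorm (M : Matrix (Fin 2) (Fin 2) ℝ) : ℝ :=
  ‖Matrix.toEuclideanCLM (𝕜 := ℝ) M‖

/-- The iterated cocycle `A^n(x) = A(x + (n-1)α) ⋯ A(x + α) A(x)` over the rotation by `α`. -/
def cocIter (α : ℝ) (A : ℝ → Matrix (Fin 2) (Fin 2) ℝ) :
    ℕ → ℝ → Matrix (Fin 2) (Fin 2) ℝ
  | 0, _ => 1
  | n + 1, x => A (x + (n : ℝ) * α) * cocIter α A n x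

/-- The Lyapunov exponent `L(α, A) = lim_n (1/n) ∫_{S¹} log ‖A^n(x)‖ dx` (the limit exists by
subadditivity, so it agrees with the `limsup` used here). -/
def lyap (α : ℝ) (A : ℝ → Matrix (Fin 2) (Fin 2) ℝ) : ℝ :=
  limsup (fun n : ℕ =>
    (n : ℝ)⁻¹ * ∫ x in (0 : ℝ)..1, Real.log (opNorm (cocIter α A n x))) atTop

/-- The `C^l` norm `max_{0 ≤ k ≤ l} sup_x ‖∂^k A(x)‖` of a matrix-valued map on the circle. -/
def cNorm (l : ℕ) (A : ℝ → Matrix (Fin 2) (Fin 2) ℝ) : ℝ :=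
  ⨆ k : Fin (l + 1), ⨆ x : ℝ, ‖iteratedDeriv (k : ℕ) A x‖

/-- Gauss map iterates of `α`: `x₀ = {α}`, `x_{n+1} = {1/x_n}`. -/
def gaussIter (α : ℝ) : ℕ → ℝ
  | 0 => Int.fract α
  | n + 1 => Int.fract (gaussIter α n)⁻¹

/-- `cfa α n` is the partial quotient `a_{n+1} = ⌊1/x_n⌋` of the continued fraction of `α`. -/
def cfa (α : ℝ) (n : ℕ) : ℕ := ⌊(gaussIter α n)⁻¹⌋₊

/-- Denominators `q_n` of the continued fraction convergents of `α`:
`q₀ = 1`, `q₁ = a₁`, `q_{n+2} = a_{n+2} q_{n+1} + q_n`. -/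
def cfq (α : ℝ) : ℕ → ℕ
  | 0 => 1
  | 1 => cfa α 0
  | n + 2 => cfa α (n + 1) * cfq α (n + 1) + cfq α n

/-- `sup_x |∂^k f(x)|` for a scalar function. -/
def supDerivR (k : ℕ) (f : ℝ → ℝ) : ℝ := ⨆ x : ℝ, |iteratedDeriv k f x|

/-- The `k`-th term of the scalar Gevrey norm `‖f‖_{s,K}`. -/
def gevreySeqR (s K : ℝ) (f : ℝ → ℝ) (k : ℕ) : ℝ :=
  (1 + (k : ℝ) ^ 2) * supDerivR k f / (K ^ k * (k.factorial : ℝ) ^ s)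

/-- The Gevrey norm `‖f‖_{s,K} = (4π²/3) sup_k (1+k²) sup_x |∂^k f(x)| / (K^k (k!)^s)`. -/
def gevreyNormR (s K : ℝ) (f : ℝ → ℝ) : ℝ :=
  (4 * Real.pi ^ 2 / 3) * ⨆ k : ℕ, gevreySeqR s K f k

/-- Membership in the scalar Gevrey class `G^{s,K}`. -/
def MemGevreyR (s K : ℝ) (f : ℝ → ℝ) : Prop :=
  ContDiff ℝ (⊤ : ℕ∞) f ∧
    (∀ k : ℕ, BddAbove (Set.range fun x : ℝ => |iteratedDeriv k f x|)) ∧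
    BddAbove (Set.range (gevreySeqR s K f))

/-- The Schrödinger cocycle matrix `S_{E,v}(x) = [[E - v(x), -1], [1, 0]]`. -/
def schrodMat (E : ℝ) (v : ℝ → ℝ) (x : ℝ) : Matrix (Fin 2) (Fin 2) ℝ :=
  !![E - v x, -1; 1, 0]

section

/-- A submultiplicative size function on a commutative ring for which `1 + e` is invertible, with
inverse of size at most `2`, as soon as `e` has size at most `1 / 2`. -/
structure NeumannNorm (R : Type) [CommRing R] where
  /-- the size function -/
  size : R → ℝ
  size_nonneg : ∀ a, 0 ≤ size a
  size_zero : size 0 = 0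
  size_add : ∀ a b, size (a + b) ≤ size a + size b
  size_neg : ∀ a, size (-a) = size a
  size_mul : ∀ a b, size (a * b) ≤ size a * size b
  size_one : size 1 ≤ 1
  neumann : ∀ e, size e ≤ 1 / 2 → ∃ u, (1 + e) * u = 1 ∧ size u ≤ 2

section Transfer

variable {R : Type} [CommRing R]

/-- The one-step transfer matrix of the Jacobi recursion with diagonal entry `a`. -/
def stepM (a : R) : Matrix (Fin 2) (Fin 2) R := !![a, -1; 1, 0]

/-- The transfer matrix over the sites `1, …, n`. -/
def transfer (a : ℕ → R) : ℕ → Matrix (Fin 2) (Fin 2) R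
  | 0 => 1
  | n + 1 => stepM (a (n + 1)) * transfer a n

/-- The truncated Weyl function over the sites `1, …, n`. -/
def weyl (a : ℕ → R) (n : ℕ) : R := -(transfer a n 0 1) * Ring.inverse (transfer a n 0 0)

theorem transfer_det (a : ℕ → R) (n : ℕ) : (transfer a n).det = 1 := by
  induction n with
  | zero => simp [transfer]
  | succ n ih => rw [transfer, Matrix.det_mul, ih, stepM, Matrix.det_fin_two_of]; ring

theorem transfer_det_entries (a : ℕ → R) (n : ℕ) :
    transfer a n 0 0 * transfer a n 1 1 - transfer a n 0 1 * transfer a n 1 0 = 1 := by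
  rw [← Matrix.det_fin_two, transfer_det]

theorem transfer_add (a : ℕ → R) (p q : ℕ) :
    transfer a (p + q) = transfer (fun k => a (p + k)) q * transfer a p := by
  induction q with
  | zero => simp [transfer]
  | succ q ih => rw [← add_assoc, transfer, ih, transfer, ← mul_assoc, add_assoc]

theorem transfer_congr {a b : ℕ → R} {n : ℕ} (h : ∀ k, 1 ≤ k → k ≤ n → a k = b k) :
    transfer a n = transfer b n := by
  induction n with
  | zero => rfl
  | succ n ih =>
    rw [transfer, transfer, h (n + 1) (by omega) le_rfl, ih fun k h1 h2 => h k h1 (by omega)]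

theorem weyl_congr {a b : ℕ → R} {n : ℕ} (h : ∀ k, 1 ≤ k → k ≤ n → a k = b k) :
    weyl a n = weyl b n := by
  rw [weyl, weyl, transfer_congr h]

theorem weyl_zero (a : ℕ → R) : weyl a 0 = 0 := by simp [weyl, transfer]

theorem transfer_one (a : ℕ → R) : transfer a 1 = stepM (a 1) := by simp [transfer]

/-- Reversing the order of the sites conjugates the transposed transfer matrix by
`diag (1, -1)`. -/
theorem transfer_reverse (a b : ℕ → R) (n : ℕ) (h : ∀ k, 1 ≤ k → k ≤ n → b k = a (n + 1 - k)) :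
    transfer b n =
      !![transfer a n 0 0, -transfer a n 1 0; -transfer a n 0 1, transfer a n 1 1] := by
  induction n generalizing a b with
  | zero => ext i j; fin_cases i <;> fin_cases j <;> simp [transfer]
  | succ n ih =>
    have h1 := ih (fun k => a (1 + k)) b fun k hk1 hk2 => by
      rw [h k hk1 (by omega)]; congr 1; omega
    have h2 : transfer a (n + 1) = transfer (fun k => a (1 + k)) n * stepM (a 1) := by
      rw [add_comm n 1, transfer_add, transfer_one]
    rw [transfer, h1, h2, h (n + 1) (by omega) le_rfl]
    have h3 : n + 1 + 1 - (n + 1) = 1 := by omega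
    rw [h3, stepM]
    ext i j
    fin_cases i <;> fin_cases j <;> simp [Matrix.mul_apply, Fin.sum_univ_two] <;> ring

theorem inverse_mul_of_isUnit {a : R} (h : IsUnit a) : Ring.inverse a * a = 1 :=
  Ring.inverse_mul_cancel a h

theorem inverse_eq_of_mul_eq_one {a b : R} (h : a * b = 1) : Ring.inverse a = b := by
  have hu : IsUnit a := IsUnit.of_mul_eq_one b h
  calc Ring.inverse a = Ring.inverse a * (a * b) := by rw [h, mul_one]
    _ = b := by rw [← mul_assoc, inverse_mul_of_isUnit hu, one_mul]

/-- The Weyl function of the reversed chain. -/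
theorem weyl_reverse (a b : ℕ → R) (n : ℕ) (h : ∀ k, 1 ≤ k → k ≤ n → b k = a (n + 1 - k)) :
    weyl b n = transfer a n 1 0 * Ring.inverse (transfer a n 0 0) := by
  rw [weyl, transfer_reverse a b n h]; simp

theorem transfer_split (a : ℕ → R) (i m : ℕ) :
    transfer a (i + 1 + m) =
      transfer (fun k => a (i + 1 + k)) m * (stepM (a (i + 1)) * transfer a i) := by
  rw [transfer_add, transfer]

/-- Factorisation of the corner entry of the transfer matrix at the site `i + 1`. -/
theorem transfer_corner_split (a : ℕ → R) (i m : ℕ) (hL : IsUnit (transfer a i 0 0))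
    (hR : IsUnit (transfer (fun k => a (i + 1 + k)) m 0 0)) :
    transfer a (i + 1 + m) 0 0 =
      transfer a i 0 0 * transfer (fun k => a (i + 1 + k)) m 0 0 *
        (a (i + 1) - transfer a i 1 0 * Ring.inverse (transfer a i 0 0)
          - weyl (fun k => a (i + 1 + k)) m) := by
  have h1 := inverse_mul_of_isUnit hL
  have h2 := inverse_mul_of_isUnit hR
  rw [transfer_split, weyl]
  generalize Ring.inverse (transfer a i 0 0) = u at *
  generalize Ring.inverse (transfer (fun k => a (i + 1 + k)) m 0 0) = w at *
  simp only [stepM, Matrix.mul_apply, Fin.sum_univ_two, Matrix.of_apply, Matrix.cons_val',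
    Matrix.cons_val_zero, Matrix.cons_val_one, Matrix.cons_val_fin_one]
  linear_combination (transfer (fun k => a (i + 1 + k)) m 0 0 * transfer a i 1 0) * h1 -
    (transfer (fun k => a (i + 1 + k)) m 0 1 * transfer a i 0 0) * h2

/-- The difference of two truncations of the Weyl function. -/
theorem weyl_sub_weyl (a : ℕ → R) (i m : ℕ) (hL : IsUnit (transfer a i 0 0))
    (hT : IsUnit (transfer a (i + 1 + m) 0 0)) :
    weyl a (i + 1 + m) - weyl a i =
      transfer a i 0 0 * transfer (fun k => a (i + 1 + k)) m 0 0 *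
        Ring.inverse (transfer a (i + 1 + m) 0 0) * Ring.inverse (transfer a i 0 0) ^ 2 := by
  have h1 := inverse_mul_of_isUnit hL
  have h2 := inverse_mul_of_isUnit hT
  have h3 := transfer_det_entries a i
  have h4 : transfer a i 0 1 * transfer a (i + 1 + m) 0 0
      - transfer a (i + 1 + m) 0 1 * transfer a i 0 0
      = transfer (fun k => a (i + 1 + k)) m 0 0 := by
    rw [transfer_split]
    simp only [stepM, Matrix.mul_apply, Fin.sum_univ_two, Matrix.of_apply, Matrix.cons_val',
      Matrix.cons_val_zero, Matrix.cons_val_one, Matrix.cons_val_fin_one]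
    linear_combination (transfer (fun k => a (i + 1 + k)) m 0 0) * h3
  rw [weyl, weyl]
  generalize Ring.inverse (transfer a i 0 0) = u at *
  generalize Ring.inverse (transfer a (i + 1 + m) 0 0) = w at *
  generalize transfer (fun k => a (i + 1 + k)) m 0 0 = r at *
  generalize transfer a (i + 1 + m) 0 0 = t at *
  generalize transfer a (i + 1 + m) 0 1 = t' at *
  generalize transfer a i 0 0 = l at *
  generalize transfer a i 0 1 = l' at *
  linear_combination (w * u) * h4 + (t' * w - r * w * u) * h1 - (l' * u) * h2

end Transfer

/-- The diagonal entries seen from `y` along the orbit of the translation by `δ`. -/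
def chain {R : Type} (H : ℝ → R) (δ y : ℝ) (k : ℕ) : R := H (y + k * δ)

/-- The weight `Λ` is maximal over the sites `1, …, n` at the site `j`. -/
def IsArgmax (Λ : ℝ → ℝ) (δ x : ℝ) (n j : ℕ) : Prop :=
  1 ≤ j ∧ j ≤ n ∧ ∀ k : ℕ, 1 ≤ k → k ≤ n → Λ (x + k * δ) ≤ Λ (x + j * δ)

theorem exists_last_argmax (Λ : ℝ → ℝ) (δ x : ℝ) {n : ℕ} (hn : 1 ≤ n) :
    ∃ j, IsArgmax Λ δ x n j ∧ ∀ i, IsArgmax Λ δ x n i → i ≤ j := by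
  classical
  obtain ⟨j₀, hj₀, hmax⟩ := Finset.exists_max_image (Finset.Icc 1 n)
    (fun k : ℕ => Λ (x + k * δ)) ⟨1, by simp [hn]⟩
  have hne : IsArgmax Λ δ x n j₀ := by
    rw [Finset.mem_Icc] at hj₀
    exact ⟨hj₀.1, hj₀.2, fun k h1 h2 => hmax k (Finset.mem_Icc.2 ⟨h1, h2⟩)⟩
  have := Nat.findGreatest_spec (P := IsArgmax Λ δ x n) hne.2.1 hne
  exact ⟨_, this, fun i hi => Nat.le_findGreatest hi.2.1 hi⟩

/-- Combinatorial data of the orbit structure: a weight `Λ` that blows up at the singular point,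
admissible chains `W`, a level function, the lengths of the two Weyl functions that are glued at a
point, and a record index `κ` common to all chains that are compared at a point. -/
structure ChainGeometry (α : ℝ) where
  Λ : ℝ → ℝ
  W : ℝ → ℝ → ℕ → Prop
  lev : ℝ → ℕ
  good : ℝ → Prop
  short : ℝ → ℕ
  long : ℝ → ℕ
  κ : ℝ → ℝ → ℕ
  B : ℝ
  C₀ : ℝ
  C₃ : ℝ
  B_nonneg : 0 ≤ B
  C₀_nonneg : 0 ≤ C₀
  good_of_W : ∀ δ x n, W δ x n → ∀ k : ℕ, 1 ≤ k → k ≤ n → good (x + k * δ)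
  W_left : ∀ δ, (δ = α ∨ δ = -α) → ∀ x n j, W δ x n → IsArgmax Λ δ x n j → W δ x (j - 1)
  W_right : ∀ δ, (δ = α ∨ δ = -α) → ∀ x n j, W δ x n → IsArgmax Λ δ x n j →
    W δ (x + j * δ) (n - j)
  W_back : ∀ δ, (δ = α ∨ δ = -α) → ∀ x n j, W δ x n → IsArgmax Λ δ x n j →
    W (-δ) (x + j * δ) (j - 1)
  sum_le : ∀ δ, (δ = α ∨ δ = -α) → ∀ x n, W δ x n →
    ∑ k ∈ Finset.Icc 1 n, Λ (x + k * δ) ≤ B * n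
  weight_le : ∀ δ, (δ = α ∨ δ = -α) → ∀ x n, W δ x n → ∀ k : ℕ, 1 ≤ k → k ≤ n →
    Λ (x + k * δ) ≤ C₀ * k
  W_short : ∀ δ, (δ = α ∨ δ = -α) → ∀ y, good y → W δ y (short y)
  W_long : ∀ δ, (δ = α ∨ δ = -α) → ∀ y, good y → W δ y (long y)
  lev_short : ∀ δ, (δ = α ∨ δ = -α) → ∀ y, good y → ∀ k : ℕ, 1 ≤ k → k ≤ short y →
    lev (y + k * δ) < lev y
  lev_long : ∀ δ, (δ = α ∨ δ = -α) → ∀ y, good y → ∀ k : ℕ, 1 ≤ k → k ≤ long y →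
    lev (y + k * δ) < lev y
  κ_pos : ∀ δ y, 1 ≤ κ δ y
  κ_record : ∀ δ y, ∀ m : ℕ, 1 ≤ m → m < κ δ y → Λ (y + m * δ) ≤ Λ (y + κ δ y * δ)
  weight_le_κ : ∀ δ, (δ = α ∨ δ = -α) → ∀ y, good y → Λ y ≤ C₃ * κ δ y
  κ_le_short : ∀ δ, (δ = α ∨ δ = -α) → ∀ y, good y → κ δ y ≤ short y + 1
  κ_le_long : ∀ δ, (δ = α ∨ δ = -α) → ∀ y, good y → κ δ y ≤ long y + 1
  κ_le_right : ∀ δ, (δ = α ∨ δ = -α) → ∀ x n j, W δ x n → IsArgmax Λ δ x n j →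
    κ δ (x + j * δ) ≤ n - j + 1
  κ_le_back : ∀ δ, (δ = α ∨ δ = -α) → ∀ x n j, W δ x n → IsArgmax Λ δ x n j →
    κ (-δ) (x + j * δ) ≤ j

/-- A diagonal `H` which at every good point is `D` plus a gluing of the truncated Weyl functions
in the two directions. -/
structure GluedDiagonal {α : ℝ} (𝒢 : ChainGeometry α) {R : Type} [CommRing R]
    (N : NeumannNorm R) where
  H : ℝ → R
  D : ℝ → R
  Dinv : ℝ → R
  X : ℝ → R
  Cχ : ℝ
  Cg : ℝ
  lam : ℝ
  θ : ℝ
  Cχ_nonneg : 0 ≤ Cχ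
  Cg_nonneg : 0 ≤ Cg
  two_le_lam : 2 ≤ lam
  θ_eq : θ = 4 * Real.exp (2 * Cg * (𝒢.B + 𝒢.C₀)) / lam
  θ_le : θ ≤ 1 / 2
  θ_mul_le : θ * Real.exp (Cg * 𝒢.C₃) ≤ 1
  lam_ge : 16 * (1 + 2 * Cχ) ≤ lam
  D_mul : ∀ y, 𝒢.good y → D y * Dinv y = 1
  size_Dinv : ∀ y, 𝒢.good y → N.size (Dinv y) ≤ Real.exp (Cg * 𝒢.Λ y) / lam
  size_X : ∀ y, 𝒢.good y → N.size (X y) ≤ Cχ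
  /-- the gluing relation, assuming that the denominators of the Weyl functions are units -/
  glue : ∀ y, 𝒢.good y →
    (∀ δ, (δ = α ∨ δ = -α) → IsUnit (transfer (chain H δ y) (𝒢.short y) 0 0) ∧
      IsUnit (transfer (chain H δ y) (𝒢.long y) 0 0)) →
    H y = D y
      + ((1 - X y) * weyl (chain H α y) (𝒢.short y) + X y * weyl (chain H α y) (𝒢.long y))
      + ((1 - X y) * weyl (chain H (-α) y) (𝒢.short y) + X y * weyl (chain H (-α) y) (𝒢.long y))

namespace NeumannNorm

variable {R : Type} [CommRing R] (N : NeumannNorm R)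

theorem size_sub (a b : R) : N.size (a - b) ≤ N.size a + N.size b := by
  rw [sub_eq_add_neg, ← N.size_neg b]; exact N.size_add _ _

theorem size_sub_le (a b c : R) : N.size (a - c) ≤ N.size (a - b) + N.size (b - c) := by
  rw [← sub_add_sub_cancel a b c]; exact N.size_add _ _

theorem size_sub_comm (a b : R) : N.size (a - b) = N.size (b - a) := by
  rw [← neg_sub, N.size_neg]

theorem size_pow_two (a : R) : N.size (a ^ 2) ≤ N.size a ^ 2 := by
  rw [pow_two, pow_two]; exact N.size_mul _ _

end NeumannNorm

end

section

theorem chain_shift {R : Type} (H : ℝ → R) (δ x : ℝ) (j : ℕ) :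
    (fun k => chain H δ x (j + k)) = chain H δ (x + j * δ) := by
  funext k
  simp only [chain]
  congr 1
  push_cast
  ring

theorem chain_reverse {R : Type} (H : ℝ → R) (δ x : ℝ) (i k : ℕ) (h2 : k ≤ i) :
    chain H (-δ) (x + ((i + 1 : ℕ) : ℝ) * δ) k = chain H δ x (i + 1 - k) := by
  simp only [chain]
  congr 1
  rw [Nat.cast_sub (by omega)]
  ring

namespace GluedDiagonal

variable {α : ℝ} {𝒢 : ChainGeometry α} {R : Type} [CommRing R] {N : NeumannNorm R}
  (𝒮 : GluedDiagonal 𝒢 N)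

/-- The bound for the contribution of one site to the inverse of the transfer matrix corner. -/
def η (y : ℝ) : ℝ := 2 / 𝒮.lam * Real.exp (𝒮.Cg * 𝒢.Λ y)

theorem lam_pos : 0 < 𝒮.lam := by linarith [𝒮.two_le_lam]

theorem η_pos (y : ℝ) : 0 < 𝒮.η y := by have := 𝒮.lam_pos; unfold η; positivity

theorem θ_pos : 0 < 𝒮.θ := by have := 𝒮.lam_pos; rw [𝒮.θ_eq]; positivity

/-- The conclusion of the main estimate for one chain. -/
def Bounded (δ x : ℝ) (n : ℕ) : Prop :=
  IsUnit (transfer (chain 𝒮.H δ x) n 0 0) ∧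
  N.size (Ring.inverse (transfer (chain 𝒮.H δ x) n 0 0)) ≤
    ∏ k ∈ Finset.Icc 1 n, 𝒮.η (x + k * δ) ∧
  ∀ i m, n = i + 1 + m → IsArgmax 𝒢.Λ δ x n (i + 1) →
    N.size (transfer (chain 𝒮.H δ x) i 0 0 *
      transfer (chain 𝒮.H δ (x + ((i + 1 : ℕ) : ℝ) * δ)) m 0 0 *
      Ring.inverse (transfer (chain 𝒮.H δ x) n 0 0)) ≤ 𝒮.η (x + ((i + 1 : ℕ) : ℝ) * δ)

theorem prod_η_le (δ : ℝ) (hδ : δ = α ∨ δ = -α) (x : ℝ) (i : ℕ) (hW : 𝒢.W δ x i) :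
    ∏ k ∈ Finset.Icc 1 i, 𝒮.η (x + k * δ) ≤
      (2 / 𝒮.lam) ^ i * Real.exp (𝒮.Cg * 𝒢.B * i) := by
  have hl := 𝒮.lam_pos
  unfold η
  rw [Finset.prod_mul_distrib, ← Real.exp_sum, ← Finset.mul_sum, Finset.prod_const, Nat.card_Icc,
    Nat.add_sub_cancel]
  have h := mul_le_mul_of_nonneg_left (𝒢.sum_le δ hδ x i hW) 𝒮.Cg_nonneg
  have h' := Real.exp_le_exp.2 h
  rw [mul_assoc 𝒮.Cg]
  gcongr

theorem η_mul_prod_le (δ : ℝ) (hδ : δ = α ∨ δ = -α) (x : ℝ) (n i : ℕ) (hW : 𝒢.W δ x n)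
    (hj : IsArgmax 𝒢.Λ δ x n (i + 1)) :
    𝒮.η (x + ((i + 1 : ℕ) : ℝ) * δ) * (∏ k ∈ Finset.Icc 1 i, 𝒮.η (x + k * δ)) ^ 2 ≤
      𝒮.θ ^ (i + 1) := by
  have hl := 𝒮.lam_pos
  have h1 := 𝒮.prod_η_le δ hδ x i (𝒢.W_left δ hδ x n (i + 1) hW hj)
  have h2 := 𝒢.weight_le δ hδ x n hW (i + 1) hj.1 hj.2.1
  have h3 : 𝒮.η (x + ((i + 1 : ℕ) : ℝ) * δ) ≤
      2 / 𝒮.lam * Real.exp (𝒮.Cg * 𝒢.C₀ * ((i + 1 : ℕ) : ℝ)) := by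
    have h := mul_le_mul_of_nonneg_left h2 𝒮.Cg_nonneg
    have h' := Real.exp_le_exp.2 h
    unfold η
    rw [mul_assoc 𝒮.Cg]
    gcongr
  have hp : 0 ≤ ∏ k ∈ Finset.Icc 1 i, 𝒮.η (x + k * δ) :=
    Finset.prod_nonneg fun k _ => (𝒮.η_pos _).le
  have hr : (2 / 𝒮.lam) ^ i ≤ 1 :=
    pow_le_one₀ (by positivity) (by rw [div_le_one hl]; exact 𝒮.two_le_lam)
  calc _ ≤ (2 / 𝒮.lam * Real.exp (𝒮.Cg * 𝒢.C₀ * ((i + 1 : ℕ) : ℝ))) *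
        ((2 / 𝒮.lam) ^ i * Real.exp (𝒮.Cg * 𝒢.B * i)) ^ 2 := by
        gcongr
    _ = (2 / 𝒮.lam) ^ (i + 1) * (2 / 𝒮.lam) ^ i *
        Real.exp (𝒮.Cg * 𝒢.C₀ * ((i + 1 : ℕ) : ℝ) + 2 * (𝒮.Cg * 𝒢.B * i)) := by
        rw [Real.exp_add, two_mul, Real.exp_add]; ring
    _ ≤ (4 / 𝒮.lam) ^ (i + 1) * 1 *
        Real.exp (2 * 𝒮.Cg * (𝒢.B + 𝒢.C₀) * ((i + 1 : ℕ) : ℝ)) := by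
        have hB := mul_nonneg 𝒮.Cg_nonneg 𝒢.B_nonneg
        have hC := mul_nonneg 𝒮.Cg_nonneg 𝒢.C₀_nonneg
        have hi : (0 : ℝ) ≤ i := Nat.cast_nonneg i
        have he : 𝒮.Cg * 𝒢.C₀ * ((i + 1 : ℕ) : ℝ) + 2 * (𝒮.Cg * 𝒢.B * i) ≤
            2 * 𝒮.Cg * (𝒢.B + 𝒢.C₀) * ((i + 1 : ℕ) : ℝ) := by
          push_cast
          nlinarith [mul_nonneg hC hi]
        have he' := Real.exp_le_exp.2 he
        have h24 : (2 : ℝ) / 𝒮.lam ≤ 4 / 𝒮.lam := by gcongr; norm_num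
        gcongr
    _ = 𝒮.θ ^ (i + 1) := by
        rw [𝒮.θ_eq, mul_one, mul_comm _ ((i + 1 : ℕ) : ℝ), Real.exp_nat_mul, ← mul_pow]
        congr 1
        ring

theorem geom_tail_le (k n : ℕ) : ∑ m ∈ Finset.Icc k n, 𝒮.θ ^ m ≤ 2 * 𝒮.θ ^ k := by
  have h0 := 𝒮.θ_pos
  have h1 := 𝒮.θ_le
  rcases lt_or_ge n k with h | h
  · rw [Finset.Icc_eq_empty (by omega)]; simp; positivity
  have key : ∀ n, k ≤ n → ∑ m ∈ Finset.Icc k n, 𝒮.θ ^ m ≤ 2 * 𝒮.θ ^ k - 𝒮.θ ^ n := by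
    intro n hn
    induction n, hn using Nat.le_induction with
    | base => simp; linarith
    | succ n hn ih =>
      rw [← Finset.insert_Icc_right_eq_Icc_add_one (by omega), Finset.sum_insert (by simp)]
      have : 𝒮.θ ^ (n + 1) ≤ 𝒮.θ ^ n * (1 / 2) := by rw [pow_succ]; gcongr
      linarith
  linarith [key n h, pow_pos h0 n]

/-- Two truncations of the Weyl function that agree up to a record index are close. -/
theorem size_weyl_sub_le (δ : ℝ) (hδ : δ = α ∨ δ = -α) (x : ℝ) (n : ℕ) (hW : 𝒢.W δ x n)
    (hB : ∀ n' ≤ n, 𝒢.W δ x n' → 𝒮.Bounded δ x n') (k : ℕ) (hk1 : 1 ≤ k) (hkn : k ≤ n + 1)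
    (hrec : ∀ m : ℕ, 1 ≤ m → m < k → 𝒢.Λ (x + m * δ) ≤ 𝒢.Λ (x + k * δ)) :
    N.size (weyl (chain 𝒮.H δ x) n - weyl (chain 𝒮.H δ x) (k - 1)) ≤
      ∑ m ∈ Finset.Icc k n, 𝒮.θ ^ m := by
  induction n using Nat.strong_induction_on with
  | _ n ih =>
    rcases eq_or_lt_of_le hkn with rfl | hlt
    · rw [Nat.add_sub_cancel, sub_self, N.size_zero]
      exact Finset.sum_nonneg fun m _ => (pow_pos 𝒮.θ_pos m).le
    have hkn' : k ≤ n := by omega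
    obtain ⟨j, hj, hlast⟩ := exists_last_argmax 𝒢.Λ δ x (n := n) (by omega)
    have hkj : k ≤ j := by
      by_contra! hc
      have := hlast k ⟨hk1, hkn', fun i h1 h2 => (hj.2.2 i h1 h2).trans (hrec j hj.1 hc)⟩
      omega
    obtain ⟨i, rfl⟩ : ∃ i, j = i + 1 := ⟨j - 1, by have := hj.1; omega⟩
    obtain ⟨m, rfl⟩ : ∃ m, n = i + 1 + m := ⟨n - (i + 1), by have := hj.2.1; omega⟩
    have hWi : 𝒢.W δ x i := 𝒢.W_left δ hδ x _ (i + 1) hW hj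
    have hbi := hB i (by omega) hWi
    have hbn := hB _ le_rfl hW
    have hdiff : N.size (weyl (chain 𝒮.H δ x) (i + 1 + m) - weyl (chain 𝒮.H δ x) i) ≤
        𝒮.θ ^ (i + 1) := by
      rw [weyl_sub_weyl _ _ _ hbi.1 hbn.1, chain_shift]
      refine le_trans ?_ (𝒮.η_mul_prod_le δ hδ x _ i hW hj)
      refine (N.size_mul _ _).trans ?_
      have h1 := hbn.2.2 i m rfl hj
      have h2 := (N.size_pow_two (Ring.inverse (transfer (chain 𝒮.H δ x) i 0 0))).trans
        (pow_le_pow_left₀ (N.size_nonneg _) hbi.2.1 2)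
      exact mul_le_mul h1 h2 (N.size_nonneg _) (𝒮.η_pos _).le
    have hrest := ih i (by omega) hWi (fun n' hn' => hB n' (by omega)) (by omega)
    refine (N.size_sub_le _ (weyl (chain 𝒮.H δ x) i) _).trans ?_
    calc _ ≤ 𝒮.θ ^ (i + 1) + ∑ m ∈ Finset.Icc k i, 𝒮.θ ^ m := add_le_add hdiff hrest
      _ = ∑ m ∈ Finset.Icc k (i + 1), 𝒮.θ ^ m := by
        rw [← Finset.insert_Icc_right_eq_Icc_add_one (by omega), Finset.sum_insert (by simp)]
      _ ≤ _ := Finset.sum_le_sum_of_subset_of_nonneg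
        (Finset.Icc_subset_Icc le_rfl (by omega)) fun m _ _ => (pow_pos 𝒮.θ_pos m).le

theorem size_weyl_sub_weyl_le (δ : ℝ) (hδ : δ = α ∨ δ = -α) (y : ℝ) (n₁ n₂ : ℕ)
    (hW₁ : 𝒢.W δ y n₁) (hW₂ : 𝒢.W δ y n₂)
    (hB₁ : ∀ n' ≤ n₁, 𝒢.W δ y n' → 𝒮.Bounded δ y n')
    (hB₂ : ∀ n' ≤ n₂, 𝒢.W δ y n' → 𝒮.Bounded δ y n')
    (hκ₁ : 𝒢.κ δ y ≤ n₁ + 1) (hκ₂ : 𝒢.κ δ y ≤ n₂ + 1) :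
    N.size (weyl (chain 𝒮.H δ y) n₁ - weyl (chain 𝒮.H δ y) n₂) ≤ 4 * 𝒮.θ ^ 𝒢.κ δ y := by
  have h1 := (𝒮.size_weyl_sub_le δ hδ y n₁ hW₁ hB₁ _ (𝒢.κ_pos δ y) hκ₁
    (𝒢.κ_record δ y)).trans (𝒮.geom_tail_le _ _)
  have h2 := (𝒮.size_weyl_sub_le δ hδ y n₂ hW₂ hB₂ _ (𝒢.κ_pos δ y) hκ₂
    (𝒢.κ_record δ y)).trans (𝒮.geom_tail_le _ _)
  rw [N.size_sub_comm] at h2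
  linarith [N.size_sub_le (weyl (chain 𝒮.H δ y) n₁)
    (weyl (chain 𝒮.H δ y) (𝒢.κ δ y - 1)) (weyl (chain 𝒮.H δ y) n₂)]

theorem size_one_sub_X (y : ℝ) (hy : 𝒢.good y) : N.size (1 - 𝒮.X y) ≤ 1 + 𝒮.Cχ := by
  linarith [N.size_sub 1 (𝒮.X y), N.size_one, 𝒮.size_X y hy]

theorem size_Dinv_mul_le (δ : ℝ) (hδ : δ = α ∨ δ = -α) (y : ℝ) (hy : 𝒢.good y) (d₁ d₂ : R)
    (h₁ : N.size d₁ ≤ 4 * 𝒮.θ ^ 𝒢.κ δ y) (h₂ : N.size d₂ ≤ 4 * 𝒮.θ ^ 𝒢.κ δ y) :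
    N.size (𝒮.Dinv y * ((1 - 𝒮.X y) * d₁ + 𝒮.X y * d₂)) ≤ 1 / 4 := by
  have hl := 𝒮.lam_pos
  have hθ := 𝒮.θ_pos
  have hχ := 𝒮.Cχ_nonneg
  have hX := 𝒮.size_X y hy
  have hX' := 𝒮.size_one_sub_X y hy
  have hsum : N.size ((1 - 𝒮.X y) * d₁ + 𝒮.X y * d₂) ≤
      (1 + 2 * 𝒮.Cχ) * (4 * 𝒮.θ ^ 𝒢.κ δ y) := by
    have a1 := (N.size_mul (1 - 𝒮.X y) d₁).trans
      (mul_le_mul hX' h₁ (N.size_nonneg _) (by positivity))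
    have a2 := (N.size_mul (𝒮.X y) d₂).trans (mul_le_mul hX h₂ (N.size_nonneg _) hχ)
    linarith [N.size_add ((1 - 𝒮.X y) * d₁) (𝒮.X y * d₂)]
  have hD : N.size (𝒮.Dinv y) ≤ Real.exp (𝒮.Cg * 𝒢.C₃) ^ 𝒢.κ δ y / 𝒮.lam := by
    refine (𝒮.size_Dinv y hy).trans ?_
    rw [← Real.exp_nat_mul]
    have := mul_le_mul_of_nonneg_left (𝒢.weight_le_κ δ hδ y hy) 𝒮.Cg_nonneg
    have h' : 𝒮.Cg * 𝒢.Λ y ≤ 𝒢.κ δ y * (𝒮.Cg * 𝒢.C₃) := by linarith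
    have := Real.exp_le_exp.2 h'
    gcongr
  have hpow : (𝒮.θ * Real.exp (𝒮.Cg * 𝒢.C₃)) ^ 𝒢.κ δ y ≤ 1 :=
    pow_le_one₀ (by positivity) 𝒮.θ_mul_le
  calc _ ≤ N.size (𝒮.Dinv y) * N.size ((1 - 𝒮.X y) * d₁ + 𝒮.X y * d₂) := N.size_mul _ _
    _ ≤ Real.exp (𝒮.Cg * 𝒢.C₃) ^ 𝒢.κ δ y / 𝒮.lam *
        ((1 + 2 * 𝒮.Cχ) * (4 * 𝒮.θ ^ 𝒢.κ δ y)) :=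
        mul_le_mul hD hsum (N.size_nonneg _) (by positivity)
    _ = 4 * (1 + 2 * 𝒮.Cχ) / 𝒮.lam * (𝒮.θ * Real.exp (𝒮.Cg * 𝒢.C₃)) ^ 𝒢.κ δ y := by
        rw [mul_pow]; ring
    _ ≤ 4 * (1 + 2 * 𝒮.Cχ) / 𝒮.lam * 1 := by gcongr
    _ ≤ 1 / 4 := by
        rw [mul_one, div_le_iff₀ hl]; linarith [𝒮.lam_ge]

/-- The Schur complement at an arbitrary good site, for arbitrary truncations beyond the record
index in both directions. -/
theorem schur_complement (y : ℝ) (hy : 𝒢.good y) (δ : ℝ) (hδ : δ = α ∨ δ = -α) (n₁ n₂ : ℕ)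
    (hW₁ : 𝒢.W δ y n₁) (hW₂ : 𝒢.W (-δ) y n₂)
    (hB₁ : ∀ n' ≤ n₁, 𝒢.W δ y n' → 𝒮.Bounded δ y n')
    (hB₂ : ∀ n' ≤ n₂, 𝒢.W (-δ) y n' → 𝒮.Bounded (-δ) y n')
    (hκ₁ : 𝒢.κ δ y ≤ n₁ + 1) (hκ₂ : 𝒢.κ (-δ) y ≤ n₂ + 1)
    (hS : ∀ δ, (δ = α ∨ δ = -α) → ∀ n' ≤ 𝒢.short y, 𝒢.W δ y n' → 𝒮.Bounded δ y n')
    (hL : ∀ δ, (δ = α ∨ δ = -α) → ∀ n' ≤ 𝒢.long y, 𝒢.W δ y n' → 𝒮.Bounded δ y n') :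
    ∃ u, (𝒮.H y - weyl (chain 𝒮.H (-δ) y) n₂ - weyl (chain 𝒮.H δ y) n₁) * u = 1 ∧
      N.size u ≤ 𝒮.η y := by
  have hδ' : -δ = α ∨ -δ = -α := by
    rcases hδ with rfl | rfl
    · exact Or.inr rfl
    · exact Or.inl (neg_neg _)
  have hunits : ∀ δ, (δ = α ∨ δ = -α) →
      IsUnit (transfer (chain 𝒮.H δ y) (𝒢.short y) 0 0) ∧
      IsUnit (transfer (chain 𝒮.H δ y) (𝒢.long y) 0 0) := fun δ hδ =>
    ⟨(hS δ hδ _ le_rfl (𝒢.W_short δ hδ y hy)).1, (hL δ hδ _ le_rfl (𝒢.W_long δ hδ y hy)).1⟩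
  have hglue : 𝒮.H y = 𝒮.D y
      + ((1 - 𝒮.X y) * weyl (chain 𝒮.H δ y) (𝒢.short y)
        + 𝒮.X y * weyl (chain 𝒮.H δ y) (𝒢.long y))
      + ((1 - 𝒮.X y) * weyl (chain 𝒮.H (-δ) y) (𝒢.short y)
        + 𝒮.X y * weyl (chain 𝒮.H (-δ) y) (𝒢.long y)) := by
    rw [𝒮.glue y hy hunits]
    rcases hδ with rfl | rfl
    · rfl
    · rw [neg_neg]; ring
  have hd : ∀ δ, (δ = α ∨ δ = -α) → ∀ n', 𝒢.W δ y n' →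
      (∀ n'' ≤ n', 𝒢.W δ y n'' → 𝒮.Bounded δ y n'') → 𝒢.κ δ y ≤ n' + 1 →
      N.size (𝒮.Dinv y * ((1 - 𝒮.X y) *
          (weyl (chain 𝒮.H δ y) (𝒢.short y) - weyl (chain 𝒮.H δ y) n')
        + 𝒮.X y * (weyl (chain 𝒮.H δ y) (𝒢.long y) - weyl (chain 𝒮.H δ y) n'))) ≤ 1 / 4 := by
    intro δ hδ n' hW hB hκ
    exact 𝒮.size_Dinv_mul_le δ hδ y hy _ _
      (𝒮.size_weyl_sub_weyl_le δ hδ y _ _ (𝒢.W_short δ hδ y hy) hW (hS δ hδ) hB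
        (𝒢.κ_le_short δ hδ y hy) hκ)
      (𝒮.size_weyl_sub_weyl_le δ hδ y _ _ (𝒢.W_long δ hδ y hy) hW (hL δ hδ) hB
        (𝒢.κ_le_long δ hδ y hy) hκ)
  have e1 := hd δ hδ n₁ hW₁ hB₁ hκ₁
  have e2 := hd (-δ) hδ' n₂ hW₂ hB₂ hκ₂
  set d₁ := 𝒮.Dinv y * ((1 - 𝒮.X y) *
          (weyl (chain 𝒮.H δ y) (𝒢.short y) - weyl (chain 𝒮.H δ y) n₁)
        + 𝒮.X y * (weyl (chain 𝒮.H δ y) (𝒢.long y) - weyl (chain 𝒮.H δ y) n₁)) with hd₁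
  set d₂ := 𝒮.Dinv y * ((1 - 𝒮.X y) *
          (weyl (chain 𝒮.H (-δ) y) (𝒢.short y) - weyl (chain 𝒮.H (-δ) y) n₂)
        + 𝒮.X y * (weyl (chain 𝒮.H (-δ) y) (𝒢.long y) - weyl (chain 𝒮.H (-δ) y) n₂)) with hd₂
  obtain ⟨u, hu, hus⟩ := N.neumann (d₁ + d₂) (by linarith [N.size_add d₁ d₂])
  refine ⟨𝒮.Dinv y * u, ?_, ?_⟩
  · have hDD := 𝒮.D_mul y hy
    have : 𝒮.H y - weyl (chain 𝒮.H (-δ) y) n₂ - weyl (chain 𝒮.H δ y) n₁ =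
        𝒮.D y * (1 + (d₁ + d₂)) := by
      rw [hglue, hd₁, hd₂]
      linear_combination -((1 - 𝒮.X y) *
          (weyl (chain 𝒮.H δ y) (𝒢.short y) - weyl (chain 𝒮.H δ y) n₁)
        + 𝒮.X y * (weyl (chain 𝒮.H δ y) (𝒢.long y) - weyl (chain 𝒮.H δ y) n₁) +
        ((1 - 𝒮.X y) *
          (weyl (chain 𝒮.H (-δ) y) (𝒢.short y) - weyl (chain 𝒮.H (-δ) y) n₂)
        + 𝒮.X y * (weyl (chain 𝒮.H (-δ) y) (𝒢.long y) - weyl (chain 𝒮.H (-δ) y) n₂))) * hDD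
    rw [this]
    linear_combination (𝒮.D y * 𝒮.Dinv y) * hu + hDD
  · have hl := 𝒮.lam_pos
    calc _ ≤ N.size (𝒮.Dinv y) * N.size u := N.size_mul _ _
      _ ≤ Real.exp (𝒮.Cg * 𝒢.Λ y) / 𝒮.lam * 2 :=
        mul_le_mul (𝒮.size_Dinv y hy) hus (N.size_nonneg _) (by positivity)
      _ = 𝒮.η y := by unfold η; ring

/-- The main estimate for a chain, given the estimate for all chains of lower level and for all
shorter chains of the same level. -/
theorem bounded_step (L : ℕ)
    (ihL : ∀ L' < L, ∀ δ, (δ = α ∨ δ = -α) → ∀ x n, 𝒢.W δ x n →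
      (∀ k : ℕ, 1 ≤ k → k ≤ n → 𝒢.lev (x + k * δ) < L') → 𝒮.Bounded δ x n)
    (n : ℕ) (ihn : ∀ n' < n, ∀ δ, (δ = α ∨ δ = -α) → ∀ x, 𝒢.W δ x n' →
      (∀ k : ℕ, 1 ≤ k → k ≤ n' → 𝒢.lev (x + k * δ) < L) → 𝒮.Bounded δ x n')
    (δ : ℝ) (hδ : δ = α ∨ δ = -α) (x : ℝ) (hW : 𝒢.W δ x n)
    (hlev : ∀ k : ℕ, 1 ≤ k → k ≤ n → 𝒢.lev (x + k * δ) < L) : 𝒮.Bounded δ x n := by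
  rcases Nat.eq_zero_or_pos n with rfl | hn
  · refine ⟨by simp [transfer], by simpa [transfer] using N.size_one, fun i m h => by omega⟩
  have hδ' : -δ = α ∨ -δ = -α := by
    rcases hδ with rfl | rfl
    · exact Or.inr rfl
    · exact Or.inl (neg_neg _)
  have key : ∀ i m, n = i + 1 + m → IsArgmax 𝒢.Λ δ x n (i + 1) →
      𝒮.Bounded δ x i ∧ 𝒮.Bounded δ (x + ((i + 1 : ℕ) : ℝ) * δ) m ∧
      ∃ u, transfer (chain 𝒮.H δ x) n 0 0 * (u *
        (Ring.inverse (transfer (chain 𝒮.H δ x) i 0 0) *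
          Ring.inverse (transfer (chain 𝒮.H δ (x + ((i + 1 : ℕ) : ℝ) * δ)) m 0 0))) = 1 ∧
        N.size u ≤ 𝒮.η (x + ((i + 1 : ℕ) : ℝ) * δ) := by
    rintro i m rfl hj
    have hWi : 𝒢.W δ x i := 𝒢.W_left δ hδ x _ (i + 1) hW hj
    have hWm : 𝒢.W δ (x + ((i + 1 : ℕ) : ℝ) * δ) m := by
      have := 𝒢.W_right δ hδ x _ (i + 1) hW hj
      rwa [Nat.add_sub_cancel_left] at this
    have hWb : 𝒢.W (-δ) (x + ((i + 1 : ℕ) : ℝ) * δ) i := 𝒢.W_back δ hδ x _ (i + 1) hW hj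
    set y := x + ((i + 1 : ℕ) : ℝ) * δ with hy
    have hlm : ∀ k : ℕ, 1 ≤ k → k ≤ m → 𝒢.lev (y + k * δ) < L := by
      intro k h1 h2
      have h := hlev (i + 1 + k) (by omega) (by omega)
      have e : x + ((i + 1 + k : ℕ) : ℝ) * δ = y + k * δ := by rw [hy]; push_cast; ring
      rwa [e] at h
    have hlb : ∀ k : ℕ, 1 ≤ k → k ≤ i → 𝒢.lev (y + k * (-δ)) < L := by
      intro k h1 h2
      have h := hlev (i + 1 - k) (by omega) (by omega)
      have e : x + ((i + 1 - k : ℕ) : ℝ) * δ = y + k * (-δ) := by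
        rw [hy, Nat.cast_sub (by omega)]; ring
      rwa [e] at h
    have hli : ∀ k : ℕ, 1 ≤ k → k ≤ i → 𝒢.lev (x + k * δ) < L := fun k h1 h2 =>
      hlev k h1 (by omega)
    have hbi := ihn i (by omega) δ hδ x hWi hli
    have hbm := ihn m (by omega) δ hδ y hWm hlm
    have hgood : 𝒢.good y := 𝒢.good_of_W δ x _ hW (i + 1) hj.1 hj.2.1
    have hly : 𝒢.lev y < L := hlev (i + 1) hj.1 hj.2.1
    obtain ⟨u, hu, hus⟩ := 𝒮.schur_complement y hgood δ hδ m i hWm hWb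
      (fun n' hn' hW' => ihn n' (by omega) δ hδ y hW' fun k h1 h2 => hlm k h1 (by omega))
      (fun n' hn' hW' => ihn n' (by omega) (-δ) hδ' y hW' fun k h1 h2 => hlb k h1 (by omega))
      (by
        have := 𝒢.κ_le_right δ hδ x _ (i + 1) hW hj
        rwa [Nat.add_sub_cancel_left] at this)
      (𝒢.κ_le_back δ hδ x _ (i + 1) hW hj)
      (fun δ hδ n' hn' hW' => ihL _ hly δ hδ y n' hW' fun k h1 h2 =>
        𝒢.lev_short δ hδ y hgood k h1 (by omega))
      (fun δ hδ n' hn' hW' => ihL _ hly δ hδ y n' hW' fun k h1 h2 =>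
        𝒢.lev_long δ hδ y hgood k h1 (by omega))
    refine ⟨hbi, hbm, u, ?_, hus⟩
    have hR : IsUnit (transfer (fun k => chain 𝒮.H δ x (i + 1 + k)) m 0 0) := by
      rw [chain_shift]; exact hbm.1
    rw [transfer_corner_split _ i m hbi.1 hR, chain_shift,
      ← weyl_reverse (chain 𝒮.H δ x) (chain 𝒮.H (-δ) y) i
        fun k _ h2 => chain_reverse 𝒮.H δ x i k h2]
    have h1 := inverse_mul_of_isUnit hbi.1
    have h2 := inverse_mul_of_isUnit hbm.1
    change transfer (chain 𝒮.H δ x) i 0 0 * transfer (chain 𝒮.H δ y) m 0 0 *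
      (𝒮.H y - weyl (chain 𝒮.H (-δ) y) i - weyl (chain 𝒮.H δ y) m) * _ = 1
    generalize Ring.inverse (transfer (chain 𝒮.H δ x) i 0 0) = a at *
    generalize Ring.inverse (transfer (chain 𝒮.H δ y) m 0 0) = b at *
    generalize transfer (chain 𝒮.H δ x) i 0 0 = l at *
    generalize transfer (chain 𝒮.H δ y) m 0 0 = r at *
    linear_combination (l * r * a * b) * hu + (r * b) * h1 + h2
  obtain ⟨j, hj, -⟩ := exists_last_argmax 𝒢.Λ δ x (n := n) hn
  obtain ⟨i, rfl⟩ : ∃ i, j = i + 1 := ⟨j - 1, by have := hj.1; omega⟩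
  obtain ⟨m, hm⟩ : ∃ m, n = i + 1 + m := ⟨n - (i + 1), by have := hj.2.1; omega⟩
  obtain ⟨hbi, hbm, u, hu, hus⟩ := key i m hm hj
  refine ⟨IsUnit.of_mul_eq_one _ hu, ?_, ?_⟩
  · rw [inverse_eq_of_mul_eq_one hu]
    have hprod : ∏ k ∈ Finset.Icc 1 n, 𝒮.η (x + k * δ) =
        𝒮.η (x + ((i + 1 : ℕ) : ℝ) * δ) * ((∏ k ∈ Finset.Icc 1 i, 𝒮.η (x + k * δ)) *
          ∏ k ∈ Finset.Icc 1 m, 𝒮.η (x + ((i + 1 : ℕ) : ℝ) * δ + k * δ)) := by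
      subst hm
      have e : ∀ p : ℕ, ∏ k ∈ Finset.Icc 1 p, 𝒮.η (x + k * δ) =
          ∏ k ∈ Finset.range p, 𝒮.η (x + ((k + 1 : ℕ) : ℝ) * δ) := by
        intro p
        rw [Finset.range_eq_Ico, Finset.prod_Ico_add' (fun k : ℕ => 𝒮.η (x + (k : ℝ) * δ)) 0 p 1]
        rfl
      have e' : ∏ k ∈ Finset.Icc 1 m, 𝒮.η (x + ((i + 1 : ℕ) : ℝ) * δ + k * δ) =
          ∏ k ∈ Finset.range m, 𝒮.η (x + ((i + 1 + k + 1 : ℕ) : ℝ) * δ) := by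
        rw [Finset.range_eq_Ico]
        trans ∏ k ∈ Finset.Ico 0 m, 𝒮.η (x + ((i + 1 : ℕ) : ℝ) * δ + ((k + 1 : ℕ) : ℝ) * δ)
        · rw [Finset.prod_Ico_add'
            (fun k : ℕ => 𝒮.η (x + ((i + 1 : ℕ) : ℝ) * δ + (k : ℝ) * δ)) 0 m 1]
          rfl
        · refine Finset.prod_congr rfl fun k _ => ?_
          congr 1
          push_cast
          ring
      rw [e, e, e', Finset.prod_range_add, Finset.prod_range_succ]
      ring
    rw [hprod]
    refine (N.size_mul _ _).trans (mul_le_mul hus ?_ (N.size_nonneg _) (𝒮.η_pos _).le)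
    exact (N.size_mul _ _).trans (mul_le_mul hbi.2.1 hbm.2.1 (N.size_nonneg _)
      (Finset.prod_nonneg fun k _ => (𝒮.η_pos _).le))
  · intro i' m' hm' hj'
    obtain ⟨hbi', hbm', u', hu', hus'⟩ := key i' m' hm' hj'
    rw [inverse_eq_of_mul_eq_one hu']
    have h1 := inverse_mul_of_isUnit hbi'.1
    have h2 := inverse_mul_of_isUnit hbm'.1
    convert hus' using 2
    linear_combination u' * h1 + u' * (Ring.inverse (transfer (chain 𝒮.H δ x) i' 0 0) *
      transfer (chain 𝒮.H δ x) i' 0 0) * h2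

/-- The main estimate: along every admissible chain the corner of the transfer matrix is
invertible, with inverse bounded by the product of the local bounds. -/
theorem bounded (δ : ℝ) (hδ : δ = α ∨ δ = -α) (x : ℝ) (n : ℕ) (hW : 𝒢.W δ x n) :
    𝒮.Bounded δ x n := by
  have main : ∀ L, ∀ δ, (δ = α ∨ δ = -α) → ∀ x n, 𝒢.W δ x n →
      (∀ k : ℕ, 1 ≤ k → k ≤ n → 𝒢.lev (x + k * δ) < L) → 𝒮.Bounded δ x n := by
    intro L
    induction L using Nat.strong_induction_on with
    | _ L ihL =>
      intro δ hδ x n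
      induction n using Nat.strong_induction_on generalizing δ x with
      | _ n ihn =>
        intro hW hlev
        exact 𝒮.bounded_step L ihL n (fun n' hn' δ hδ x => ihn n' hn' δ hδ x) δ hδ x hW hlev
  refine main ((Finset.Icc 1 n).sup (fun k : ℕ => 𝒢.lev (x + k * δ)) + 1) δ hδ x n hW ?_
  intro k h1 h2
  exact Nat.lt_succ_of_le
    (Finset.le_sup (f := fun k : ℕ => 𝒢.lev (x + k * δ)) (Finset.mem_Icc.2 ⟨h1, h2⟩))

/-- Two truncations of the Weyl function that agree up to a record index are close. -/
theorem size_weyl_sub_record_le (δ : ℝ) (hδ : δ = α ∨ δ = -α) (x : ℝ) (n₁ n₂ : ℕ)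
    (hW₁ : 𝒢.W δ x n₁) (hW₂ : 𝒢.W δ x n₂) (k : ℕ) (hk1 : 1 ≤ k) (hk₁ : k ≤ n₁ + 1)
    (hk₂ : k ≤ n₂ + 1)
    (hrec : ∀ m : ℕ, 1 ≤ m → m < k → 𝒢.Λ (x + m * δ) ≤ 𝒢.Λ (x + k * δ)) :
    N.size (weyl (chain 𝒮.H δ x) n₁ - weyl (chain 𝒮.H δ x) n₂) ≤ 4 * 𝒮.θ ^ k := by
  have h1 := (𝒮.size_weyl_sub_le δ hδ x n₁ hW₁ (fun n' _ h => 𝒮.bounded δ hδ x n' h) k hk1 hk₁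
    hrec).trans (𝒮.geom_tail_le _ _)
  have h2 := (𝒮.size_weyl_sub_le δ hδ x n₂ hW₂ (fun n' _ h => 𝒮.bounded δ hδ x n' h) k hk1 hk₂
    hrec).trans (𝒮.geom_tail_le _ _)
  rw [N.size_sub_comm] at h2
  linarith [N.size_sub_le (weyl (chain 𝒮.H δ x) n₁)
    (weyl (chain 𝒮.H δ x) (k - 1)) (weyl (chain 𝒮.H δ x) n₂)]

end GluedDiagonal

end

section

/-- The distance to the nearest integer. -/
def dst (y : ℝ) : ℝ := |y - round y|

theorem dst_eq_norm (y : ℝ) : dst y = ‖(y : UnitAddCircle)‖ := (UnitAddCircle.norm_eq).symm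

theorem dst_nonneg (y : ℝ) : 0 ≤ dst y := abs_nonneg _

theorem dst_le_half (y : ℝ) : dst y ≤ 1 / 2 := abs_sub_round y

theorem dst_neg (y : ℝ) : dst (-y) = dst y := by
  rw [dst_eq_norm, dst_eq_norm, AddCircle.coe_neg, norm_neg]

theorem dst_add_le (x y : ℝ) : dst (x + y) ≤ dst x + dst y := by
  simp only [dst_eq_norm, AddCircle.coe_add]
  exact norm_add_le _ _

theorem dst_sub_le (x y : ℝ) : dst (x - y) ≤ dst x + dst y := by
  rw [sub_eq_add_neg, ← dst_neg y]; exact dst_add_le _ _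

theorem dst_add_int (y : ℝ) (n : ℤ) : dst (y + n) = dst y := by
  rw [dst, round_add_intCast, dst]; push_cast; congr 1; ring

theorem dst_le_abs_sub_int (y : ℝ) (n : ℤ) : dst y ≤ |y - n| := round_le y n

theorem continuous_dst : Continuous dst := by
  have : dst = fun y : ℝ => ‖(y : UnitAddCircle)‖ := funext dst_eq_norm
  rw [this]
  exact continuous_norm.comp (AddCircle.continuous_mk' 1)

theorem dst_periodic : Function.Periodic dst 1 := fun x => by
  simpa using dst_add_int x 1

theorem dst_eq_abs {y : ℝ} (h : |y| < 1 / 2) : dst y = |y| := by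
  rw [dst, show round y = 0 from ?_]
  · simp
  · rw [round_eq_zero_iff, Set.mem_Ico]
    rw [abs_lt] at h
    constructor <;> linarith

section ContinuedFraction

variable {α : ℝ}

theorem gaussIter_irrational (hα : Irrational α) (n : ℕ) : Irrational (gaussIter α n) := by
  induction n with
  | zero => rw [gaussIter, Int.fract]; exact hα.sub_intCast _
  | succ n ih => rw [gaussIter, Int.fract]; exact ih.inv.sub_intCast _

theorem gaussIter_pos (hα : Irrational α) (n : ℕ) : 0 < gaussIter α n := by
  have h : 0 ≤ gaussIter α n := by cases n <;> exact Int.fract_nonneg _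
  exact lt_of_le_of_ne h (gaussIter_irrational hα n).ne_zero.symm

theorem gaussIter_lt_one (n : ℕ) : gaussIter α n < 1 := by
  cases n <;> exact Int.fract_lt_one _

theorem gaussIter_succ (hα : Irrational α) (n : ℕ) :
    gaussIter α (n + 1) = (gaussIter α n)⁻¹ - cfa α n := by
  rw [gaussIter, cfa, Int.fract, natCast_floor_eq_intCast_floor]
  exact (inv_pos.2 (gaussIter_pos hα n)).le

theorem one_le_cfa (hα : Irrational α) (n : ℕ) : 1 ≤ cfa α n := by
  rw [cfa, Nat.one_le_floor_iff]
  exact (one_le_inv₀ (gaussIter_pos hα n)).2 (gaussIter_lt_one n).le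

/-- Numerators of the continued fraction convergents. -/
def cfp (α : ℝ) : ℕ → ℤ
  | 0 => ⌊α⌋
  | 1 => cfa α 0 * ⌊α⌋ + 1
  | n + 2 => cfa α (n + 1) * cfp α (n + 1) + cfp α n

theorem cfq_pos (hα : Irrational α) (n : ℕ) : 1 ≤ cfq α n := by
  induction n using Nat.strong_induction_on with
  | _ n ih =>
    match n with
    | 0 => exact le_rfl
    | 1 => exact one_le_cfa hα 0
    | n + 2 => rw [cfq]; exact le_add_left (ih n (by omega))

theorem cfq_add_le (hα : Irrational α) (n : ℕ) :
    cfq α (n + 1) + cfq α n ≤ cfq α (n + 1 + 1) := by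
  have h2 : cfq α (n + 1 + 1) = cfa α (n + 1) * cfq α (n + 1) + cfq α n := by rw [cfq]
  rw [h2]
  have := Nat.mul_le_mul_right (cfq α (n + 1)) (one_le_cfa hα (n + 1))
  omega

theorem cfq_le_succ (hα : Irrational α) (n : ℕ) : cfq α n ≤ cfq α (n + 1) := by
  cases n with
  | zero => exact one_le_cfa hα 0
  | succ n => have := cfq_add_le hα n; omega

theorem le_cfq (hα : Irrational α) (n : ℕ) : n ≤ cfq α n := by
  induction n with
  | zero => exact Nat.zero_le _
  | succ n ih =>
    cases n with
    | zero => exact cfq_pos hα 1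
    | succ n => have := cfq_add_le hα n; have := cfq_pos hα n; omega

/-- The signed error of the convergent `p_n / q_n`, multiplied by `q_n`. -/
def cfErr (α : ℝ) (n : ℕ) : ℝ := cfq α n * α - cfp α n

theorem cfErr_succ (hα : Irrational α) (n : ℕ) :
    cfErr α (n + 1) = -(gaussIter α (n + 1) * cfErr α n) := by
  induction n with
  | zero =>
    have h0 : gaussIter α 0 ≠ 0 := (gaussIter_pos hα 0).ne'
    rw [gaussIter_succ hα 0]
    have h1 : cfErr α 0 = gaussIter α 0 := by
      simp only [cfErr, cfq, cfp, gaussIter, Int.fract]; push_cast; ring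
    have h2 : cfErr α 1 = cfa α 0 * gaussIter α 0 - 1 := by
      simp only [cfErr, cfq, cfp, gaussIter, Int.fract]; push_cast; ring
    rw [h1, zero_add, h2]; field_simp; ring
  | succ n ih =>
    have h0 : gaussIter α (n + 1) ≠ 0 := (gaussIter_pos hα (n + 1)).ne'
    have h1 : cfErr α (n + 2) = cfa α (n + 1) * cfErr α (n + 1) + cfErr α n := by
      simp only [cfErr, cfq, cfp]; push_cast; ring
    have h2 : cfErr α n = -((gaussIter α (n + 1))⁻¹ * cfErr α (n + 1)) := by
      rw [ih]; field_simp
    rw [gaussIter_succ hα (n + 1), h1, h2]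
    ring

theorem cf_det (α : ℝ) (n : ℕ) :
    (cfq α n : ℤ) * cfp α (n + 1) - cfq α (n + 1) * cfp α n = (-1) ^ n := by
  induction n with
  | zero => simp only [cfq, cfp]; push_cast; ring
  | succ n ih =>
    have h1 : cfq α (n + 2) = cfa α (n + 1) * cfq α (n + 1) + cfq α n := by rw [cfq]
    have h2 : cfp α (n + 2) = cfa α (n + 1) * cfp α (n + 1) + cfp α n := by rw [cfp]
    rw [h1, h2, pow_succ]
    push_cast
    linear_combination -ih

theorem one_le_cfErr (hα : Irrational α) (n : ℕ) :
    1 ≤ 2 * cfq α (n + 1) * |cfErr α n| := by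
  have hd : (cfq α (n + 1) : ℝ) * cfErr α n - cfq α n * cfErr α (n + 1) = (-1) ^ n := by
    have h := cf_det α n
    have h' : (cfq α n : ℝ) * cfp α (n + 1) - cfq α (n + 1) * cfp α n = (-1) ^ n := by
      exact_mod_cast h
    simp only [cfErr]; linear_combination h'
  have habs : |(cfq α (n + 1) : ℝ) * cfErr α n - cfq α n * cfErr α (n + 1)| = 1 := by
    rw [hd]; simp
  have h1 : |cfErr α (n + 1)| ≤ |cfErr α n| := by
    rw [cfErr_succ hα, abs_neg, abs_mul, abs_of_pos (gaussIter_pos hα _)]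
    exact mul_le_of_le_one_left (abs_nonneg _) (gaussIter_lt_one _).le
  have h2 : (cfq α n : ℝ) ≤ cfq α (n + 1) := by exact_mod_cast cfq_le_succ hα n
  have h3 := abs_sub (cfq α (n + 1) * cfErr α n) ((cfq α n : ℝ) * cfErr α (n + 1))
  rw [habs, abs_mul, abs_mul, Nat.abs_cast, Nat.abs_cast] at h3
  have h4 : (cfq α n : ℝ) * |cfErr α (n + 1)| ≤ cfq α (n + 1) * |cfErr α n| :=
    mul_le_mul h2 h1 (abs_nonneg _) (Nat.cast_nonneg _)
  linarith

/-- The convergents are best approximations. -/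
theorem cfErr_le_dst (hα : Irrational α) (n k : ℕ) (hk : 1 ≤ k) (hkq : k < cfq α (n + 1)) :
    |cfErr α n| ≤ dst (k * α) := by
  set p := round (k * α)
  set e : ℤ := (-1) ^ n with he
  have hee : e * e = 1 := by rw [he, ← mul_pow]; simp
  have hdet := cf_det α n
  rw [← he] at hdet
  set u : ℤ := e * (k * cfp α (n + 1) - cfq α (n + 1) * p) with hu
  set w : ℤ := e * (cfq α n * p - k * cfp α n) with hw
  have hk1 : (k : ℤ) = u * cfq α n + w * cfq α (n + 1) := by
    rw [hu, hw]; linear_combination -(k : ℤ) * hee - (k * e : ℤ) * hdet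
  have hp1 : p = u * cfp α n + w * cfp α (n + 1) := by
    rw [hu, hw]; linear_combination -p * hee - (p * e : ℤ) * hdet
  have hkα : (k : ℝ) * α - p = u * cfErr α n + w * cfErr α (n + 1) := by
    have h1 : (k : ℝ) = u * cfq α n + w * cfq α (n + 1) := by exact_mod_cast hk1
    have h2 : (p : ℝ) = u * cfp α n + w * cfp α (n + 1) := by exact_mod_cast hp1
    rw [h1, h2]; simp only [cfErr]; ring
  have hq1 : (1 : ℤ) ≤ cfq α n := by exact_mod_cast cfq_pos hα n
  have hq2 : (k : ℤ) < cfq α (n + 1) := by exact_mod_cast hkq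
  have hk' : (1 : ℤ) ≤ k := by exact_mod_cast hk
  have huw : (1 ≤ u ∧ w ≤ 0) ∨ (u ≤ -1 ∧ 0 ≤ w) := by
    rcases lt_trichotomy w 0 with h | h | h
    · refine Or.inl ⟨?_, h.le⟩
      by_contra! hc
      nlinarith
    · refine Or.inl ⟨?_, h.le⟩
      by_contra! hc
      rw [h] at hk1
      nlinarith
    · refine Or.inr ⟨?_, h.le⟩
      by_contra! hc
      have : 0 ≤ u := by omega
      nlinarith
  rw [dst, hkα, cfErr_succ hα]
  have hg := gaussIter_pos hα (n + 1)
  have : (u : ℝ) * cfErr α n + w * -(gaussIter α (n + 1) * cfErr α n) =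
      (u - w * gaussIter α (n + 1)) * cfErr α n := by ring
  rw [this, abs_mul]
  refine le_mul_of_one_le_left (abs_nonneg _) ?_
  rcases huw with ⟨h1, h2⟩ | ⟨h1, h2⟩
  · have h1' : (1 : ℝ) ≤ u := by exact_mod_cast h1
    have h2' : (w : ℝ) ≤ 0 := by exact_mod_cast h2
    rw [le_abs]; left; nlinarith
  · have h1' : (u : ℝ) ≤ -1 := by exact_mod_cast h1
    have h2' : (0 : ℝ) ≤ w := by exact_mod_cast h2
    rw [le_abs]; right; nlinarith

theorem inv_cfq_le_dst (hα : Irrational α) (n k : ℕ) (hk : 1 ≤ k) (hkq : k < cfq α n) :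
    1 / (2 * cfq α n) ≤ dst (k * α) := by
  cases n with
  | zero => rw [cfq] at hkq; omega
  | succ n =>
    refine le_trans ?_ (cfErr_le_dst hα n k hk hkq)
    have hq : (0 : ℝ) < cfq α (n + 1) := by exact_mod_cast cfq_pos hα (n + 1)
    rw [div_le_iff₀ (by positivity)]
    linarith [one_le_cfErr hα n]

theorem dst_cfq_le (hα : Irrational α) (n k : ℕ) (hk : 1 ≤ k) (hkq : k < cfq α n) :
    dst (cfq α n * α) ≤ dst (k * α) := by
  cases n with
  | zero => rw [cfq] at hkq; omega
  | succ n =>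
    refine le_trans ?_ (cfErr_le_dst hα n k hk hkq)
    refine (dst_le_abs_sub_int _ (cfp α (n + 1))).trans ?_
    change |cfErr α (n + 1)| ≤ _
    rw [cfErr_succ hα, abs_neg, abs_mul, abs_of_pos (gaussIter_pos hα _)]
    exact mul_le_of_le_one_left (abs_nonneg _) (gaussIter_lt_one _).le

theorem cfq_growth (hα : Irrational α)
    (hSDC : ∃ γ : ℝ, 0 < γ ∧ ∃ τ : ℝ, 0 < τ ∧ ∀ᶠ n in atTop,
      (cfq α (n + 1) : ℝ) ≤ γ⁻¹ * (cfq α n : ℝ) * (Real.log (cfq α n : ℝ)) ^ τ)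
    {b : ℝ} (hb : 1 < b) :
    ∃ C : ℝ, 1 ≤ C ∧ ∀ n, (cfq α (n + 1) : ℝ) ≤ C * (cfq α n : ℝ) ^ b := by
  obtain ⟨γ, hγ, τ, hτ, hev⟩ := hSDC
  obtain ⟨n₀, hn₀⟩ := eventually_atTop.1 hev
  set ε := (b - 1) / τ with hε
  have hε0 : 0 < ε := div_pos (by linarith) hτ
  refine ⟨1 + γ⁻¹ * (1 / ε) ^ τ + ∑ n ∈ Finset.range n₀, (cfq α (n + 1) : ℝ), ?_, ?_⟩
  · have : 0 ≤ ∑ n ∈ Finset.range n₀, (cfq α (n + 1) : ℝ) :=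
      Finset.sum_nonneg fun _ _ => Nat.cast_nonneg _
    have : 0 ≤ γ⁻¹ * (1 / ε) ^ τ := by positivity
    linarith
  intro n
  have hq : (1 : ℝ) ≤ cfq α n := by exact_mod_cast cfq_pos hα n
  have hS : 0 ≤ ∑ n ∈ Finset.range n₀, (cfq α (n + 1) : ℝ) :=
    Finset.sum_nonneg fun _ _ => Nat.cast_nonneg _
  have hT : 0 ≤ γ⁻¹ * (1 / ε) ^ τ := by positivity
  have hqb : 1 ≤ (cfq α n : ℝ) ^ b := Real.one_le_rpow hq (by linarith)
  rcases lt_or_ge n n₀ with h | h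
  · have h1 : (cfq α (n + 1) : ℝ) ≤ ∑ n ∈ Finset.range n₀, (cfq α (n + 1) : ℝ) :=
      Finset.single_le_sum (f := fun n => (cfq α (n + 1) : ℝ))
        (fun _ _ => Nat.cast_nonneg _) (Finset.mem_range.2 h)
    nlinarith
  · have h1 := hn₀ n h
    have hlog : Real.log (cfq α n) ≤ (cfq α n : ℝ) ^ ε / ε :=
      Real.log_le_rpow_div (by linarith) hε0
    have h2 : Real.log (cfq α n) ^ τ ≤ (1 / ε) ^ τ * (cfq α n : ℝ) ^ (b - 1) := by
      calc _ ≤ ((cfq α n : ℝ) ^ ε / ε) ^ τ :=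
            Real.rpow_le_rpow (Real.log_nonneg hq) hlog hτ.le
        _ = (1 / ε * (cfq α n : ℝ) ^ ε) ^ τ := by congr 1; ring
        _ = (1 / ε) ^ τ * (cfq α n : ℝ) ^ (b - 1) := by
            rw [Real.mul_rpow (by positivity) (by positivity), ← Real.rpow_mul (by linarith), hε,
              div_mul_cancel₀ _ hτ.ne']
    have h3 : (cfq α n : ℝ) ^ b = cfq α n * (cfq α n : ℝ) ^ (b - 1) := by
      rw [← Real.rpow_one_add' (by linarith) (by linarith)]; congr 1; ring
    calc _ ≤ γ⁻¹ * (cfq α n : ℝ) * ((1 / ε) ^ τ * (cfq α n : ℝ) ^ (b - 1)) :=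
          h1.trans (by gcongr)
      _ = γ⁻¹ * (1 / ε) ^ τ * (cfq α n : ℝ) ^ b := by rw [h3]; ring
      _ ≤ _ := by gcongr; linarith

end ContinuedFraction

/-- Quantitative Diophantine data of a frequency. -/
structure FreqData (α β : ℝ) where
  cD : ℝ
  cD_pos : 0 < cD
  dioph : ∀ k : ℕ, 1 ≤ k → cD / (k : ℝ) ^ β ≤ dst (k * α)
  Q : ℕ → ℕ
  Q_zero : Q 0 = 1
  Q_succ : ∀ i, 3 * Q i ≤ Q (i + 1)
  dst_ge : ∀ i k, 1 ≤ k → k < Q i → 1 / (2 * Q i : ℝ) ≤ dst (k * α)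
  record : ∀ i k, 1 ≤ k → k < Q i → dst (Q i * α) ≤ dst (k * α)
  CQ : ℝ
  one_le_CQ : 1 ≤ CQ
  Q_growth : ∀ i, (Q (i + 1) : ℝ) ≤ CQ * (Q i : ℝ) ^ β

theorem exists_freqData {α : ℝ} (hα : Irrational α)
    (hSDC : ∃ γ : ℝ, 0 < γ ∧ ∃ τ : ℝ, 0 < τ ∧ ∀ᶠ n in atTop,
      (cfq α (n + 1) : ℝ) ≤ γ⁻¹ * (cfq α n : ℝ) * (Real.log (cfq α n : ℝ)) ^ τ)
    {β : ℝ} (hβ : 1 < β) : Nonempty (FreqData α β) := by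
  set b := β ^ (1 / 3 : ℝ) with hb
  have hb1 : 1 < b := Real.one_lt_rpow hβ (by norm_num)
  have hb3 : b * b * b = β := by
    have h : b ^ (3 : ℕ) = β := by
      rw [hb, ← Real.rpow_natCast, ← Real.rpow_mul (by linarith)]; norm_num
    rw [← h]; ring
  obtain ⟨C, hC1, hC⟩ := cfq_growth hα hSDC hb1
  have hq1 : ∀ n, (1 : ℝ) ≤ cfq α n := fun n => by exact_mod_cast cfq_pos hα n
  have step : ∀ n (D e : ℝ), 1 ≤ D → 0 ≤ e → ∀ m, (cfq α n : ℝ) ≤ D * (cfq α m : ℝ) ^ e →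
      (cfq α (n + 1) : ℝ) ≤ (C * D ^ b) * (cfq α m : ℝ) ^ (e * b) := by
    intro n D e hD he m h
    have hm := hq1 m
    calc _ ≤ C * (cfq α n : ℝ) ^ b := hC n
      _ ≤ C * (D * (cfq α m : ℝ) ^ e) ^ b := by
        have := hq1 n
        gcongr
      _ = _ := by
        rw [Real.mul_rpow (by linarith) (by positivity), ← Real.rpow_mul (by linarith), mul_assoc]
  have hCb : ∀ D, 1 ≤ D → 1 ≤ C * D ^ b := fun D hD =>
    one_le_mul_of_one_le_of_one_le hC1 (Real.one_le_rpow hD (by linarith))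
  refine ⟨⟨1 / (2 * C), by positivity, ?_, fun i => cfq α (3 * i), rfl, ?_, ?_, ?_,
    C * (C * C ^ b) ^ b, hCb _ (hCb _ hC1), ?_⟩⟩
  · intro k hk
    have hex : ∃ n, k < cfq α (n + 1) := ⟨k, by have := le_cfq hα (k + 1); omega⟩
    classical
    set n := Nat.find hex
    have hn : k < cfq α (n + 1) := Nat.find_spec hex
    have hqn : cfq α n ≤ k := by
      rcases Nat.eq_zero_or_pos n with h | h
      · rw [h]; exact hk
      · have := Nat.find_min hex (show n - 1 < n by omega)
        rw [Nat.sub_add_cancel h] at this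
        omega
    refine le_trans ?_ (cfErr_le_dst hα n k hk hn)
    have h1 := one_le_cfErr hα n
    have hk' : (1 : ℝ) ≤ k := by exact_mod_cast hk
    have hqn' : (cfq α n : ℝ) ≤ k := by exact_mod_cast hqn
    have h2 : (cfq α (n + 1) : ℝ) ≤ C * (k : ℝ) ^ β := by
      refine (hC n).trans ?_
      have hbβ : b ≤ β := by nlinarith
      have := hq1 n
      calc C * (cfq α n : ℝ) ^ b ≤ C * (k : ℝ) ^ b := by gcongr
        _ ≤ _ := by gcongr
    rw [div_div, div_le_iff₀ (by positivity)]
    nlinarith [abs_nonneg (cfErr α n)]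
  · intro i
    have h1 := cfq_add_le hα (3 * i)
    have h2 := cfq_add_le hα (3 * i + 1)
    have h3 := cfq_le_succ hα (3 * i)
    have : 3 * (i + 1) = 3 * i + 1 + 1 + 1 := by ring
    simp only [this]
    omega
  · intro i k hk hk'
    exact inv_cfq_le_dst hα (3 * i) k hk hk'
  · intro i k hk hk'
    exact dst_cfq_le hα (3 * i) k hk hk'
  · intro i
    have h1 := hC (3 * i)
    have h2 := step (3 * i + 1) C b hC1 (by linarith) (3 * i) h1
    have h3 := step (3 * i + 2) _ (b * b) (hCb _ hC1) (by positivity) (3 * i) h2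
    rw [hb3] at h3
    exact h3

end

section

/-- A frequency with its Diophantine data and the constant in the definition of admissible
chains. -/
structure Setup (α : ℝ) where
  β : ℝ
  one_lt_β : 1 < β
  F : FreqData α β
  c : ℝ
  c_pos : 0 < c
  c_le : c ≤ F.cD / 8

namespace Setup

variable {α : ℝ} (P : Setup α)

theorem β_pos : 0 < P.β := by linarith [P.one_lt_β]

/-- The exponent of the flatness of the reference function. -/
def σ : ℝ := 1 / P.β ^ 3

/-- The growth exponent of the weight along admissible chains. -/
def γ : ℝ := 1 / P.β ^ 2

theorem σ_pos : 0 < P.σ := by have := P.β_pos; unfold σ; positivity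

theorem γ_pos : 0 < P.γ := by have := P.β_pos; unfold γ; positivity

theorem γ_lt_one : P.γ < 1 := by
  have := P.one_lt_β
  unfold γ
  rw [div_lt_one (by positivity)]
  nlinarith

theorem β_mul_σ : P.β * P.σ = P.γ := by
  have := P.β_pos
  unfold σ γ
  field_simp

/-- The weight. -/
def Λ (y : ℝ) : ℝ := dst y ^ (-P.σ)

theorem dst_le_of_Λ_le {y z : ℝ} (hy : 0 < dst y) (h : P.Λ y ≤ P.Λ z) :
    dst z ≤ dst y := by
  by_contra! hc
  have := Real.rpow_lt_rpow_of_neg hy hc (neg_lt_zero.2 P.σ_pos)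
  exact absurd h (not_le.2 this)

/-- Admissible chains. -/
def W (δ x : ℝ) (n : ℕ) : Prop :=
  ∀ k : ℕ, 1 ≤ k → k ≤ n → P.c / (k : ℝ) ^ P.β ≤ dst (x + k * δ) ∧
    P.c / ((n + 1 - k : ℕ) : ℝ) ^ P.β ≤ dst (x + k * δ)

theorem c_div_pos {k : ℕ} (hk : 1 ≤ k) : 0 < P.c / (k : ℝ) ^ P.β := by
  have h : (0 : ℝ) < k := by exact_mod_cast hk
  have := P.c_pos
  positivity

variable {P} in
theorem W.dst_pos {δ x : ℝ} {n : ℕ} (hW : P.W δ x n) {k : ℕ} (h1 : 1 ≤ k) (h2 : k ≤ n) :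
    0 < dst (x + k * δ) :=
  (P.c_div_pos h1).trans_le (hW k h1 h2).1

theorem dioph' {δ : ℝ} (hδ : δ = α ∨ δ = -α) (k : ℕ) (hk : 1 ≤ k) :
    P.F.cD / (k : ℝ) ^ P.β ≤ dst (k * δ) := by
  rcases hδ with rfl | rfl
  · exact P.F.dioph k hk
  · rw [mul_neg, dst_neg]; exact P.F.dioph k hk

theorem dst_mul_dir {δ : ℝ} (hδ : δ = α ∨ δ = -α) (k : ℝ) : dst (k * δ) = dst (k * α) := by
  rcases hδ with rfl | rfl
  · rfl
  · rw [mul_neg, dst_neg]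

theorem cD_le : P.F.cD ≤ 1 / 2 := by
  have h := P.F.dioph 1 le_rfl
  simp only [Nat.cast_one, Real.one_rpow, div_one] at h
  exact h.trans (dst_le_half _)

variable {P} in
/-- At a site of maximal weight the other sites of an admissible chain keep their distance in
terms of the number of steps in between. -/
theorem W.argmax_gap {δ x : ℝ} (hδ : δ = α ∨ δ = -α) {n j : ℕ} (hW : P.W δ x n)
    (hj : IsArgmax P.Λ δ x n j) {k m : ℕ} (h1 : 1 ≤ k) (h2 : k ≤ n) (hm : 1 ≤ m)
    (h : k = j + m ∨ j = k + m) : P.c / (m : ℝ) ^ P.β ≤ dst (x + k * δ) := by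
  have hle := P.dst_le_of_Λ_le (hW.dst_pos h1 h2) (hj.2.2 k h1 h2)
  have hgap : dst (m * δ) ≤ dst (x + k * δ) + dst (x + j * δ) := by
    rcases h with rfl | rfl
    · have : (m : ℝ) * δ = (x + ((j + m : ℕ) : ℝ) * δ) - (x + j * δ) := by push_cast; ring
      rw [this]; exact dst_sub_le _ _
    · have : (m : ℝ) * δ = -((x + k * δ) - (x + ((k + m : ℕ) : ℝ) * δ)) := by push_cast; ring
      rw [this, dst_neg]; exact dst_sub_le _ _
  have hd := P.dioph' hδ m hm
  have hm' : (0 : ℝ) < (m : ℝ) ^ P.β := Real.rpow_pos_of_pos (by exact_mod_cast hm) _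
  have hc : P.c / (m : ℝ) ^ P.β ≤ P.F.cD / 8 / (m : ℝ) ^ P.β := by gcongr; exact P.c_le
  have hc' : P.F.cD / 8 / (m : ℝ) ^ P.β = P.F.cD / (m : ℝ) ^ P.β / 8 := by ring
  have : 0 < P.F.cD / (m : ℝ) ^ P.β := div_pos P.F.cD_pos hm'
  linarith

variable {P} in
theorem W.left {δ x : ℝ} (hδ : δ = α ∨ δ = -α) {n j : ℕ} (hW : P.W δ x n)
    (hj : IsArgmax P.Λ δ x n j) : P.W δ x (j - 1) := by
  intro k h1 h2
  have := hj.1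
  have := hj.2.1
  exact ⟨(hW k h1 (by omega)).1,
    hW.argmax_gap hδ hj h1 (by omega) (by omega) (Or.inr (by omega))⟩

variable {P} in
theorem W.right {δ x : ℝ} (hδ : δ = α ∨ δ = -α) {n j : ℕ} (hW : P.W δ x n)
    (hj : IsArgmax P.Λ δ x n j) : P.W δ (x + j * δ) (n - j) := by
  intro k h1 h2
  have := hj.1
  have := hj.2.1
  have e : x + j * δ + k * δ = x + ((j + k : ℕ) : ℝ) * δ := by push_cast; ring
  rw [e]
  refine ⟨hW.argmax_gap hδ hj (by omega) (by omega) h1 (Or.inl rfl), ?_⟩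
  have h := (hW (j + k) (by omega) (by omega)).2
  rwa [show n + 1 - (j + k) = n - j + 1 - k by omega] at h

variable {P} in
theorem W.back {δ x : ℝ} (hδ : δ = α ∨ δ = -α) {n j : ℕ} (hW : P.W δ x n)
    (hj : IsArgmax P.Λ δ x n j) : P.W (-δ) (x + j * δ) (j - 1) := by
  intro k h1 h2
  have := hj.1
  have := hj.2.1
  have e : x + j * δ + k * -δ = x + ((j - k : ℕ) : ℝ) * δ := by
    rw [Nat.cast_sub (by omega)]; ring
  rw [e]
  refine ⟨hW.argmax_gap hδ hj (by omega) (by omega) h1 (Or.inr (by omega)), ?_⟩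
  have h := (hW (j - k) (by omega) (by omega)).1
  rwa [show j - 1 + 1 - k = j - k by omega]

/-- The constant in the growth of the weight along admissible chains. -/
def C₀ : ℝ := P.c ^ (-P.σ)

theorem C₀_pos : 0 < P.C₀ := Real.rpow_pos_of_pos P.c_pos _

theorem Λ_le_of_div_le {y : ℝ} {k : ℕ} (hk : 1 ≤ k) (h : P.c / (k : ℝ) ^ P.β ≤ dst y) :
    P.Λ y ≤ P.C₀ * (k : ℝ) ^ P.γ := by
  have hk' : (0 : ℝ) < k := by exact_mod_cast hk
  have h1 := Real.rpow_le_rpow_of_nonpos (P.c_div_pos hk) h (neg_nonpos.2 P.σ_pos.le)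
  refine h1.trans (le_of_eq ?_)
  rw [Real.div_rpow P.c_pos.le (by positivity), ← Real.rpow_mul hk'.le, mul_neg, β_mul_σ,
    Real.rpow_neg hk'.le, div_inv_eq_mul]
  rfl

theorem rpow_γ_le {k : ℕ} (hk : 1 ≤ k) : (k : ℝ) ^ P.γ ≤ k := by
  have hk' : (1 : ℝ) ≤ k := by exact_mod_cast hk
  exact Real.rpow_le_self_of_one_le hk' P.γ_lt_one.le

theorem rpow_concave_gap {γ m l : ℝ} (hγ0 : 0 < γ) (hγ1 : γ < 1) (hm : 0 < m) (hml : m ≤ l) :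
    (m + l) ^ γ + (1 - γ) * m ^ γ ≤ m ^ γ + l ^ γ := by
  have hl : 0 < l := hm.trans_le hml
  have h1 : (m + l) ^ γ = l ^ γ * (1 + m / l) ^ γ := by
    rw [← Real.mul_rpow hl.le (by positivity)]; congr 1; field_simp; ring
  have h0 : 0 ≤ m / l := by positivity
  have h2 : (1 + m / l) ^ γ ≤ 1 + γ * (m / l) :=
    rpow_one_add_le_one_add_mul_self (by linarith) hγ0.le hγ1.le
  have h3 : l ^ γ * (m / l) ≤ m ^ γ := by
    have e1 : l ^ γ = l ^ (γ - 1) * l := by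
      rw [← Real.rpow_add_one hl.ne']; congr 1; ring
    have e2 : m ^ γ = m ^ (γ - 1) * m := by
      rw [← Real.rpow_add_one hm.ne']; congr 1; ring
    have e3 : l ^ γ * (m / l) = l ^ (γ - 1) * m := by rw [e1]; field_simp
    rw [e2, e3]
    have := Real.rpow_le_rpow_of_nonpos hm hml (by linarith : γ - 1 ≤ 0)
    gcongr
  have h4 : l ^ γ * (1 + m / l) ^ γ ≤ l ^ γ * (1 + γ * (m / l)) := by gcongr
  rw [h1]
  nlinarith

/-- The constant in the bound for the sum of the weights. -/
def B : ℝ := P.C₀ / (1 - P.γ)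

theorem B_pos : 0 < P.B := div_pos P.C₀_pos (by linarith [P.γ_lt_one])

theorem sum_Λ_le_aux {δ : ℝ} (hδ : δ = α ∨ δ = -α) (n : ℕ) : ∀ x, P.W δ x n →
    ∑ k ∈ Finset.range n, P.Λ (x + ((k + 1 : ℕ) : ℝ) * δ) ≤
      P.B * ((n + 1 : ℕ) : ℝ) - P.B * ((n + 1 : ℕ) : ℝ) ^ P.γ := by
  induction n using Nat.strong_induction_on with
  | _ n ih =>
    intro x hW
    rcases Nat.eq_zero_or_pos n with rfl | hn
    · simp
    obtain ⟨j, hj, -⟩ := exists_last_argmax P.Λ δ x hn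
    have hWl := hW.left hδ hj
    have hWr := hW.right hδ hj
    have hWj := hW j hj.1 hj.2.1
    obtain ⟨i, rfl⟩ : ∃ i, j = i + 1 := ⟨j - 1, by have := hj.1; omega⟩
    obtain ⟨m, rfl⟩ : ∃ m, n = i + 1 + m := ⟨n - (i + 1), by have := hj.2.1; omega⟩
    rw [Nat.add_sub_cancel] at hWl
    rw [Nat.add_sub_cancel_left] at hWr
    rw [show i + 1 + m + 1 - (i + 1) = m + 1 by omega] at hWj
    have h1 := ih i (by omega) x hWl
    have h2 := ih m (by omega) _ hWr
    have hs1 := P.Λ_le_of_div_le (by omega) hWj.1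
    have hs2 := P.Λ_le_of_div_le (by omega) hWj.2
    rw [Finset.sum_range_add, Finset.sum_range_succ]
    have e : ∑ k ∈ Finset.range m, P.Λ (x + ((i + 1 + k + 1 : ℕ) : ℝ) * δ) =
        ∑ k ∈ Finset.range m, P.Λ (x + ((i + 1 : ℕ) : ℝ) * δ + ((k + 1 : ℕ) : ℝ) * δ) := by
      refine Finset.sum_congr rfl fun k _ => ?_
      congr 1; push_cast; ring
    rw [e]
    have hγ := P.γ_lt_one
    have hBC : P.C₀ = P.B * (1 - P.γ) := by
      unfold B; rw [div_mul_cancel₀ _ (by linarith)]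
    have hcast : ((i + 1 + m + 1 : ℕ) : ℝ) = ((i + 1 : ℕ) : ℝ) + ((m + 1 : ℕ) : ℝ) := by
      push_cast; ring
    rw [hcast]
    have hi : (0 : ℝ) < ((i + 1 : ℕ) : ℝ) := by positivity
    have hm : (0 : ℝ) < ((m + 1 : ℕ) : ℝ) := by positivity
    generalize ((i + 1 : ℕ) : ℝ) = a at *
    generalize ((m + 1 : ℕ) : ℝ) = b at *
    have hB := P.B_pos
    rcases le_total a b with hab | hab
    · have h3 := mul_le_mul_of_nonneg_left (rpow_concave_gap P.γ_pos hγ hi hab) hB.le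
      rw [hBC] at hs1
      linarith
    · have h3 := mul_le_mul_of_nonneg_left (rpow_concave_gap P.γ_pos hγ hm hab) hB.le
      rw [hBC] at hs2
      rw [add_comm a b]
      linarith

theorem sum_Λ_le {δ : ℝ} (hδ : δ = α ∨ δ = -α) (x : ℝ) (n : ℕ) (hW : P.W δ x n) :
    ∑ k ∈ Finset.Icc 1 n, P.Λ (x + k * δ) ≤ P.B * n := by
  have h := P.sum_Λ_le_aux hδ n x hW
  have e : ∑ k ∈ Finset.Icc 1 n, P.Λ (x + k * δ) =
      ∑ k ∈ Finset.range n, P.Λ (x + ((k + 1 : ℕ) : ℝ) * δ) := by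
    rw [Finset.range_eq_Ico, Finset.sum_Ico_add' (fun k : ℕ => P.Λ (x + (k : ℝ) * δ)) 0 n 1]
    rfl
  rw [e]
  have h1 : (1 : ℝ) ≤ ((n + 1 : ℕ) : ℝ) ^ P.γ :=
    Real.one_le_rpow (by push_cast; linarith [Nat.cast_nonneg (α := ℝ) n]) P.γ_pos.le
  have h2 := mul_le_mul_of_nonneg_left h1 P.B_pos.le
  push_cast at h h2 ⊢
  linarith

end Setup

end

section

namespace Setup

variable {α : ℝ} (P : Setup α)

/-- The denominators of the chosen convergents. -/
def Q (i : ℕ) : ℕ := P.F.Q i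

theorem pow_le_Q (i : ℕ) : 3 ^ i ≤ P.Q i := by
  induction i with
  | zero => exact P.F.Q_zero.ge
  | succ i ih => rw [pow_succ]; have := P.F.Q_succ i; unfold Q at *; omega

theorem one_le_Q (i : ℕ) : 1 ≤ P.Q i := (Nat.one_le_pow _ _ (by norm_num)).trans (P.pow_le_Q i)

theorem Q_pos (i : ℕ) : (0 : ℝ) < P.Q i := by exact_mod_cast P.one_le_Q i

theorem one_le_Q_cast (i : ℕ) : (1 : ℝ) ≤ P.Q i := by exact_mod_cast P.one_le_Q i

theorem Q_mono : Monotone P.Q :=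
  monotone_nat_of_le_succ fun i => by have := P.F.Q_succ i; unfold Q; omega

theorem Q_zero : P.Q 0 = 1 := P.F.Q_zero

/-- The scale of the `i`-th plateau. -/
def ℓ (i : ℕ) : ℝ := 1 / (64 * P.Q i)

theorem ℓ_pos (i : ℕ) : 0 < P.ℓ i := by have := P.Q_pos i; unfold ℓ; positivity

theorem ℓ_anti {i j : ℕ} (h : i ≤ j) : P.ℓ j ≤ P.ℓ i := by
  have h1 : (P.Q i : ℝ) ≤ P.Q j := by exact_mod_cast P.Q_mono h
  have := P.Q_pos i
  unfold ℓ
  gcongr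

theorem ℓ_succ_le (i : ℕ) : 3 * P.ℓ (i + 1) ≤ P.ℓ i := by
  have h1 : (3 * P.Q i : ℝ) ≤ P.Q (i + 1) := by exact_mod_cast P.F.Q_succ i
  have h2 := P.Q_pos i
  have h3 := P.Q_pos (i + 1)
  unfold ℓ
  rw [mul_one_div, div_le_div_iff₀ (by positivity) (by positivity)]
  linarith

theorem Q_mul_ℓ (i : ℕ) : P.Q i * P.ℓ i = 1 / 64 := by
  have := P.Q_pos i
  unfold ℓ; field_simp

theorem ℓ_le (i : ℕ) : P.ℓ i ≤ 1 / 64 := by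
  have h := P.ℓ_anti (Nat.zero_le i)
  have h0 : P.ℓ 0 = 1 / 64 := by simp [ℓ, Q_zero]
  linarith

theorem exists_ℓ_lt {d : ℝ} (hd : 0 < d) : ∃ i, 2 * P.ℓ i < d := by
  obtain ⟨i, hi⟩ := exists_pow_lt_of_lt_one hd (show (1 / 3 : ℝ) < 1 by norm_num)
  refine ⟨i, lt_of_le_of_lt ?_ hi⟩
  have h1 : ((3 : ℝ) ^ i) ≤ P.Q i := by exact_mod_cast P.pow_le_Q i
  have h2 : (0 : ℝ) < 3 ^ i := by positivity
  unfold ℓ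
  rw [div_pow, one_pow, mul_one_div, div_le_div_iff₀ (by linarith) h2]
  linarith

theorem ten_ℓ_le_dst {i i' k : ℕ} (hi : i' ≤ i) (hk : 1 ≤ k) (hkQ : k < P.Q i') :
    32 * P.ℓ i ≤ dst (k * α) := by
  refine le_trans ?_ (P.F.dst_ge i' k hk hkQ)
  have h := P.ℓ_anti hi
  have e : 1 / (2 * P.F.Q i' : ℝ) = 32 * P.ℓ i' := by
    have := P.Q_pos i'
    unfold Q at this
    unfold ℓ Q; field_simp; norm_num
  linarith

/-- Close to the singular point the orbit keeps its distance for the next `Q i - 1` steps. -/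
theorem near_dst {δ : ℝ} (hδ : δ = α ∨ δ = -α) {y : ℝ} {i i' k : ℕ} (hy : dst y ≤ 4 * P.ℓ i)
    (hi : i' ≤ i) (hk : 1 ≤ k) (hkQ : k < P.Q i') :
    7 / 8 * dst (k * α) ≤ dst (y + k * δ) := by
  have h1 := P.ten_ℓ_le_dst hi hk hkQ
  have h2 : dst (k * δ) ≤ dst (y + k * δ) + dst y := by
    have := dst_sub_le (y + k * δ) y
    rwa [add_sub_cancel_left] at this
  rw [dst_mul_dir hδ] at h2
  linarith

theorem near_dst_ge {δ : ℝ} (hδ : δ = α ∨ δ = -α) {y : ℝ} {i i' k : ℕ} (hy : dst y ≤ 4 * P.ℓ i)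
    (hi : i' ≤ i) (hk : 1 ≤ k) (hkQ : k < P.Q i') :
    28 * P.ℓ i ≤ dst (y + k * δ) := by
  linarith [P.near_dst hδ hy hi hk hkQ, P.ten_ℓ_le_dst hi hk hkQ]

theorem near_W {δ : ℝ} (hδ : δ = α ∨ δ = -α) {y : ℝ} {i i' : ℕ} (hy : dst y ≤ 4 * P.ℓ i)
    (hi : i' ≤ i) : P.W δ y (P.Q i' - 1) := by
  intro k h1 h2
  have hQ := P.one_le_Q i'
  have hkQ : k < P.Q i' := by omega
  have hn := P.near_dst hδ hy hi h1 hkQ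
  have hbound : ∀ m : ℕ, 1 ≤ m → P.F.cD / (m : ℝ) ^ P.β ≤ 2 * dst (k * α) →
      P.c / (m : ℝ) ^ P.β ≤ dst (y + k * δ) := by
    intro m hm h
    have hm' : (0 : ℝ) < (m : ℝ) ^ P.β := Real.rpow_pos_of_pos (by exact_mod_cast hm) _
    have h1 : P.c / (m : ℝ) ^ P.β ≤ P.F.cD / (m : ℝ) ^ P.β / 8 := by
      rw [div_div, mul_comm, ← div_div]; gcongr; exact P.c_le
    have := dst_nonneg (k * α)
    linarith
  refine ⟨hbound k h1 ?_, hbound _ (by omega) ?_⟩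
  · linarith [P.F.dioph k h1, dst_nonneg (k * α)]
  · have h3 := P.F.dioph (P.Q i' - k) (by omega)
    rw [show P.Q i' - 1 + 1 - k = P.Q i' - k by omega]
    refine h3.trans ?_
    have h4 := P.F.record i' k h1 hkQ
    rw [Nat.cast_sub hkQ.le, sub_mul]
    have h5 := dst_sub_le (P.Q i' * α) (k * α)
    unfold Q at *
    linarith

/-- The level of a point: the number of plateaus it is close to. -/
def lev (y : ℝ) : ℕ := sInf {i : ℕ | 2 * P.ℓ i < dst y}

theorem lt_dst_of_lev {y : ℝ} (hy : 0 < dst y) : 2 * P.ℓ (P.lev y) < dst y :=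
  Nat.sInf_mem (s := {i : ℕ | 2 * P.ℓ i < dst y}) (P.exists_ℓ_lt hy)

theorem lev_le {y : ℝ} {i : ℕ} (h : 2 * P.ℓ i < dst y) : P.lev y ≤ i := Nat.sInf_le h

theorem dst_le_of_lt_lev {y : ℝ} {i : ℕ} (h : i < P.lev y) : dst y ≤ 2 * P.ℓ i := by
  by_contra! hc
  have := P.lev_le hc
  omega

/-- The length of the Weyl functions used away from the current plateau. -/
def short (y : ℝ) : ℕ := P.Q (P.lev y - 2) - 1

/-- The length of the Weyl functions used on the current plateau. -/
def long (y : ℝ) : ℕ := P.Q (P.lev y - 1) - 1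

theorem W_zero (δ y : ℝ) : P.W δ y 0 := fun k h1 h2 => by omega

theorem W_Q_lev {δ : ℝ} (hδ : δ = α ∨ δ = -α) {y : ℝ} {i' : ℕ} (hi : i' ≤ P.lev y - 1) :
    P.W δ y (P.Q i' - 1) := by
  rcases Nat.eq_zero_or_pos (P.lev y) with h | h
  · rw [show i' = 0 by omega, Q_zero]; exact P.W_zero δ y
  · have := P.dst_le_of_lt_lev (show P.lev y - 1 < P.lev y by omega)
    have hl := P.ℓ_pos (P.lev y - 1)
    exact P.near_W hδ (by linarith) hi

theorem lev_site_lt {δ : ℝ} (hδ : δ = α ∨ δ = -α) {y : ℝ} {i' k : ℕ}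
    (hi : i' ≤ P.lev y - 1) (h1 : 1 ≤ k) (h2 : k ≤ P.Q i' - 1) :
    P.lev (y + k * δ) < P.lev y := by
  rcases Nat.eq_zero_or_pos (P.lev y) with h | h
  · rw [show i' = 0 by omega, Q_zero] at h2; omega
  · have h3 := P.dst_le_of_lt_lev (show P.lev y - 1 < P.lev y by omega)
    have hl := P.ℓ_pos (P.lev y - 1)
    have h4 := P.near_dst_ge hδ (y := y) (by linarith) hi h1 (by omega)
    have := P.lev_le (y := y + k * δ) (i := P.lev y - 1) (by linarith)
    omega

theorem dst_site_ge {δ : ℝ} (hδ : δ = α ∨ δ = -α) {y : ℝ} {i' k : ℕ}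
    (hi : i' ≤ P.lev y - 1) (h1 : 1 ≤ k) (h2 : k ≤ P.Q i' - 1) :
    dst y ≤ dst (y + k * δ) := by
  rcases Nat.eq_zero_or_pos (P.lev y) with h | h
  · rw [show i' = 0 by omega, Q_zero] at h2; omega
  · have h3 := P.dst_le_of_lt_lev (show P.lev y - 1 < P.lev y by omega)
    have hl := P.ℓ_pos (P.lev y - 1)
    linarith [P.near_dst_ge hδ (y := y) (by linarith) hi h1 (by omega)]

theorem Q_le_Q_sub_two (L : ℕ) :
    (P.Q L : ℝ) ≤ P.F.CQ ^ (1 + P.β) * (P.Q (L - 2) : ℝ) ^ (P.β ^ 2) := by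
  have hβ := P.one_lt_β
  have hC := P.F.one_le_CQ
  have hβ2 : (1 : ℝ) ≤ P.β ^ 2 := by nlinarith
  have hC1 : P.F.CQ ≤ P.F.CQ ^ (1 + P.β) := Real.self_le_rpow_of_one_le hC (by linarith)
  match L with
  | 0 =>
    simp only [Nat.zero_sub, Q_zero, Nat.cast_one, Real.one_rpow]; linarith
  | 1 =>
    have h := P.F.Q_growth 0
    rw [P.F.Q_zero, Nat.cast_one, Real.one_rpow] at h
    simp only [show 1 - 2 = 0 from rfl, Q_zero, Nat.cast_one, Real.one_rpow]
    unfold Q; linarith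
  | L + 2 =>
    rw [Nat.add_sub_cancel]
    have hQ := P.Q_pos L
    have h1 := P.F.Q_growth L
    have h2 := P.F.Q_growth (L + 1)
    have h3 : (P.F.Q (L + 1) : ℝ) ^ P.β ≤ (P.F.CQ * (P.F.Q L : ℝ) ^ P.β) ^ P.β :=
      Real.rpow_le_rpow (Nat.cast_nonneg _) h1 (by linarith)
    unfold Q at *
    calc _ ≤ P.F.CQ * (P.F.CQ * (P.F.Q L : ℝ) ^ P.β) ^ P.β :=
          h2.trans (by gcongr)
      _ = _ := by
        rw [Real.mul_rpow (by linarith) (by positivity), ← Real.rpow_mul (by positivity),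
          Real.rpow_add (by linarith), Real.rpow_one, ← pow_two, mul_assoc]

/-- The constant in the definition of the record search range. -/
def c' : ℝ := min (P.c ^ (1 / P.β)) ((32 * P.F.CQ ^ (1 + P.β)) ^ (-P.γ))

theorem c'_pos : 0 < P.c' := by
  have h1 := P.c_pos
  have h2 := P.F.one_le_CQ
  unfold c'
  exact lt_min (by positivity) (by positivity)

/-- The record search range. -/
def range (y : ℝ) : ℕ := ⌈P.c' * dst y ^ (-P.γ)⌉₊

open Classical in
/-- The record index. -/
def κ (δ y : ℝ) : ℕ :=
  if h : 1 ≤ P.range y - 1 then (exists_last_argmax P.Λ δ y h).choose else 1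

theorem κ_spec {δ y : ℝ} (h : 1 ≤ P.range y - 1) :
    IsArgmax P.Λ δ y (P.range y - 1) (P.κ δ y) := by
  rw [κ, dif_pos h]; exact (exists_last_argmax P.Λ δ y h).choose_spec.1

theorem κ_pos (δ y : ℝ) : 1 ≤ P.κ δ y := by
  by_cases h : 1 ≤ P.range y - 1
  · exact (P.κ_spec h).1
  · rw [κ, dif_neg h]

theorem κ_record (δ y : ℝ) (m : ℕ) (h1 : 1 ≤ m) (h2 : m < P.κ δ y) :
    P.Λ (y + m * δ) ≤ P.Λ (y + P.κ δ y * δ) := by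
  by_cases h : 1 ≤ P.range y - 1
  · have := P.κ_spec (δ := δ) h
    exact this.2.2 m h1 (by have := this.2.1; omega)
  · rw [κ, dif_neg h] at h2; omega

theorem range_pos {y : ℝ} (hy : 0 < dst y) : 1 ≤ P.range y := by
  have := P.c'_pos
  exact Nat.one_le_ceil_iff.2 (by positivity)

theorem κ_le_range {δ y : ℝ} (hy : 0 < dst y) : P.κ δ y ≤ P.range y := by
  by_cases h : 1 ≤ P.range y - 1
  · have := (P.κ_spec (δ := δ) h).2.1; omega
  · rw [κ, dif_neg h]; exact P.range_pos hy

theorem range_le_of_div_le {y : ℝ} {k : ℕ} (hk : 1 ≤ k)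
    (h : P.c / (k : ℝ) ^ P.β ≤ dst y) : P.range y ≤ k := by
  have hβ := P.β_pos
  have hk' : (0 : ℝ) < k := by exact_mod_cast hk
  have hc := P.c_pos
  have hd : 0 < dst y := (P.c_div_pos hk).trans_le h
  have hd1 : dst y ≤ 1 := (dst_le_half y).trans (by norm_num)
  refine Nat.ceil_le.2 ?_
  have h1 : P.c ≤ dst y * (k : ℝ) ^ P.β := by rwa [div_le_iff₀ (by positivity)] at h
  have h2 : P.c ^ (1 / P.β) ≤ dst y ^ (1 / P.β) * k := by
    have := Real.rpow_le_rpow hc.le h1 (by positivity : 0 ≤ 1 / P.β)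
    rwa [Real.mul_rpow hd.le (by positivity), ← Real.rpow_mul hk'.le, mul_one_div_cancel hβ.ne',
      Real.rpow_one] at this
  have h3 : dst y ^ (1 / P.β) ≤ dst y ^ P.γ := by
    refine Real.rpow_le_rpow_of_exponent_ge hd hd1 ?_
    unfold γ
    have := P.one_lt_β
    gcongr
    nlinarith
  have h4 : P.c' ≤ dst y ^ P.γ * k :=
    (min_le_left _ _).trans (h2.trans (by gcongr))
  rw [Real.rpow_neg hd.le, ← div_eq_mul_inv, div_le_iff₀ (by positivity), mul_comm]
  exact h4

theorem range_le_Q {y : ℝ} (hy : 0 < dst y) : P.range y ≤ P.Q (P.lev y - 2) := by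
  refine Nat.ceil_le.2 ?_
  have hβ := P.β_pos
  have hγ := P.γ_pos
  have hC := P.F.one_le_CQ
  set L := P.lev y
  have hQ := P.Q_pos (L - 2)
  have hQL := P.Q_pos L
  have h1 : (32 * P.F.CQ ^ (1 + P.β) * (P.Q (L - 2) : ℝ) ^ (P.β ^ 2))⁻¹ ≤ dst y := by
    refine le_trans ?_ (P.lt_dst_of_lev hy).le
    have e : 2 * P.ℓ (P.lev y) = (32 * (P.Q L : ℝ))⁻¹ := by
      change 2 * (1 / (64 * (P.Q L : ℝ))) = _
      field_simp; norm_num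
    rw [e]
    refine inv_anti₀ (by positivity) ?_
    rw [mul_assoc]
    linarith [P.Q_le_Q_sub_two L]
  have h2 : dst y ^ (-P.γ) ≤ (32 * P.F.CQ ^ (1 + P.β)) ^ P.γ * P.Q (L - 2) := by
    have := Real.rpow_le_rpow_of_nonpos (by positivity) h1 (neg_nonpos.2 hγ.le)
    refine this.trans (le_of_eq ?_)
    rw [Real.inv_rpow (by positivity), Real.rpow_neg (by positivity), inv_inv,
      Real.mul_rpow (by positivity) (by positivity), ← Real.rpow_mul hQ.le]
    have : P.β ^ 2 * P.γ = 1 := by unfold γ; field_simp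
    rw [this, Real.rpow_one]
  have h3 : P.c' * (32 * P.F.CQ ^ (1 + P.β)) ^ P.γ ≤ 1 := by
    have : P.c' ≤ (32 * P.F.CQ ^ (1 + P.β)) ^ (-P.γ) := min_le_right _ _
    calc _ ≤ (32 * P.F.CQ ^ (1 + P.β)) ^ (-P.γ) * (32 * P.F.CQ ^ (1 + P.β)) ^ P.γ := by gcongr
      _ = 1 := by rw [← Real.rpow_add (by positivity)]; simp
  have hc' := P.c'_pos
  calc _ ≤ P.c' * ((32 * P.F.CQ ^ (1 + P.β)) ^ P.γ * P.Q (L - 2)) := by gcongr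
    _ = P.c' * (32 * P.F.CQ ^ (1 + P.β)) ^ P.γ * P.Q (L - 2) := by ring
    _ ≤ 1 * P.Q (L - 2) := by gcongr
    _ = _ := one_mul _

/-- A record over a range of `m` steps is far out. -/
theorem record_far {δ : ℝ} (hδ : δ = α ∨ δ = -α) {y : ℝ} {m j : ℕ} (hm : 1 ≤ m)
    (hpos : ∀ k : ℕ, 1 ≤ k → k ≤ m → 0 < dst (y + k * δ)) (hj : IsArgmax P.Λ δ y m j) :
    P.F.cD / (j : ℝ) ^ P.β ≤ 2 * dst y + 1 / (m + 1) := by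
  obtain ⟨k, hk0, hkm, hk⟩ := Real.exists_nat_abs_mul_sub_round_le α (n := m) (by omega)
  have h1 := P.dst_le_of_Λ_le (hpos k hk0 hkm) (hj.2.2 k hk0 hkm)
  have h2 : dst (y + k * δ) ≤ dst y + 1 / (m + 1) := by
    refine (dst_add_le _ _).trans ?_
    rw [dst_mul_dir hδ]
    have : dst (k * α) ≤ 1 / (m + 1) := hk
    linarith
  have h3 : dst (j * δ) ≤ dst (y + j * δ) + dst y := by
    have := dst_sub_le (y + j * δ) y
    rwa [add_sub_cancel_left] at this
  linarith [P.dioph' hδ j hj.1]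

/-- The constant in the comparison of the weight with the record index. -/
def C₃ : ℝ := (P.F.cD / (2 + 1 / P.c')) ^ (-(1 / P.β)) + (1 / P.c') ^ (1 / P.β)

theorem Λ_eq_rpow (y : ℝ) : P.Λ y = (dst y ^ (-P.γ)) ^ (1 / P.β) := by
  rw [← Real.rpow_mul (dst_nonneg y), Λ, neg_mul]
  congr 2
  have := P.β_pos
  unfold σ γ
  field_simp

theorem Λ_le_κ {δ : ℝ} (hδ : δ = α ∨ δ = -α) {y : ℝ} (hy : 0 < dst y) :
    P.Λ y ≤ P.C₃ * P.κ δ y := by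
  have hβ := P.β_pos
  have hc' := P.c'_pos
  have hcD := P.F.cD_pos
  have hκ : (1 : ℝ) ≤ P.κ δ y := by exact_mod_cast P.κ_pos δ y
  have hA : 0 < (P.F.cD / (2 + 1 / P.c')) ^ (-(1 / P.β)) := by positivity
  have hB : 0 < (1 / P.c') ^ (1 / P.β) := by positivity
  rw [Λ_eq_rpow, C₃, add_mul]
  set t := dst y ^ (-P.γ) with ht
  have ht0 : 0 < t := by positivity
  have hceil : P.c' * t ≤ P.range y := Nat.le_ceil _
  by_cases h : 1 ≤ P.range y - 1
  · have hsp := P.κ_spec (δ := δ) h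
    have hW : P.W δ y (P.short y) := P.W_Q_lev hδ (by omega)
    have hle := P.range_le_Q hy
    have hfar := P.record_far hδ h (fun k h1 h2 => hW.dst_pos h1 (by
      unfold short; omega)) hsp
    have hM : ((P.range y - 1 : ℕ) : ℝ) + 1 = P.range y := by
      have : P.range y - 1 + 1 = P.range y := by omega
      exact_mod_cast this
    rw [hM] at hfar
    have hd : dst y ≤ 1 / t := by
      rw [ht, Real.rpow_neg hy.le, one_div, inv_inv]
      exact Real.self_le_rpow_of_le_one hy.le ((dst_le_half y).trans (by norm_num)) P.γ_lt_one.le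
    have hr : 1 / (P.range y : ℝ) ≤ 1 / P.c' * (1 / t) := by
      rw [one_div_mul_one_div]
      exact one_div_le_one_div_of_le (by positivity) hceil
    have h5 : P.F.cD / (P.κ δ y : ℝ) ^ P.β ≤ (2 + 1 / P.c') * (1 / t) := by
      rw [add_mul]; linarith
    have h6 : P.F.cD / (2 + 1 / P.c') * t ≤ (P.κ δ y : ℝ) ^ P.β := by
      rw [div_le_iff₀ (by positivity)] at h5
      rw [div_mul_eq_mul_div, div_le_iff₀ (by positivity)]
      calc P.F.cD * t ≤ (2 + 1 / P.c') * (1 / t) * (P.κ δ y : ℝ) ^ P.β * t := by gcongr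
        _ = _ := by field_simp
    have h7 := Real.rpow_le_rpow (by positivity) h6 (by positivity : 0 ≤ 1 / P.β)
    clear_value t
    rw [Real.mul_rpow (by positivity) ht0.le, ← Real.rpow_mul (Nat.cast_nonneg (P.κ δ y)),
      mul_one_div_cancel hβ.ne', Real.rpow_one] at h7
    have h8 : t ^ (1 / P.β) ≤ (P.F.cD / (2 + 1 / P.c')) ^ (-(1 / P.β)) * P.κ δ y := by
      rw [Real.rpow_neg (by positivity), inv_mul_eq_div, le_div_iff₀ (by positivity)]
      linarith
    nlinarith
  · have hr1 : P.range y = 1 := by have := P.range_pos hy; omega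
    rw [hr1, Nat.cast_one] at hceil
    have h1 : t ≤ 1 / P.c' := by rw [le_div_iff₀ hc']; linarith
    have h2 := Real.rpow_le_rpow ht0.le h1 (by positivity : 0 ≤ 1 / P.β)
    nlinarith

/-- The orbit geometry of a frequency, restricted to the points at distance at least `d` from the
singular point. -/
def geom (d : ℝ) : ChainGeometry α where
  Λ := P.Λ
  W δ x n := P.W δ x n ∧ ∀ k : ℕ, 1 ≤ k → k ≤ n → d ≤ dst (x + k * δ)
  lev := P.lev
  good y := 0 < dst y ∧ d ≤ dst y
  short := P.short
  long := P.long
  κ := P.κ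
  B := P.B
  C₀ := P.C₀
  C₃ := P.C₃
  B_nonneg := P.B_pos.le
  C₀_nonneg := P.C₀_pos.le
  good_of_W _ _ _ hW k h1 h2 := ⟨hW.1.dst_pos h1 h2, hW.2 k h1 h2⟩
  W_left _ hδ _ _ _ hW hj := ⟨hW.1.left hδ hj, fun k h1 h2 => hW.2 k h1 (by have := hj.2.1; omega)⟩
  W_right δ hδ x n j hW hj := ⟨hW.1.right hδ hj, fun k h1 h2 => by
    have := hW.2 (j + k) (by omega) (by omega)
    rwa [Nat.cast_add, add_mul, ← add_assoc] at this⟩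
  W_back δ hδ x n j hW hj := ⟨hW.1.back hδ hj, fun k h1 h2 => by
    have := hW.2 (j - k) (by omega) (by have := hj.2.1; omega)
    rwa [Nat.cast_sub (by omega), sub_mul, ← add_sub_assoc, sub_eq_add_neg, ← mul_neg] at this⟩
  sum_le _ hδ x n hW := P.sum_Λ_le hδ x n hW.1
  weight_le _ _ _ _ hW k h1 h2 :=
    (P.Λ_le_of_div_le h1 (hW.1 k h1 h2).1).trans
      (mul_le_mul_of_nonneg_left (P.rpow_γ_le h1) P.C₀_pos.le)
  W_short _ hδ _ hy := ⟨P.W_Q_lev hδ (by omega), fun _ h1 h2 =>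
    hy.2.trans (P.dst_site_ge hδ (by omega) h1 h2)⟩
  W_long _ hδ _ hy := ⟨P.W_Q_lev hδ le_rfl, fun _ h1 h2 =>
    hy.2.trans (P.dst_site_ge hδ le_rfl h1 h2)⟩
  lev_short _ hδ _ _ _ h1 h2 := P.lev_site_lt hδ (by omega) h1 h2
  lev_long _ hδ _ _ _ h1 h2 := P.lev_site_lt hδ le_rfl h1 h2
  κ_pos := P.κ_pos
  κ_record := P.κ_record
  weight_le_κ _ hδ _ hy := P.Λ_le_κ hδ hy.1
  κ_le_short δ _ y hy := by
    have h1 := (P.κ_le_range (δ := δ) hy.1).trans (P.range_le_Q hy.1)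
    have h2 := P.one_le_Q (P.lev y - 2)
    unfold short
    exact h1.trans (by omega)
  κ_le_long δ _ y hy := by
    have h1 := (P.κ_le_range (δ := δ) hy.1).trans (P.range_le_Q hy.1)
    have h2 := P.one_le_Q (P.lev y - 2)
    have h3 := P.Q_mono (show P.lev y - 2 ≤ P.lev y - 1 by omega)
    unfold long
    exact h1.trans (by omega)
  κ_le_right δ _ x n j hW hj := by
    have h := hW.1 j hj.1 hj.2.1
    have h1 := (P.κ_le_range (δ := δ) (hW.1.dst_pos hj.1 hj.2.1)).trans
      (P.range_le_of_div_le (by have := hj.2.1; omega) h.2)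
    have := hj.2.1
    exact h1.trans (by omega)
  κ_le_back δ _ x n j hW hj := by
    have h := hW.1 j hj.1 hj.2.1
    exact (P.κ_le_range (δ := -δ) (hW.1.dst_pos hj.1 hj.2.1)).trans
      (P.range_le_of_div_le hj.1 h.1)

end Setup

end

section

/-- The absolute value as a size function. -/
def absNorm : NeumannNorm ℝ where
  size a := |a|
  size_nonneg := abs_nonneg
  size_zero := abs_zero
  size_add := abs_add_le
  size_neg := abs_neg
  size_mul a b := (abs_mul a b).le
  size_one := abs_one.le
  neumann e he := by
    have h1 := abs_le.1 he
    have h : (1 / 2 : ℝ) ≤ 1 + e := by linarith [h1.1]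
    refine ⟨(1 + e)⁻¹, mul_inv_cancel₀ (by linarith), ?_⟩
    rw [abs_inv, abs_of_pos (by linarith)]
    exact (inv_anti₀ (by norm_num) h).trans (by norm_num)

/-- The Gevrey weights on Taylor coefficients. -/
def gevreyWeight (ρ r : ℝ) (k : ℕ) : ℝ := ρ ^ k * (k.factorial : ℝ) ^ (-r)

theorem gevreyWeight_zero (ρ r : ℝ) : gevreyWeight ρ r 0 = 1 := by simp [gevreyWeight]

theorem gevreyWeight_nonneg {ρ : ℝ} (hρ : 0 ≤ ρ) (r : ℝ) (k : ℕ) : 0 ≤ gevreyWeight ρ r k := by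
  unfold gevreyWeight; positivity

theorem gevreyWeight_add_le {ρ r : ℝ} (hρ : 0 ≤ ρ) (hr : 0 ≤ r) (i j : ℕ) :
    gevreyWeight ρ r (i + j) ≤ gevreyWeight ρ r i * gevreyWeight ρ r j := by
  unfold gevreyWeight
  have h1 : (i.factorial : ℝ) * j.factorial ≤ (i + j).factorial := by
    exact_mod_cast Nat.le_of_dvd (Nat.factorial_pos _)
      (Nat.factorial_mul_factorial_dvd_factorial_add i j)
  have h2 := Real.rpow_le_rpow_of_nonpos (by positivity) h1 (neg_nonpos.2 hr)
  rw [Real.mul_rpow (by positivity) (by positivity)] at h2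
  calc _ ≤ ρ ^ (i + j) * ((i.factorial : ℝ) ^ (-r) * (j.factorial : ℝ) ^ (-r)) := by gcongr
    _ = _ := by rw [pow_add]; ring

/-- The weighted size of the Taylor coefficients up to order `n`. -/
def jetSize (ρ r : ℝ) (n : ℕ) (q : PowerSeries ℝ) : ℝ :=
  ∑ k ∈ Finset.range (n + 1), gevreyWeight ρ r k * |PowerSeries.coeff k q|

theorem jetSize_nonneg {ρ : ℝ} (hρ : 0 ≤ ρ) (r : ℝ) (n : ℕ) (q : PowerSeries ℝ) :
    0 ≤ jetSize ρ r n q :=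
  Finset.sum_nonneg fun k _ => mul_nonneg (gevreyWeight_nonneg hρ r k) (abs_nonneg _)

theorem jetSize_add {ρ : ℝ} (hρ : 0 ≤ ρ) (r : ℝ) (n : ℕ) (q q' : PowerSeries ℝ) :
    jetSize ρ r n (q + q') ≤ jetSize ρ r n q + jetSize ρ r n q' := by
  unfold jetSize
  rw [← Finset.sum_add_distrib]
  refine Finset.sum_le_sum fun k _ => ?_
  rw [← mul_add, map_add]
  exact mul_le_mul_of_nonneg_left (abs_add_le _ _) (gevreyWeight_nonneg hρ r k)

theorem jetSize_neg (ρ r : ℝ) (n : ℕ) (q : PowerSeries ℝ) :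
    jetSize ρ r n (-q) = jetSize ρ r n q := by
  simp [jetSize]

theorem jetSize_one (ρ r : ℝ) (n : ℕ) : jetSize ρ r n 1 = 1 := by
  unfold jetSize
  rw [Finset.sum_eq_single 0]
  · simp [gevreyWeight_zero]
  · intro k _ hk; simp [PowerSeries.coeff_one, hk]
  · simp

theorem jetSize_mul {ρ r : ℝ} (hρ : 0 ≤ ρ) (hr : 0 ≤ r) (n : ℕ) (q q' : PowerSeries ℝ) :
    jetSize ρ r n (q * q') ≤ jetSize ρ r n q * jetSize ρ r n q' := by
  have hw := gevreyWeight_nonneg hρ r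
  set f : ℕ × ℕ → ℝ := fun x => (gevreyWeight ρ r x.1 * |PowerSeries.coeff x.1 q|) *
    (gevreyWeight ρ r x.2 * |PowerSeries.coeff x.2 q'|) with hf
  have hf0 : ∀ x, 0 ≤ f x := fun x => by
    have := hw x.1
    have := hw x.2
    simp only [hf]; positivity
  have h1 : jetSize ρ r n (q * q') ≤
      ∑ k ∈ Finset.range (n + 1), ∑ x ∈ Finset.HasAntidiagonal.antidiagonal k, f x := by
    refine Finset.sum_le_sum fun k _ => ?_
    rw [PowerSeries.coeff_mul]
    calc _ ≤ gevreyWeight ρ r k * ∑ x ∈ Finset.HasAntidiagonal.antidiagonal k,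
            |PowerSeries.coeff x.1 q * PowerSeries.coeff x.2 q'| :=
          mul_le_mul_of_nonneg_left (Finset.abs_sum_le_sum_abs _ _) (hw k)
      _ ≤ _ := by
        rw [Finset.mul_sum]
        refine Finset.sum_le_sum fun x hx => ?_
        rw [← Finset.HasAntidiagonal.mem_antidiagonal.1 hx, abs_mul]
        calc _ ≤ (gevreyWeight ρ r x.1 * gevreyWeight ρ r x.2) *
              (|PowerSeries.coeff x.1 q| * |PowerSeries.coeff x.2 q'|) := by
              gcongr; exact gevreyWeight_add_le hρ hr _ _
          _ = f x := by simp only [hf]; ring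
  refine h1.trans ?_
  unfold jetSize
  rw [Finset.sum_mul_sum, ← Finset.sum_product', Finset.sum_sigma']
  have hinj : ∀ x ∈ (Finset.range (n + 1)).sigma fun k => Finset.HasAntidiagonal.antidiagonal k,
      ∀ y ∈ (Finset.range (n + 1)).sigma fun k => Finset.HasAntidiagonal.antidiagonal k,
      x.2 = y.2 → x = y := by
    rintro ⟨k, x⟩ hx ⟨k', y⟩ hy hxy
    simp only [Finset.mem_sigma, Finset.HasAntidiagonal.mem_antidiagonal] at hx hy
    simp only at hxy
    subst hxy
    rw [← hx.2, ← hy.2]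
  rw [← Finset.sum_image (f := f) (g := fun x : (_ : ℕ) × (ℕ × ℕ) => x.2) hinj]
  refine Finset.sum_le_sum_of_subset_of_nonneg ?_ fun x _ _ => hf0 x
  intro x hx
  simp only [Finset.mem_image, Finset.mem_sigma, Finset.mem_range,
    Finset.HasAntidiagonal.mem_antidiagonal,
    Sigma.exists] at hx
  obtain ⟨k, y, ⟨hk, hy⟩, rfl⟩ := hx
  rw [Finset.mem_product, Finset.mem_range, Finset.mem_range]
  omega

theorem abs_coeff_le_jetSize {ρ : ℝ} (hρ : 0 ≤ ρ) (r : ℝ) {n k : ℕ} (hk : k ≤ n)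
    (q : PowerSeries ℝ) : gevreyWeight ρ r k * |PowerSeries.coeff k q| ≤ jetSize ρ r n q :=
  Finset.single_le_sum (f := fun k => gevreyWeight ρ r k * |PowerSeries.coeff k q|)
    (fun k _ => mul_nonneg (gevreyWeight_nonneg hρ r k) (abs_nonneg _))
    (Finset.mem_range.2 (by omega))

/-- The weighted Taylor coefficient size as a size function. -/
def jetNorm {ρ r : ℝ} (hρ : 0 ≤ ρ) (hr : 0 ≤ r) (n : ℕ) : NeumannNorm (PowerSeries ℝ) where
  size := jetSize ρ r n
  size_nonneg := jetSize_nonneg hρ r n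
  size_zero := by simp [jetSize]
  size_add := jetSize_add hρ r n
  size_neg := jetSize_neg ρ r n
  size_mul := jetSize_mul hρ hr n
  size_one := (jetSize_one ρ r n).le
  neumann e he := by
    have h0 := abs_coeff_le_jetSize hρ r (Nat.zero_le n) e
    rw [gevreyWeight_zero, one_mul, PowerSeries.coeff_zero_eq_constantCoeff_apply] at h0
    have h1 := abs_le.1 (h0.trans he)
    have h2 : PowerSeries.constantCoeff (1 + e) ≠ 0 := by
      rw [map_add, map_one]; linarith [h1.1]
    have h3 := PowerSeries.mul_inv_cancel (1 + e) h2
    refine ⟨(1 + e)⁻¹, h3, ?_⟩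
    set u := (1 + e)⁻¹
    have h4 : u = 1 + -(e * u) := by linear_combination h3
    have h5 := jetSize_add hρ r n 1 (-(e * u))
    rw [← h4, jetSize_neg, jetSize_one] at h5
    have h6 := jetSize_mul hρ hr n e u
    have h7 := jetSize_nonneg hρ r n u
    nlinarith

/-- Smoothness at a point. -/
abbrev SmoothAt (h : ℝ → ℝ) (x : ℝ) : Prop := ContDiffAt ℝ ((⊤ : ℕ∞) : WithTop ℕ∞) h x

theorem SmoothAt.natCast {h : ℝ → ℝ} {x : ℝ} (hx : SmoothAt h x) (n : ℕ) : ContDiffAt ℝ n h x :=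
  hx.of_le (by exact_mod_cast le_top)

/-- The Taylor series at `x`. -/
def jet (h : ℝ → ℝ) (x : ℝ) : PowerSeries ℝ :=
  PowerSeries.mk fun k => iteratedDeriv k h x / k.factorial

theorem coeff_jet (h : ℝ → ℝ) (x : ℝ) (k : ℕ) :
    PowerSeries.coeff k (jet h x) = iteratedDeriv k h x / k.factorial := PowerSeries.coeff_mk _ _

theorem jet_congr {h h' : ℝ → ℝ} {x : ℝ} (e : h =ᶠ[nhds x] h') : jet h x = jet h' x := by
  ext k; rw [coeff_jet, coeff_jet, e.iteratedDeriv_eq]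

theorem jet_add {h h' : ℝ → ℝ} {x : ℝ} (hx : SmoothAt h x) (hx' : SmoothAt h' x) :
    jet (fun z => h z + h' z) x = jet h x + jet h' x := by
  ext k
  rw [map_add, coeff_jet, coeff_jet, coeff_jet,
    iteratedDeriv_fun_add (hx.natCast k) (hx'.natCast k), add_div]

theorem jet_mul {h h' : ℝ → ℝ} {x : ℝ} (hx : SmoothAt h x) (hx' : SmoothAt h' x) :
    jet (fun z => h z * h' z) x = jet h x * jet h' x := by
  ext k
  rw [coeff_jet, iteratedDeriv_fun_mul (hx.natCast k) (hx'.natCast k), PowerSeries.coeff_mul,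
    Finset.Nat.sum_antidiagonal_eq_sum_range_succ_mk, Finset.sum_div]
  refine Finset.sum_congr rfl fun i hi => ?_
  have hi' : i ≤ k := by simpa [Nat.lt_succ_iff] using hi
  rw [coeff_jet, coeff_jet, Nat.cast_choose ℝ hi']
  have h1 := Nat.cast_ne_zero (R := ℝ).2 (Nat.factorial_ne_zero k)
  have h2 := Nat.cast_ne_zero (R := ℝ).2 (Nat.factorial_ne_zero i)
  have h3 := Nat.cast_ne_zero (R := ℝ).2 (Nat.factorial_ne_zero (k - i))
  field_simp

theorem jet_const (c x : ℝ) : jet (fun _ => c) x = PowerSeries.C c := by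
  ext k
  rw [coeff_jet, iteratedDeriv_const, PowerSeries.coeff_C]
  split_ifs with h
  · simp [h]
  · simp

theorem jet_neg (h : ℝ → ℝ) (x : ℝ) : jet (fun z => -h z) x = -jet h x := by
  ext k
  rw [map_neg, coeff_jet, coeff_jet, iteratedDeriv_fun_neg, neg_div]

theorem jet_sub {h h' : ℝ → ℝ} {x : ℝ} (hx : SmoothAt h x) (hx' : SmoothAt h' x) :
    jet (fun z => h z - h' z) x = jet h x - jet h' x := by
  simp only [sub_eq_add_neg]
  rw [jet_add hx hx'.neg, jet_neg]

theorem jet_shift (h : ℝ → ℝ) (x a : ℝ) : jet (fun z => h (z + a)) x = jet h (x + a) := by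
  ext k
  rw [coeff_jet, coeff_jet, iteratedDeriv_comp_add_const]

theorem jet_mul_inv {h : ℝ → ℝ} {x : ℝ} (hx : SmoothAt h x) (h0 : h x ≠ 0) :
    jet h x * jet (fun z => (h z)⁻¹) x = 1 := by
  have hi : SmoothAt (fun z => (h z)⁻¹) x := hx.inv h0
  rw [← jet_mul hx hi, ← map_one (PowerSeries.C), ← jet_const 1 x]
  refine jet_congr ?_
  filter_upwards [hx.continuousAt.eventually_ne h0] with z hz
  exact mul_inv_cancel₀ hz

theorem smoothAt_shift {h : ℝ → ℝ} {x a : ℝ} (hx : SmoothAt h (x + a)) :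
    SmoothAt (fun z => h (z + a)) x :=
  ContDiffAt.comp x hx (contDiffAt_id.add contDiffAt_const)

theorem transfer_succ_zero {R : Type} [CommRing R] (a : ℕ → R) (n : ℕ) (j : Fin 2) :
    transfer a (n + 1) 0 j = a (n + 1) * transfer a n 0 j - transfer a n 1 j := by
  rw [transfer, stepM, Matrix.mul_apply, Fin.sum_univ_two]
  simp [sub_eq_add_neg]

theorem transfer_succ_one {R : Type} [CommRing R] (a : ℕ → R) (n : ℕ) (j : Fin 2) :
    transfer a (n + 1) 1 j = transfer a n 0 j := by
  rw [transfer, stepM, Matrix.mul_apply, Fin.sum_univ_two]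
  simp

theorem smoothAt_jet_transfer {h : ℝ → ℝ} {δ x : ℝ} {n : ℕ}
    (hx : ∀ k : ℕ, 1 ≤ k → k ≤ n → SmoothAt h (x + k * δ)) (i j : Fin 2) :
    SmoothAt (fun z => transfer (chain h δ z) n i j) x ∧
      jet (fun z => transfer (chain h δ z) n i j) x = transfer (chain (jet h) δ x) n i j := by
  induction n generalizing i with
  | zero =>
    refine ⟨contDiffAt_const, ?_⟩
    simp only [transfer]
    rw [jet_const]
    fin_cases i <;> fin_cases j <;> simp
  | succ n ih =>
    have ih' := fun i => ih (fun k h1 h2 => hx k h1 (by omega)) i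
    match i with
    | 0 =>
      simp only [transfer_succ_zero]
      have hs : SmoothAt (fun z => chain h δ z (n + 1)) x :=
        smoothAt_shift (hx (n + 1) (by omega) le_rfl)
      refine ⟨(hs.mul (ih' 0).1).sub (ih' 1).1, ?_⟩
      rw [jet_sub (hs.mul (ih' 0).1) (ih' 1).1, jet_mul hs (ih' 0).1, (ih' 0).2, (ih' 1).2]
      congr 2
      exact jet_shift h x _
    | 1 => simp only [transfer_succ_one]; exact ih' 0

theorem smoothAt_jet_weyl {h : ℝ → ℝ} {δ x : ℝ} {n : ℕ}
    (hx : ∀ k : ℕ, 1 ≤ k → k ≤ n → SmoothAt h (x + k * δ))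
    (h0 : transfer (chain h δ x) n 0 0 ≠ 0) :
    SmoothAt (fun z => weyl (chain h δ z) n) x ∧
      jet (fun z => weyl (chain h δ z) n) x = weyl (chain (jet h) δ x) n := by
  have h1 := smoothAt_jet_transfer hx 0 0
  have h2 := smoothAt_jet_transfer hx 0 1
  simp only [weyl, Ring.inverse_eq_inv']
  have hi : SmoothAt (fun z => (transfer (chain h δ z) n 0 0)⁻¹) x := h1.1.inv h0
  refine ⟨h2.1.neg.mul hi, ?_⟩
  rw [jet_mul h2.1.neg hi, jet_neg, h2.2]
  congr 1
  symm
  apply inverse_eq_of_mul_eq_one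
  rw [← h1.2]
  exact jet_mul_inv h1.1 h0

end

section

theorem iteratedDeriv_re_of_extension {f : ℝ → ℝ} {F : ℂ → ℂ} {x R : ℝ}
    (hF : ∀ z ∈ Metric.ball (x : ℂ) R, DifferentiableAt ℂ F z)
    (hf : ∀ t : ℝ, |t - x| < R → f t = (F t).re) (k : ℕ) :
    ∀ t : ℝ, |t - x| < R → iteratedDeriv k f t = (iteratedDeriv k F t).re := by
  have hmem : ∀ t : ℝ, |t - x| < R → (t : ℂ) ∈ Metric.ball (x : ℂ) R := fun t ht => by
    rw [Metric.mem_ball, dist_eq_norm, ← Complex.ofReal_sub, Complex.norm_real]; exact ht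
  have han : ∀ z ∈ Metric.ball (x : ℂ) R, AnalyticAt ℂ F z := fun z hz =>
    (DifferentiableOn.analyticAt (s := Metric.ball (x : ℂ) R)
      (fun w hw => (hF w hw).differentiableWithinAt) (Metric.isOpen_ball.mem_nhds hz))
  induction k with
  | zero => simpa using hf
  | succ k ih =>
    intro t ht
    have hd : HasDerivAt (iteratedDeriv k F) (iteratedDeriv (k + 1) F t) t := by
      rw [iteratedDeriv_succ]
      have h1 : AnalyticAt ℂ (iteratedDeriv k F) t := by
        rw [iteratedDeriv_eq_iterate]; exact (han _ (hmem t ht)).iterated_deriv k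
      exact h1.differentiableAt.hasDerivAt
    rw [iteratedDeriv_succ]
    have hev : iteratedDeriv k f =ᶠ[nhds t] fun u : ℝ => (iteratedDeriv k F u).re := by
      have : ∀ᶠ u : ℝ in nhds t, |u - x| < R :=
        (continuous_abs.comp (continuous_id.sub continuous_const)).continuousAt.eventually_lt
          continuousAt_const ht
      filter_upwards [this] with u hu using ih u hu
    rw [hev.deriv_eq]
    exact hd.real_of_complex.deriv

/-- Cauchy's estimate for a real function with a bounded holomorphic extension to a disc. -/
theorem abs_iteratedDeriv_le_of_extension {f : ℝ → ℝ} {F : ℂ → ℂ} {x R M : ℝ} (hR : 0 < R)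
    (hF : ∀ z ∈ Metric.closedBall (x : ℂ) R, DifferentiableAt ℂ F z)
    (hM : ∀ z ∈ Metric.closedBall (x : ℂ) R, ‖F z‖ ≤ M)
    (hf : ∀ t : ℝ, |t - x| < R → f t = (F t).re) (k : ℕ) :
    |iteratedDeriv k f x| ≤ k.factorial * M / R ^ k := by
  rw [iteratedDeriv_re_of_extension (fun z hz => hF z (Metric.ball_subset_closedBall hz)) hf k x
    (by simpa using hR)]
  refine (Complex.abs_re_le_norm _).trans ?_
  refine Complex.norm_iteratedDeriv_le_of_forall_mem_sphere_norm_le k hR ?_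
    fun z hz => hM z (Metric.sphere_subset_closedBall hz)
  refine DifferentiableOn.diffContOnCl fun z hz => (hF z ?_).differentiableWithinAt
  exact Metric.closure_ball_subset_closedBall hz

theorem geom_half_le {t : ℝ} (h0 : 0 ≤ t) (h : t ≤ 1 / 2) (n : ℕ) :
    ∑ k ∈ Finset.range n, t ^ k ≤ 2 := by
  have h1 := geom_sum_mul_neg t n
  have h2 : 0 ≤ t ^ n := by positivity
  have h3 : 0 ≤ ∑ k ∈ Finset.range n, t ^ k := Finset.sum_nonneg fun k _ => by positivity
  nlinarith

/-- Derivative bounds turn into bounds for the jet size. -/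
theorem jetSize_jet_le {f : ℝ → ℝ} {x R M ρ r : ℝ} (hR : 0 < R) (hM : 0 ≤ M)
    (hρ : 0 ≤ ρ) (hρR : ρ ≤ R / 2)
    (h : ∀ k : ℕ, |iteratedDeriv k f x| ≤ (k.factorial : ℝ) ^ (1 + r) * M / R ^ k) (n : ℕ) :
    jetSize ρ r n (jet f x) ≤ 2 * M := by
  have h1 : jetSize ρ r n (jet f x) ≤ ∑ k ∈ Finset.range (n + 1), (ρ / R) ^ k * M := by
    refine Finset.sum_le_sum fun k _ => ?_
    have hf : (0 : ℝ) < k.factorial := by exact_mod_cast Nat.factorial_pos k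
    rw [coeff_jet, abs_div, abs_of_pos hf, gevreyWeight]
    calc _ ≤ ρ ^ k * (k.factorial : ℝ) ^ (-r) *
          ((k.factorial : ℝ) ^ (1 + r) * M / R ^ k / k.factorial) := by
          gcongr; exact h k
      _ = (ρ / R) ^ k * M * ((k.factorial : ℝ) ^ (-r) * (k.factorial : ℝ) ^ (1 + r) /
            k.factorial) := by
          rw [div_pow]; ring
      _ = _ := by
        rw [← Real.rpow_add hf, show -r + (1 + r) = 1 by ring, Real.rpow_one, div_self hf.ne',
          mul_one]
  refine h1.trans ?_
  rw [← Finset.sum_mul]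
  refine mul_le_mul_of_nonneg_right (geom_half_le (by positivity) ?_ _) hM
  rw [div_le_iff₀ hR]; linarith

theorem jetSize_mono {ρ ρ' r : ℝ} (hρ : 0 ≤ ρ) (h : ρ ≤ ρ') (n : ℕ) (q : PowerSeries ℝ) :
    jetSize ρ r n q ≤ jetSize ρ' r n q := by
  unfold jetSize gevreyWeight
  gcongr

theorem jetSize_C (ρ r c : ℝ) (n : ℕ) (q : PowerSeries ℝ) :
    jetSize ρ r n (PowerSeries.C c * q) = |c| * jetSize ρ r n q := by
  unfold jetSize
  rw [Finset.mul_sum]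
  refine Finset.sum_congr rfl fun k _ => ?_
  rw [PowerSeries.coeff_C_mul, abs_mul]; ring

section Reference

variable {σ : ℝ}

/-- The reference function, flat at the integers. -/
def flat (σ x : ℝ) : ℝ := Real.exp (-|Real.sin (Real.pi * x)| ^ (-σ))

theorem flat_pos (σ x : ℝ) : 0 < flat σ x := Real.exp_pos _

theorem flat_periodic (σ : ℝ) : Function.Periodic (flat σ) 1 := fun x => by
  rw [flat, mul_add, mul_one, Real.sin_add_pi, abs_neg, flat]

theorem abs_sin_pi_eq (x : ℝ) :
    |Real.sin (Real.pi * x)| = |Real.sin (Real.pi * (x - round x))| := by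
  rw [mul_sub, mul_comm Real.pi (round x : ℝ), Real.sin_sub_int_mul_pi, abs_mul, abs_zpow]
  simp

theorem two_dst_le_sin (x : ℝ) : 2 * dst x ≤ |Real.sin (Real.pi * x)| := by
  rw [abs_sin_pi_eq]
  have hp := Real.pi_pos
  have h : |Real.pi * (x - round x)| ≤ Real.pi / 2 := by
    rw [abs_mul, abs_of_pos hp]; have := dst_le_half x; unfold dst at this; nlinarith
  have h2 := Real.mul_abs_le_abs_sin h
  rw [abs_mul, abs_of_pos hp, ← mul_assoc, div_mul_cancel₀ _ hp.ne'] at h2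
  exact h2

theorem sin_le_pi_dst (x : ℝ) : |Real.sin (Real.pi * x)| ≤ Real.pi * dst x := by
  rw [abs_sin_pi_eq]
  refine Real.abs_sin_le_abs.trans ?_
  rw [abs_mul, abs_of_pos Real.pi_pos, dst]

theorem norm_sin_le {w : ℂ} (hw : ‖w‖ ≤ 1) : ‖Complex.sin w‖ ≤ 2 * ‖w‖ := by
  have h1 := Complex.norm_exp_sub_one_le (x := -w * Complex.I) (by simpa using hw)
  have h2 := Complex.norm_exp_sub_one_le (x := w * Complex.I) (by simpa using hw)
  simp only [norm_mul, norm_neg, Complex.norm_I, mul_one] at h1 h2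
  have e : Complex.sin w = ((Complex.exp (-w * Complex.I) - 1) - (Complex.exp (w * Complex.I) - 1))
      * Complex.I / 2 := by rw [Complex.sin]; ring
  rw [e, norm_div, norm_mul, Complex.norm_I, mul_one, Complex.norm_two]
  have := norm_sub_le (Complex.exp (-w * Complex.I) - 1) (Complex.exp (w * Complex.I) - 1)
  linarith

theorem norm_cos_sub_one_le {w : ℂ} (hw : ‖w‖ ≤ 1) : ‖Complex.cos w - 1‖ ≤ 2 * ‖w‖ := by
  have h1 := Complex.norm_exp_sub_one_le (x := -w * Complex.I) (by simpa using hw)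
  have h2 := Complex.norm_exp_sub_one_le (x := w * Complex.I) (by simpa using hw)
  simp only [norm_mul, norm_neg, Complex.norm_I, mul_one] at h1 h2
  have e : Complex.cos w - 1 = ((Complex.exp (w * Complex.I) - 1) +
      (Complex.exp (-w * Complex.I) - 1)) / 2 := by rw [Complex.cos]; ring
  rw [e, norm_div, Complex.norm_two]
  have := norm_add_le (Complex.exp (w * Complex.I) - 1) (Complex.exp (-w * Complex.I) - 1)
  linarith

theorem sin_ne_zero_of_dst {x : ℝ} (hx : 0 < dst x) : Real.sin (Real.pi * x) ≠ 0 := fun h => by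
  have := two_dst_le_sin x
  rw [h, abs_zero] at this
  linarith

theorem norm_sin_ratio_sub_one_le {x : ℝ} (hx : 0 < dst x) {z : ℂ}
    (hz : z ∈ Metric.closedBall (x : ℂ) (dst x / 32)) :
    ‖Complex.sin (Real.pi * z) / Complex.sin (Real.pi * x) - 1‖ ≤ 1 / 4 := by
  have hp := Real.pi_pos
  have hp4 : Real.pi < 3.15 := Real.pi_lt_d2
  have hd := dst_le_half x
  set h : ℂ := z - x with hh
  have hz' : ‖h‖ ≤ dst x / 32 := by rwa [Metric.mem_closedBall, dist_eq_norm] at hz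
  set w : ℂ := Real.pi * h with hwdef
  have hw : ‖w‖ ≤ Real.pi * (dst x / 32) := by
    rw [hwdef, norm_mul, Complex.norm_real, Real.norm_of_nonneg hp.le]; gcongr
  have hw1 : ‖w‖ ≤ 1 := by nlinarith
  have hs0 : Complex.sin (Real.pi * x) ≠ 0 := by
    rw [← Complex.ofReal_mul, ← Complex.ofReal_sin]
    exact_mod_cast sin_ne_zero_of_dst hx
  have e : Complex.sin (Real.pi * z) = Complex.sin (Real.pi * x) * Complex.cos w +
      Complex.cos (Real.pi * x) * Complex.sin w := by
    rw [← Complex.sin_add, hwdef, hh]; ring_nf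
  have e2 : Complex.sin (Real.pi * z) / Complex.sin (Real.pi * x) - 1 =
      (Complex.cos w - 1) + Complex.cos (Real.pi * x) * Complex.sin w /
        Complex.sin (Real.pi * x) := by
    rw [e]; field_simp; ring
  rw [e2]
  have h1 := norm_cos_sub_one_le hw1
  have h2 := norm_sin_le hw1
  have h3 : ‖Complex.cos (Real.pi * x)‖ ≤ 1 := by
    rw [← Complex.ofReal_mul, ← Complex.ofReal_cos, Complex.norm_real]
    exact Real.abs_cos_le_one _
  have h4 : 2 * dst x ≤ ‖Complex.sin (Real.pi * x)‖ := by
    rw [← Complex.ofReal_mul, ← Complex.ofReal_sin, Complex.norm_real]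
    exact two_dst_le_sin x
  have h5 : ‖Complex.cos (Real.pi * x) * Complex.sin w / Complex.sin (Real.pi * x)‖ ≤
      1 * (2 * (Real.pi * (dst x / 32))) / (2 * dst x) := by
    rw [norm_div, norm_mul]
    gcongr
    exact h2.trans (by gcongr)
  have h6 : 1 * (2 * (Real.pi * (dst x / 32))) / (2 * dst x) = Real.pi / 32 := by field_simp
  rw [h6] at h5
  refine (norm_add_le _ _).trans ?_
  nlinarith

theorem norm_cpow_sub_one_le (h0 : 0 < σ) (h1 : σ < 1) {u : ℂ} (hu : ‖u - 1‖ ≤ 1 / 4) :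
    ‖u ^ (-(σ : ℂ)) - 1‖ ≤ 3 / 4 ∧ u ∈ Complex.slitPlane := by
  have hre := abs_le.1 ((Complex.abs_re_le_norm (u - 1)).trans hu)
  rw [Complex.sub_re, Complex.one_re] at hre
  have hpos : 0 < u.re := by linarith [hre.1]
  have hs : u ∈ Complex.slitPlane := Or.inl hpos
  refine ⟨?_, hs⟩
  have hne : u ≠ 0 := Complex.slitPlane_ne_zero hs
  have hlog := Complex.norm_log_one_add_half_le_self (z := u - 1) (by linarith)
  rw [add_sub_cancel] at hlog
  have hlog2 : ‖Complex.log u * -(σ : ℂ)‖ ≤ 3 / 8 := by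
    rw [norm_mul, norm_neg, Complex.norm_real, Real.norm_of_nonneg h0.le]
    nlinarith [norm_nonneg (Complex.log u)]
  rw [Complex.cpow_def_of_ne_zero hne]
  refine (Complex.norm_exp_sub_one_le (by linarith)).trans ?_
  linarith

/-- The holomorphic extension of the exponent of the reference function. -/
theorem flat_extension (h0 : 0 < σ) (h1 : σ < 1) {x : ℝ} (hx : 0 < dst x) (b : ℝ) {z : ℂ}
    (hz : z ∈ Metric.closedBall (x : ℂ) (dst x / 32)) :
    DifferentiableAt ℂ (fun z : ℂ => Complex.exp (b * (|Real.sin (Real.pi * x)| ^ (-σ) : ℝ) *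
      (Complex.sin (Real.pi * z) / Complex.sin (Real.pi * x)) ^ (-(σ : ℂ)))) z ∧
    |((Complex.sin (Real.pi * z) / Complex.sin (Real.pi * x)) ^ (-(σ : ℂ))).re - 1| ≤ 3 / 4 := by
  have h2 := norm_cpow_sub_one_le h0 h1 (norm_sin_ratio_sub_one_le hx hz)
  constructor
  · refine DifferentiableAt.cexp (DifferentiableAt.const_mul ?_ _)
    refine DifferentiableAt.cpow_const ?_ h2.2
    refine DifferentiableAt.div_const ?_ _
    exact (Complex.differentiable_sin _).comp z (differentiableAt_id.const_mul _)
  · have := (Complex.abs_re_le_norm _).trans h2.1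
    rwa [Complex.sub_re, Complex.one_re] at this

theorem flat_extension_eq {x : ℝ} (hx : 0 < dst x) (b t : ℝ)
    (ht : |t - x| ≤ dst x / 32) :
    Real.exp (b * |Real.sin (Real.pi * t)| ^ (-σ)) =
      (Complex.exp (b * (|Real.sin (Real.pi * x)| ^ (-σ) : ℝ) *
      (Complex.sin (Real.pi * t) / Complex.sin (Real.pi * x)) ^ (-(σ : ℂ)))).re := by
  have hz : (t : ℂ) ∈ Metric.closedBall (x : ℂ) (dst x / 32) := by
    rw [Metric.mem_closedBall, dist_eq_norm, ← Complex.ofReal_sub, Complex.norm_real]; exact ht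
  have h1 := norm_sin_ratio_sub_one_le hx hz
  have hs0 := sin_ne_zero_of_dst hx
  rw [← Complex.ofReal_mul Real.pi t, ← Complex.ofReal_mul Real.pi x, ← Complex.ofReal_sin,
    ← Complex.ofReal_sin, ← Complex.ofReal_div] at h1 ⊢
  set q := Real.sin (Real.pi * t) / Real.sin (Real.pi * x) with hq
  have h2 : |q - 1| ≤ 1 / 4 := by
    rw [← Complex.ofReal_one, ← Complex.ofReal_sub, Complex.norm_real] at h1; exact h1
  have hq0 : 0 < q := by linarith [(abs_le.1 h2).1]
  rw [← Complex.ofReal_neg, ← Complex.ofReal_cpow hq0.le, ← Complex.ofReal_mul,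
    ← Complex.ofReal_mul, Complex.exp_ofReal_re]
  congr 1
  rw [mul_assoc]
  congr 1
  rw [← Real.mul_rpow (abs_nonneg _) hq0.le]
  congr 1
  rw [← abs_of_pos hq0, ← abs_mul, hq, mul_div_cancel₀ _ hs0]

theorem sin_rpow_le (h0 : 0 < σ) {x : ℝ} (hx : 0 < dst x) :
    |Real.sin (Real.pi * x)| ^ (-σ) ≤ dst x ^ (-σ) :=
  Real.rpow_le_rpow_of_nonpos hx (by linarith [two_dst_le_sin x]) (neg_nonpos.2 h0.le)

theorem le_sin_rpow (h0 : 0 < σ) (h1 : σ < 1) {x : ℝ} (hx : 0 < dst x) :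
    dst x ^ (-σ) / 4 ≤ |Real.sin (Real.pi * x)| ^ (-σ) := by
  have hs := abs_pos.2 (sin_ne_zero_of_dst hx)
  have hp := Real.pi_lt_four
  have h2 : |Real.sin (Real.pi * x)| ≤ 4 * dst x := (sin_le_pi_dst x).trans (by gcongr)
  have h3 := Real.rpow_le_rpow_of_nonpos hs h2 (neg_nonpos.2 h0.le)
  rw [Real.mul_rpow (by norm_num) hx.le] at h3
  have h4 : (4 : ℝ) ^ (-1 : ℝ) ≤ 4 ^ (-σ) :=
    Real.rpow_le_rpow_of_exponent_le (by norm_num) (by linarith)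
  rw [Real.rpow_neg_one] at h4
  have : 0 < dst x ^ (-σ) := by positivity
  nlinarith

theorem jetSize_flat_le (h0 : 0 < σ) (h1 : σ < 1) {x ρ r : ℝ} (hx : 0 < dst x) (hr : 0 ≤ r)
    (hρ : 0 ≤ ρ) (hρx : ρ ≤ dst x / 64) (n : ℕ) :
    jetSize ρ r n (jet (flat σ) x) ≤ 2 * Real.exp (-(dst x ^ (-σ) / 16)) := by
  refine jetSize_jet_le (R := dst x / 32) (by positivity) (Real.exp_pos _).le hρ (by linarith)
    (fun k => ?_) n
  refine (abs_iteratedDeriv_le_of_extension (f := flat σ) (R := dst x / 32)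
    (M := Real.exp (-(dst x ^ (-σ) / 16))) (by positivity)
    (fun z hz => (flat_extension h0 h1 hx (-1) hz).1) (fun z hz => ?_) (fun t ht => ?_) k).trans ?_
  · rw [Complex.norm_exp, Real.exp_le_exp]
    have h2 := (abs_le.1 (flat_extension h0 h1 hx (-1) hz).2).1
    have h3 := le_sin_rpow h0 h1 hx
    rw [← Complex.ofReal_mul, Complex.re_ofReal_mul]
    have : 0 < dst x ^ (-σ) := by positivity
    nlinarith
  · rw [← flat_extension_eq hx (-1) t ht.le, flat, neg_one_mul]
  · have : (1 : ℝ) ≤ k.factorial := by exact_mod_cast Nat.factorial_pos k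
    gcongr
    exact Real.self_le_rpow_of_one_le this (by linarith)

theorem jetSize_flat_inv_le (h0 : 0 < σ) (h1 : σ < 1) {x ρ r : ℝ} (hx : 0 < dst x) (hr : 0 ≤ r)
    (hρ : 0 ≤ ρ) (hρx : ρ ≤ dst x / 64) (n : ℕ) :
    jetSize ρ r n (jet (fun z => (flat σ z)⁻¹) x) ≤ Real.exp (3 * dst x ^ (-σ)) := by
  have hL : 1 ≤ dst x ^ (-σ) :=
    Real.one_le_rpow_of_pos_of_le_one_of_nonpos hx ((dst_le_half x).trans (by norm_num))
      (neg_nonpos.2 h0.le)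
  have h2 : 2 * Real.exp (2 * dst x ^ (-σ)) ≤ Real.exp (3 * dst x ^ (-σ)) := by
    have h3 : 2 ≤ Real.exp (dst x ^ (-σ)) := by linarith [Real.add_one_le_exp (dst x ^ (-σ))]
    rw [show 3 * dst x ^ (-σ) = dst x ^ (-σ) + 2 * dst x ^ (-σ) by ring, Real.exp_add]
    gcongr
  refine le_trans ?_ h2
  refine jetSize_jet_le (R := dst x / 32) (by positivity) (Real.exp_pos _).le hρ (by linarith)
    (fun k => ?_) n
  refine (abs_iteratedDeriv_le_of_extension (f := fun z => (flat σ z)⁻¹) (R := dst x / 32)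
    (M := Real.exp (2 * dst x ^ (-σ))) (by positivity)
    (fun z hz => (flat_extension h0 h1 hx 1 hz).1) (fun z hz => ?_) (fun t ht => ?_) k).trans ?_
  · rw [Complex.norm_exp, Real.exp_le_exp]
    have h2 := (abs_le.1 (flat_extension h0 h1 hx 1 hz).2).2
    have h3 := sin_rpow_le h0 hx
    have h4 : 0 ≤ |Real.sin (Real.pi * x)| ^ (-σ) := by positivity
    rw [← Complex.ofReal_mul, Complex.re_ofReal_mul]
    nlinarith
  · rw [← flat_extension_eq hx 1 t ht.le, flat, ← Real.exp_neg, neg_neg, one_mul]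
  · have : (1 : ℝ) ≤ k.factorial := by exact_mod_cast Nat.factorial_pos k
    gcongr
    exact Real.self_le_rpow_of_one_le this (by linarith)

theorem smoothAt_flat (σ : ℝ) {x : ℝ} (hx : 0 < dst x) : SmoothAt (flat σ) x := by
  have h := sin_ne_zero_of_dst hx
  have h1 : SmoothAt (fun t => Real.sin (Real.pi * t)) x :=
    (Real.contDiff_sin.comp (contDiff_const.mul contDiff_id)).contDiffAt
  exact (Real.contDiff_exp.contDiffAt.comp x
    ((h1.abs h).rpow_const_of_ne (p := -σ) (abs_ne_zero.2 h)).neg)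

end Reference

end

section

section Bump

theorem pow_mul_exp_neg_le {p : ℕ} (hp : 1 ≤ p) {t : ℝ} (ht : 0 ≤ t) (k : ℕ) :
    t ^ k * Real.exp (-(t ^ p / 2)) ≤ (k.factorial : ℝ) ^ (1 / (p : ℝ)) * 2 ^ k := by
  set y : ℝ := t ^ p / 2 with hy
  have hy0 : 0 ≤ y := by positivity
  have hp0 : (p : ℝ) ≠ 0 := by exact_mod_cast (by omega : p ≠ 0)
  rw [Real.exp_neg, ← div_eq_mul_inv, div_le_iff₀ (Real.exp_pos _)]
  refine le_of_pow_le_pow_left₀ (n := p) (by omega) (by positivity) ?_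
  have h1 : (t ^ k) ^ p = 2 ^ k * y ^ k := by
    rw [← pow_mul, mul_comm k p, pow_mul, ← mul_pow, hy]; congr 1; ring
  have h2 := Real.pow_div_factorial_le_exp y hy0 k
  rw [div_le_iff₀ (by positivity)] at h2
  have h3 : ((k.factorial : ℝ) ^ (1 / (p : ℝ))) ^ p = k.factorial := by
    rw [← Real.rpow_natCast, ← Real.rpow_mul (by positivity), one_div_mul_cancel hp0, Real.rpow_one]
  rw [h1, mul_pow, mul_pow, h3]
  have h4 : Real.exp y ≤ Real.exp y ^ p :=
    le_self_pow₀ (Real.one_le_exp hy0) (by omega)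
  have h5 : (2 : ℝ) ^ k ≤ (2 ^ k) ^ p :=
    le_self_pow₀ (one_le_pow₀ (by norm_num)) (by omega)
  calc (2 : ℝ) ^ k * y ^ k ≤ (2 ^ k) ^ p * (Real.exp y ^ p * k.factorial) := by
        gcongr; exact h2.trans (by gcongr)
    _ = _ := by ring

/-- The one-sided flat function `exp (-x ^ (-p))`, for odd `p`. -/
def glue (p : ℕ) (x : ℝ) : ℝ := expNegInvGlue (x ^ p)

theorem contDiff_glue (p : ℕ) : ContDiff ℝ ((⊤ : ℕ∞) : WithTop ℕ∞) (glue p) :=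
  expNegInvGlue.contDiff.comp (contDiff_id.pow p)

theorem glue_nonneg (p : ℕ) (x : ℝ) : 0 ≤ glue p x := expNegInvGlue.nonneg _

theorem glue_of_nonpos {p : ℕ} (hp : Odd p) {x : ℝ} (hx : x ≤ 0) : glue p x = 0 :=
  expNegInvGlue.zero_of_nonpos (hp.pow_nonpos hx)

theorem glue_of_pos (p : ℕ) {x : ℝ} (hx : 0 < x) : glue p x = Real.exp (-(x ^ p)⁻¹) := by
  simp [glue, expNegInvGlue, not_le.2 (pow_pos hx p)]

theorem exists_glue_radius (p : ℕ) : ∃ ε : ℝ, 0 < ε ∧ ∀ u : ℂ, ‖u - 1‖ ≤ ε →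
    u ≠ 0 ∧ ‖(u ^ p)⁻¹ - 1‖ ≤ 1 / 2 := by
  have h1 : ContinuousAt (fun u : ℂ => (u ^ p)⁻¹) 1 :=
    (continuousAt_id.pow p).inv₀ (by simp)
  obtain ⟨ε, he, h⟩ := Metric.continuousAt_iff.1 h1 (1 / 2) (by norm_num)
  refine ⟨min (ε / 2) (1 / 2), by positivity, fun u hu => ⟨fun h0 => ?_, ?_⟩⟩
  · rw [h0, zero_sub, norm_neg, norm_one] at hu
    linarith [min_le_right (ε / 2) (1 / 2)]
  · have := h (x := u) (by rw [dist_eq_norm]; linarith [min_le_left (ε / 2) (1 / 2)])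
    simp only [dist_eq_norm, one_pow, inv_one] at this
    exact this.le

theorem exists_glue_bound {p : ℕ} (hp : Odd p) : ∃ ρ : ℝ, 0 < ρ ∧ ∀ (x : ℝ) (k : ℕ),
    |iteratedDeriv k (glue p) x| ≤ (k.factorial : ℝ) ^ (1 + 1 / (p : ℝ)) * 1 / ρ ^ k := by
  obtain ⟨ε, he, hu⟩ := exists_glue_radius p
  refine ⟨ε / 2, by positivity, fun x k => ?_⟩
  have hp1 : 1 ≤ p := hp.pos
  have hpos : ∀ x : ℝ, 0 < x → |iteratedDeriv k (glue p) x| ≤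
      (k.factorial : ℝ) ^ (1 + 1 / (p : ℝ)) * 1 / (ε / 2) ^ k := by
    intro x hx
    have hx' : (x : ℂ) ≠ 0 := by exact_mod_cast hx.ne'
    have hball : ∀ z ∈ Metric.closedBall (x : ℂ) (ε * x), ‖z / x - 1‖ ≤ ε := by
      intro z hz
      rw [Metric.mem_closedBall, dist_eq_norm] at hz
      rw [div_sub_one hx', norm_div, Complex.norm_real, Real.norm_of_nonneg hx.le,
        div_le_iff₀ hx]
      exact hz
    have h1 := abs_iteratedDeriv_le_of_extension (f := glue p) (x := x) (R := ε * x)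
      (F := fun z => Complex.exp (((-(x ^ p)⁻¹ : ℝ) : ℂ) * ((z / x) ^ p)⁻¹))
      (M := Real.exp (-((x⁻¹) ^ p / 2))) (by positivity) (fun z hz => ?_) (fun z hz => ?_)
      (fun t ht => ?_) k
    · refine h1.trans ?_
      have h2 := pow_mul_exp_neg_le hp1 (inv_nonneg.2 hx.le) k
      have hk : (0 : ℝ) < k.factorial := by positivity
      rw [Real.rpow_add hk, Real.rpow_one]
      calc _ = k.factorial * (x⁻¹ ^ k * Real.exp (-(x⁻¹ ^ p / 2))) / ε ^ k := by
            rw [mul_pow, inv_pow x k]; field_simp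
        _ ≤ k.factorial * ((k.factorial : ℝ) ^ (1 / (p : ℝ)) * 2 ^ k) / ε ^ k := by gcongr
        _ = _ := by rw [div_pow]; field_simp
    · have h0 := (hu _ (hball z hz)).1
      refine DifferentiableAt.cexp (DifferentiableAt.const_mul (DifferentiableAt.inv ?_ ?_) _)
      · exact (differentiableAt_id.div_const _).pow p
      · exact pow_ne_zero _ h0
    · rw [Complex.norm_exp, Real.exp_le_exp, Complex.re_ofReal_mul]
      have h3 := (abs_le.1 ((Complex.abs_re_le_norm _).trans (hu _ (hball z hz)).2)).1
      rw [Complex.sub_re, Complex.one_re] at h3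
      rw [inv_pow]
      have : 0 < (x ^ p)⁻¹ := by positivity
      nlinarith
    · have h0 : |t / x - 1| ≤ ε := by
        rw [div_sub_one hx.ne', abs_div, abs_of_pos hx, div_le_iff₀ hx]; exact ht.le
      have h4 := hu ((t / x : ℝ) : ℂ) (by
        rw [← Complex.ofReal_one, ← Complex.ofReal_sub, Complex.norm_real]; exact h0)
      have h5 : ‖(((t / x) ^ p)⁻¹ - 1 : ℝ)‖ ≤ 1 / 2 := by
        rw [← Complex.norm_real]; push_cast; have := h4.2; push_cast at this; exact this
      have h6 := (abs_le.1 h5).1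
      have h7 : 0 < (t / x) ^ p := by
        by_contra h
        have : ((t / x) ^ p)⁻¹ ≤ 0 := inv_nonpos.2 (not_lt.1 h)
        linarith
      have h8 : 0 < t := by
        have : 0 < t / x := by
          by_contra h
          exact absurd h7 (not_lt.2 (hp.pow_nonpos (not_lt.1 h)))
        exact (div_pos_iff_of_pos_right hx).1 this
      rw [glue_of_pos p h8]
      have : ((-(x ^ p)⁻¹ : ℝ) : ℂ) * (((t : ℂ) / x) ^ p)⁻¹ = ((-(t ^ p)⁻¹ : ℝ) : ℂ) := by
        push_cast
        have : (t : ℂ) ≠ 0 := by exact_mod_cast h8.ne'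
        rw [div_pow]
        field_simp
      rw [this, Complex.exp_ofReal_re]
  have hneg : ∀ x : ℝ, x < 0 → iteratedDeriv k (glue p) x = 0 := by
    intro x hx
    have : glue p =ᶠ[nhds x] fun _ => (0 : ℝ) := by
      filter_upwards [gt_mem_nhds hx] with z hz using glue_of_nonpos hp (le_of_lt hz)
    rw [this.iteratedDeriv_eq, iteratedDeriv_const]; simp
  have hcl : IsClosed {x : ℝ | |iteratedDeriv k (glue p) x| ≤
      (k.factorial : ℝ) ^ (1 + 1 / (p : ℝ)) * 1 / (ε / 2) ^ k} := by
    refine isClosed_le ?_ continuous_const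
    exact continuous_abs.comp
      ((contDiff_glue p).continuous_iteratedDeriv k (by exact_mod_cast le_top))
  have hd : Dense ({0}ᶜ : Set ℝ) := dense_compl_singleton 0
  have hsub : ({0}ᶜ : Set ℝ) ⊆ _ := fun x (hx : x ≠ 0) =>
    show x ∈ {x : ℝ | |iteratedDeriv k (glue p) x| ≤
      (k.factorial : ℝ) ^ (1 + 1 / (p : ℝ)) * 1 / (ε / 2) ^ k} by
    rcases lt_or_gt_of_ne hx with h | h
    · rw [Set.mem_ofPred_eq, hneg x h, abs_zero]; positivity
    · exact hpos x h
  exact (hd.closure_eq ▸ closure_minimal hsub hcl) (Set.mem_univ x)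

theorem jetSize_reflect (f : ℝ → ℝ) (ρ r c x : ℝ) (n : ℕ) :
    jetSize ρ r n (jet (fun z => f (c - z)) x) = jetSize ρ r n (jet f (c - x)) := by
  unfold jetSize
  refine Finset.sum_congr rfl fun k _ => ?_
  rw [coeff_jet, coeff_jet, iteratedDeriv_comp_const_sub]
  simp [abs_mul, abs_div]

theorem jetSize_sub_const_le {ρ ρ' : ℝ} (hρ : 0 ≤ ρ) (h : ρ ≤ ρ') (hρ' : 0 < ρ') (r : ℝ) (n : ℕ)
    (q : PowerSeries ℝ) :
    jetSize ρ r n (q - PowerSeries.C (PowerSeries.coeff 0 q)) ≤ ρ / ρ' * jetSize ρ' r n q := by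
  unfold jetSize
  rw [Finset.mul_sum]
  refine Finset.sum_le_sum fun k _ => ?_
  rcases Nat.eq_zero_or_pos k with rfl | hk
  · simp only [map_sub, PowerSeries.coeff_C, if_true, sub_self, abs_zero, mul_zero]
    exact mul_nonneg (by positivity) (mul_nonneg (gevreyWeight_nonneg hρ'.le r 0) (abs_nonneg _))
  · rw [map_sub, PowerSeries.coeff_C, if_neg hk.ne', sub_zero, ← mul_assoc]
    refine mul_le_mul_of_nonneg_right ?_ (abs_nonneg _)
    unfold gevreyWeight
    obtain ⟨j, rfl⟩ : ∃ j, k = j + 1 := ⟨k - 1, by omega⟩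
    have : ρ ^ j ≤ ρ' ^ j := by gcongr
    have hw : (0 : ℝ) ≤ ((j + 1).factorial : ℝ) ^ (-r) := by positivity
    calc ρ ^ (j + 1) * ((j + 1).factorial : ℝ) ^ (-r)
        = ρ * ρ ^ j * ((j + 1).factorial : ℝ) ^ (-r) := by ring
      _ ≤ ρ * ρ' ^ j * ((j + 1).factorial : ℝ) ^ (-r) := by gcongr
      _ = _ := by field_simp; ring

/-- The Taylor series of a reciprocal, for a function bounded below. -/
theorem jetSize_inv_le {f : ℝ → ℝ} {x ρ ρ' r d M : ℝ} (hf : SmoothAt f x) (hd : 0 < d)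
    (hdx : d ≤ f x) (hr : 0 ≤ r) (hρ : 0 ≤ ρ) (hρρ : ρ ≤ ρ') (hρ' : 0 < ρ')
    (hM : ρ * M ≤ ρ' * d / 2) (n : ℕ) (hb : jetSize ρ' r n (jet f x) ≤ M) :
    jetSize ρ r n (jet (fun z => (f z)⁻¹) x) ≤ 2 / d := by
  have hfx : 0 < f x := hd.trans_le hdx
  set q := jet f x with hq
  have hq0 : PowerSeries.coeff 0 q = f x := by rw [hq, coeff_jet]; simp
  have h1 := jetSize_sub_const_le hρ hρρ hρ' r n q
  rw [hq0] at h1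
  set e := PowerSeries.C (f x)⁻¹ * (q - PowerSeries.C (f x)) with he
  have h2 : jetSize ρ r n e ≤ 1 / 2 := by
    rw [he, jetSize_C, abs_of_pos (by positivity)]
    have h3 : ρ / ρ' * jetSize ρ' r n q ≤ d / 2 := by
      have : ρ / ρ' * jetSize ρ' r n q ≤ ρ / ρ' * M := by gcongr
      refine this.trans ?_
      rw [div_mul_eq_mul_div, div_le_iff₀ hρ']; linarith
    calc (f x)⁻¹ * jetSize ρ r n (q - PowerSeries.C (f x)) ≤ d⁻¹ * (d / 2) := by
          have := jetSize_nonneg hρ r n (q - PowerSeries.C (f x))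
          gcongr; exact h1.trans h3
      _ = 1 / 2 := by field_simp
  obtain ⟨u, hu1, hu2⟩ := (jetNorm hρ hr n).neumann e h2
  have hCC : PowerSeries.C (f x) * PowerSeries.C (f x)⁻¹ = (1 : PowerSeries ℝ) := by
    rw [← map_mul, mul_inv_cancel₀ hfx.ne', map_one]
  have hqe : q = PowerSeries.C (f x) * (1 + e) := by
    rw [he]; linear_combination (PowerSeries.C (f x) - q) * hCC
  have h3 : q * (PowerSeries.C (f x)⁻¹ * u) = 1 := by
    rw [hqe]; linear_combination (1 + e) * u * hCC + hu1
  have h4 := jet_mul_inv hf hfx.ne'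
  have h5 : jet (fun z => (f z)⁻¹) x = PowerSeries.C (f x)⁻¹ * u := by
    linear_combination (-(jet (fun z => (f z)⁻¹) x)) * h3 + PowerSeries.C (f x)⁻¹ * u * h4
  rw [h5, jetSize_C, abs_of_pos (by positivity)]
  calc (f x)⁻¹ * jetSize ρ r n u ≤ d⁻¹ * 2 := by
        have : (f x)⁻¹ ≤ d⁻¹ := by gcongr
        have h6 : jetSize ρ r n u ≤ 2 := hu2
        have h7 := jetSize_nonneg hρ r n u
        gcongr
    _ = 2 / d := by ring

/-- A plateau function of Gevrey class `1 + r`. -/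
structure Bump (r : ℝ) where
  /-- the function -/
  f : ℝ → ℝ
  /-- the radius for the jet bound -/
  ρ : ℝ
  /-- the jet bound -/
  M : ℝ
  ρ_pos : 0 < ρ
  ρ_le : ρ ≤ 1 / 64
  smooth : ContDiff ℝ ((⊤ : ℕ∞) : WithTop ℕ∞) f
  nonneg : ∀ x, 0 ≤ f x
  le_one : ∀ x, f x ≤ 1
  eq_one : ∀ x, |x| ≤ 1 → f x = 1
  eq_zero : ∀ x, 2 ≤ |x| → f x = 0
  jetSize_le : ∀ n x, jetSize ρ r n (jet f x) ≤ M

theorem exists_bump {p : ℕ} (hp : Odd p) : Nonempty (Bump (1 / (p : ℝ))) := by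
  obtain ⟨R, hR, hb⟩ := exists_glue_bound hp
  set r : ℝ := 1 / (p : ℝ) with hr
  have hr0 : 0 ≤ r := by positivity
  have hG : ∀ n x, jetSize (R / 2) r n (jet (glue p) x) ≤ 2 := fun n x => by
    simpa using jetSize_jet_le hR zero_le_one (by positivity) le_rfl (hb x) n
  set d : ℝ := Real.exp (-2 ^ p) with hd
  have hd0 : 0 < d := Real.exp_pos _
  have hlow : ∀ x : ℝ, 1 / 2 ≤ x → d ≤ glue p x := by
    intro x hx
    rw [glue_of_pos p (by linarith), hd, Real.exp_le_exp, neg_le_neg_iff]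
    rw [inv_le_comm₀ (by positivity) (by positivity), ← inv_pow]
    gcongr; linarith
  set D : ℝ → ℝ := fun x => glue p x + glue p (1 - x) with hD
  have hrefl : ∀ c : ℝ, ContDiff ℝ ((⊤ : ℕ∞) : WithTop ℕ∞) fun x : ℝ => c - x := fun c =>
    contDiff_const.sub contDiff_id
  have hDs : ContDiff ℝ ((⊤ : ℕ∞) : WithTop ℕ∞) D :=
    (contDiff_glue p).add ((contDiff_glue p).comp (hrefl 1))
  have hDd : ∀ x, d ≤ D x := fun x => by
    have h1 := glue_nonneg p x
    have h2 := glue_nonneg p (1 - x)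
    rcases le_total (1 / 2) x with h | h
    · have := hlow x h; simp only [hD]; linarith
    · have := hlow (1 - x) (by linarith); simp only [hD]; linarith
  have hDj : ∀ n x, jetSize (R / 2) r n (jet D x) ≤ 4 := fun n x => by
    rw [hD, jet_add (h' := fun x => glue p (1 - x)) (contDiff_glue p).contDiffAt
      ((contDiff_glue p).comp (hrefl 1)).contDiffAt]
    refine (jetSize_add (by positivity) _ _ _ _).trans ?_
    rw [jetSize_reflect]
    linarith [hG n x, hG n (1 - x)]
  set ρ : ℝ := min (min (R / 2) (R / 2 * d / 8)) (1 / 64) with hρ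
  have hρ0 : 0 < ρ := by positivity
  have hρ1 : ρ ≤ R / 2 := (min_le_left _ _).trans (min_le_left _ _)
  have hρ2 : ρ ≤ R / 2 * d / 8 := (min_le_left _ _).trans (min_le_right _ _)
  have hDi : ∀ n x, jetSize ρ r n (jet (fun z => (D z)⁻¹) x) ≤ 2 / d := fun n x =>
    jetSize_inv_le hDs.contDiffAt hd0 (hDd x) hr0 hρ0.le hρ1 (by positivity)
      (by linarith) n (hDj n x)
  set τ : ℝ → ℝ := fun x => glue p x * (D x)⁻¹ with hτ
  have hτs : ContDiff ℝ ((⊤ : ℕ∞) : WithTop ℕ∞) τ :=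
    (contDiff_glue p).mul (hDs.inv fun x => (hd0.trans_le (hDd x)).ne')
  have hτj : ∀ n x, jetSize ρ r n (jet τ x) ≤ 2 * (2 / d) := fun n x => by
    rw [hτ, jet_mul (h' := fun x => (D x)⁻¹) (contDiff_glue p).contDiffAt
      (hDs.inv fun x => (hd0.trans_le (hDd x)).ne').contDiffAt]
    refine (jetSize_mul hρ0.le hr0 _ _ _).trans ?_
    have h1 := (jetSize_mono hρ0.le hρ1 n (jet (glue p) x)).trans (hG n x)
    exact mul_le_mul h1 (hDi n x) (jetSize_nonneg hρ0.le _ _ _) (by norm_num)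
  have hτ0 : ∀ x, 0 ≤ τ x := fun x =>
    mul_nonneg (glue_nonneg _ _) (inv_nonneg.2 (hd0.le.trans (hDd x)))
  have hτ1 : ∀ x, τ x ≤ 1 := fun x => by
    simp only [hτ]
    rw [← div_eq_mul_inv, div_le_one (hd0.trans_le (hDd x))]
    simp only [hD]; linarith [glue_nonneg p (1 - x)]
  have hτe : ∀ x, 1 ≤ x → τ x = 1 := fun x hx => by
    simp only [hτ, hD]
    rw [glue_of_nonpos hp (by linarith : 1 - x ≤ 0), add_zero, glue_of_pos p (by linarith)]
    exact mul_inv_cancel₀ (Real.exp_pos _).ne'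
  have hτz : ∀ x, x ≤ 0 → τ x = 0 := fun x hx => by
    simp only [hτ]
    rw [glue_of_nonpos hp hx, zero_mul]
  have h2s : ContDiff ℝ ((⊤ : ℕ∞) : WithTop ℕ∞) fun x : ℝ => τ (x + 2) :=
    hτs.comp (contDiff_id.add contDiff_const)
  refine ⟨⟨fun x => τ (2 - x) * τ (x + 2), ρ, 2 * (2 / d) * (2 * (2 / d)), hρ0, min_le_right _ _,
    (hτs.comp (hrefl 2)).mul h2s,
    fun x => mul_nonneg (hτ0 _) (hτ0 _), fun x => mul_le_one₀ (hτ1 _) (hτ0 _) (hτ1 _),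
    fun x hx => ?_, fun x hx => ?_, fun n x => ?_⟩⟩
  · have := abs_le.1 hx
    rw [hτe _ (by linarith [this.2]), hτe _ (by linarith [this.1]), mul_one]
  · rcases le_abs.1 hx with h | h
    · rw [hτz (2 - x) (by linarith), zero_mul]
    · rw [hτz (x + 2) (by linarith), mul_zero]
  · rw [jet_mul (h := fun x => τ (2 - x)) (hτs.comp (hrefl 2)).contDiffAt h2s.contDiffAt, jet_shift]
    refine (jetSize_mul hρ0.le hr0 _ _ _).trans ?_
    rw [jetSize_reflect]
    exact mul_le_mul (hτj n _) (hτj n _) (jetSize_nonneg hρ0.le _ _ _) (by positivity)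

namespace Bump

variable {r : ℝ} (b : Bump r)

/-- The periodic plateau function at scale `ℓ`. -/
def cut (ℓ x : ℝ) : ℝ := b.f ((x - round x) / ℓ)

theorem M_pos : 1 ≤ b.M := by
  have h := b.jetSize_le 0 0
  have h1 : b.f 0 = 1 := b.eq_one 0 (by simp)
  simpa [jetSize, gevreyWeight_zero, coeff_jet, h1] using h

theorem cut_nonneg (ℓ x : ℝ) : 0 ≤ b.cut ℓ x := b.nonneg _

theorem cut_le_one (ℓ x : ℝ) : b.cut ℓ x ≤ 1 := b.le_one _

theorem cut_periodic (ℓ : ℝ) : Function.Periodic (b.cut ℓ) 1 := fun x => by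
  unfold cut; rw [round_add_one]; push_cast; congr 2; ring

theorem cut_eq_one {ℓ x : ℝ} (hℓ : 0 < ℓ) (h : dst x ≤ ℓ) : b.cut ℓ x = 1 :=
  b.eq_one _ (by rw [abs_div, abs_of_pos hℓ, div_le_one hℓ]; exact h)

theorem cut_eq_zero {ℓ x : ℝ} (hℓ : 0 < ℓ) (h : 2 * ℓ ≤ dst x) : b.cut ℓ x = 0 :=
  b.eq_zero _ (by rw [abs_div, abs_of_pos hℓ, le_div_iff₀ hℓ]; exact h)

theorem cut_eventuallyEq {ℓ : ℝ} (hℓ : 0 < ℓ) (hℓ' : ℓ ≤ 1 / 64) (x : ℝ) :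
    b.cut ℓ =ᶠ[nhds x] fun z => b.f (ℓ⁻¹ * (z + -(round x : ℝ))) := by
  have h1 : |x - round x| < 1 - 2 * ℓ := by
    have := dst_le_half x; unfold dst at this; linarith
  have h2 : ∀ᶠ z : ℝ in nhds x, |z - round x| < 1 - 2 * ℓ :=
    (continuous_abs.comp (continuous_id.sub continuous_const)).continuousAt.eventually_lt
      continuousAt_const h1
  filter_upwards [h2] with z hz
  by_cases hr : round z = round x
  · rw [cut, hr, div_eq_inv_mul, sub_eq_add_neg]
  · have h3 : (1 : ℝ) ≤ |(round z : ℝ) - round x| := by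
      have : (1 : ℤ) ≤ |round z - round x| := Int.one_le_abs (sub_ne_zero.2 hr)
      exact_mod_cast this
    have h4 : |(round z : ℝ) - round x| ≤ |z - round x| + dst z := by
      unfold dst
      have := abs_sub (z - round x) (z - round z)
      rwa [show z - (round x : ℝ) - (z - round z) = (round z : ℝ) - round x by ring] at this
    rw [b.cut_eq_zero hℓ (by linarith), b.eq_zero]
    rw [abs_mul, abs_of_pos (inv_pos.2 hℓ), ← sub_eq_add_neg, ← div_eq_inv_mul, le_div_iff₀ hℓ]
    have := dst_le_half z
    linarith

theorem smoothAt_cut {ℓ : ℝ} (hℓ : 0 < ℓ) (hℓ' : ℓ ≤ 1 / 64) (x : ℝ) : SmoothAt (b.cut ℓ) x := by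
  refine ContDiffAt.congr_of_eventuallyEq ?_ (b.cut_eventuallyEq hℓ hℓ' x)
  exact (b.smooth.comp (contDiff_const.mul (contDiff_id.add contDiff_const))).contDiffAt

theorem jetSize_cut_le {ℓ ρ : ℝ} (hℓ : 0 < ℓ) (hℓ' : ℓ ≤ 1 / 64) (hρ : 0 ≤ ρ) (h : ρ ≤ b.ρ * ℓ)
    (n : ℕ) (x : ℝ) : jetSize ρ r n (jet (b.cut ℓ) x) ≤ b.M := by
  rw [jet_congr (b.cut_eventuallyEq hℓ hℓ' x), jet_shift (fun y => b.f (ℓ⁻¹ * y))]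
  refine (jetSize_mono hρ h n _).trans ?_
  refine le_trans (le_of_eq ?_) (b.jetSize_le n (ℓ⁻¹ * (x + -(round x : ℝ))))
  unfold jetSize
  refine Finset.sum_congr rfl fun k _ => ?_
  rw [coeff_jet, coeff_jet,
    iteratedDeriv_comp_const_mul (b.smooth.of_le (by exact_mod_cast le_top)),
    abs_div, abs_mul, abs_div, abs_pow, abs_of_pos (inv_pos.2 hℓ), gevreyWeight, gevreyWeight,
    mul_pow, inv_pow]
  field_simp

end Bump

end Bump

end

section

/-- A frequency, a plateau function and a coupling constant satisfying the largeness conditions of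
the construction. -/
structure Model (α : ℝ) where
  P : Setup α
  r : ℝ
  r_nonneg : 0 ≤ r
  b : Bump r
  lam : ℝ
  two_le_lam : 2 ≤ lam
  lam_ge : 16 * (1 + 2 * b.M) ≤ lam
  θ_le : 4 * Real.exp (2 * 3 * (P.B + P.C₀)) / lam ≤ 1 / 2
  θ_mul_le : 4 * Real.exp (2 * 3 * (P.B + P.C₀)) / lam * Real.exp (3 * P.C₃) ≤ 1

/-- The sum of the Weyl functions in the two directions. -/
def weylSum (α : ℝ) (h : ℝ → ℝ) (n : ℕ) (x : ℝ) : ℝ :=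
  weyl (chain h α x) n + weyl (chain h (-α) x) n

theorem weylSum_zero (α : ℝ) (h : ℝ → ℝ) (x : ℝ) : weylSum α h 0 x = 0 := by
  simp [weylSum, weyl_zero]

namespace Setup

variable {α : ℝ} (P : Setup α)

theorem σ_lt_one : P.σ < 1 := by
  have := P.one_lt_β
  unfold σ
  rw [div_lt_one (by positivity)]
  exact one_lt_pow₀ this (by norm_num)

theorem lev_add_one (y : ℝ) : P.lev (y + 1) = P.lev y := by
  unfold lev; rw [dst_periodic y]

end Setup

namespace Model

variable {α : ℝ} (𝓜 : Model α)

theorem lam_pos : 0 < 𝓜.lam := by linarith [𝓜.two_le_lam]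

/-- The reference diagonal. -/
def G (y : ℝ) : ℝ := 𝓜.lam * flat 𝓜.P.σ y

/-- The `i`-th correction computed from the diagonal `h`. -/
def corr (h : ℝ → ℝ) (i : ℕ) (y : ℝ) : ℝ :=
  𝓜.b.cut (𝓜.P.ℓ i) y * (weylSum α h (𝓜.P.Q i - 1) y - weylSum α h (𝓜.P.Q (i - 1) - 1) y)

/-- The approximations obtained by iterating the functional equation. -/
def approx : ℕ → ℝ → ℝ
  | 0, _ => 0
  | n + 1, y => 𝓜.G y + ∑ i ∈ Finset.Icc 1 (𝓜.P.lev y - 1), 𝓜.corr (approx n) i y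

/-- The diagonal solving the functional equation away from the integers. -/
def H (y : ℝ) : ℝ := 𝓜.approx (𝓜.P.lev y + 1) y

theorem weylSum_congr {h h' : ℝ → ℝ} {n : ℕ} {y : ℝ}
    (e : ∀ δ, (δ = α ∨ δ = -α) → ∀ k : ℕ, 1 ≤ k → k ≤ n → h (y + k * δ) = h' (y + k * δ)) :
    weylSum α h n y = weylSum α h' n y := by
  rw [weylSum, weylSum,
    weyl_congr (a := chain h α y) (b := chain h' α y) fun k h1 h2 => e α (Or.inl rfl) k h1 h2,
    weyl_congr (a := chain h (-α) y) (b := chain h' (-α) y)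
      fun k h1 h2 => e (-α) (Or.inr rfl) k h1 h2]

theorem sum_corr_congr {h h' : ℝ → ℝ} {y : ℝ}
    (e : ∀ z, 𝓜.P.lev z < 𝓜.P.lev y → h z = h' z) :
    ∑ i ∈ Finset.Icc 1 (𝓜.P.lev y - 1), 𝓜.corr h i y =
      ∑ i ∈ Finset.Icc 1 (𝓜.P.lev y - 1), 𝓜.corr h' i y := by
  refine Finset.sum_congr rfl fun i hi => ?_
  rw [Finset.mem_Icc] at hi
  unfold corr
  have key : ∀ i' ≤ 𝓜.P.lev y - 1, weylSum α h (𝓜.P.Q i' - 1) y = weylSum α h' (𝓜.P.Q i' - 1) y :=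
    fun i' hi' => weylSum_congr fun δ hδ k h1 h2 => e _ (𝓜.P.lev_site_lt hδ hi' h1 h2)
  rw [key i hi.2, key (i - 1) (by omega)]

theorem approx_stable (y : ℝ) (n : ℕ) (hn : 𝓜.P.lev y < n) : 𝓜.approx n y = 𝓜.H y := by
  induction hL : 𝓜.P.lev y using Nat.strong_induction_on generalizing y n with
  | _ L ih =>
    subst hL
    obtain ⟨m, rfl⟩ : ∃ m, n = m + 1 := ⟨n - 1, by omega⟩
    unfold H
    rw [approx, approx, 𝓜.sum_corr_congr (h := 𝓜.approx m) (h' := 𝓜.approx (𝓜.P.lev y))]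
    intro z hz
    rw [ih _ hz z m (by omega) rfl, ih _ hz z _ hz rfl]

theorem H_eq_lev (y : ℝ) :
    𝓜.H y = 𝓜.G y + ∑ i ∈ Finset.Icc 1 (𝓜.P.lev y - 1), 𝓜.corr 𝓜.H i y := by
  rw [H, approx, 𝓜.sum_corr_congr (h' := 𝓜.H)]
  intro z hz
  exact 𝓜.approx_stable z _ hz

theorem corr_eq_zero {h : ℝ → ℝ} {i : ℕ} {y : ℝ} (hy : 2 * 𝓜.P.ℓ i ≤ dst y) :
    𝓜.corr h i y = 0 := by
  rw [corr, 𝓜.b.cut_eq_zero (𝓜.P.ℓ_pos i) hy, zero_mul]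

/-- The functional equation. -/
theorem H_eq {y : ℝ} {M : ℕ} (hy : 2 * 𝓜.P.ℓ (M + 1) < dst y) :
    𝓜.H y = 𝓜.G y + ∑ i ∈ Finset.Icc 1 M, 𝓜.corr 𝓜.H i y := by
  have hy0 : 0 < dst y := by linarith [𝓜.P.ℓ_pos (M + 1)]
  rw [H_eq_lev]
  congr 1
  refine Finset.sum_subset (Finset.Icc_subset_Icc_right ?_) fun i hi hi' => ?_
  · have := 𝓜.P.lev_le hy; omega
  · rw [Finset.mem_Icc] at hi hi'
    refine 𝓜.corr_eq_zero ?_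
    have h1 := 𝓜.P.lt_dst_of_lev hy0
    have h2 := 𝓜.P.ℓ_anti (show 𝓜.P.lev y ≤ i by omega)
    linarith

theorem G_periodic : Function.Periodic 𝓜.G 1 := fun y => by
  rw [G, flat_periodic, G]

theorem weylSum_periodic {h : ℝ → ℝ} (hp : Function.Periodic h 1) (n : ℕ) :
    Function.Periodic (weylSum α h n) 1 := fun y => by
  have : ∀ δ, chain h δ (y + 1) = chain h δ y := fun δ => funext fun k => by
    rw [chain, chain, show y + 1 + k * δ = y + k * δ + 1 by ring, hp]
  rw [weylSum, weylSum, this, this]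

theorem corr_periodic {h : ℝ → ℝ} (hp : Function.Periodic h 1) (i : ℕ) :
    Function.Periodic (𝓜.corr h i) 1 := fun y => by
  rw [corr, corr, 𝓜.b.cut_periodic, weylSum_periodic hp, weylSum_periodic hp]

theorem approx_periodic (n : ℕ) : Function.Periodic (𝓜.approx n) 1 := by
  induction n with
  | zero => intro y; rfl
  | succ n ih =>
    intro y
    rw [approx, approx, 𝓜.G_periodic, 𝓜.P.lev_add_one]
    simp only [𝓜.corr_periodic ih _ y]

theorem H_periodic : Function.Periodic 𝓜.H 1 := fun y => by
  rw [H, 𝓜.P.lev_add_one, 𝓜.approx_periodic, H]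

theorem sum_corr_telescope {h : ℝ → ℝ} {y : ℝ} {M : ℕ} (hy : dst y ≤ 𝓜.P.ℓ M) :
    ∑ i ∈ Finset.Icc 1 M, 𝓜.corr h i y = weylSum α h (𝓜.P.Q M - 1) y := by
  induction M with
  | zero => simp [𝓜.P.Q_zero, weylSum_zero]
  | succ M ih =>
    have h1 := 𝓜.P.ℓ_anti (show M ≤ M + 1 by omega)
    rw [Finset.sum_Icc_succ_top (by omega), ih (by linarith), corr,
      𝓜.b.cut_eq_one (𝓜.P.ℓ_pos _) hy, Nat.add_sub_cancel]
    ring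

/-- The cutoff used in the gluing at the point `y`. -/
def X (y : ℝ) : ℝ → ℝ := 𝓜.b.cut (𝓜.P.ℓ (𝓜.P.lev y - 1))

/-- Near any point the diagonal glues Weyl functions of two fixed lengths. -/
theorem H_eventuallyEq {y : ℝ} (hy : 0 < dst y) : 𝓜.H =ᶠ[nhds y] fun z => 𝓜.G z +
    ((1 - 𝓜.X y z) * weyl (chain 𝓜.H α z) (𝓜.P.short y) +
      𝓜.X y z * weyl (chain 𝓜.H α z) (𝓜.P.long y)) +
    ((1 - 𝓜.X y z) * weyl (chain 𝓜.H (-α) z) (𝓜.P.short y) +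
      𝓜.X y z * weyl (chain 𝓜.H (-α) z) (𝓜.P.long y)) := by
  have h1 : ∀ᶠ z in nhds y, 2 * 𝓜.P.ℓ (𝓜.P.lev y) < dst z :=
    continuousAt_const.eventually_lt continuous_dst.continuousAt (𝓜.P.lt_dst_of_lev hy)
  set L := 𝓜.P.lev y with hL
  rcases Nat.lt_or_ge L 2 with hL2 | hL2
  · filter_upwards [h1] with z hz
    have h2 : 2 * 𝓜.P.ℓ (1 - 1 + 1) < dst z := by
      have := 𝓜.P.ℓ_anti (show L ≤ 1 by omega); simp only [Nat.sub_self, zero_add]; linarith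
    have h3 := 𝓜.H_eq (M := 1 - 1) h2
    have e1 : 𝓜.P.short y = 0 := by
      rw [Setup.short, ← hL, show L - 2 = 0 by omega, 𝓜.P.Q_zero]
    have e2 : 𝓜.P.long y = 0 := by
      rw [Setup.long, ← hL, show L - 1 = 0 by omega, 𝓜.P.Q_zero]
    rw [e1, e2, h3]
    simp [weyl_zero]
  · have h2 : dst y < 𝓜.P.ℓ (L - 2) := by
      have a := 𝓜.P.dst_le_of_lt_lev (y := y) (i := L - 1) (by omega)
      have b := 𝓜.P.ℓ_succ_le (L - 2)
      rw [show L - 2 + 1 = L - 1 by omega] at b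
      linarith [𝓜.P.ℓ_pos (L - 1)]
    have h2' : ∀ᶠ z in nhds y, dst z < 𝓜.P.ℓ (L - 2) :=
      continuous_dst.continuousAt.eventually_lt continuousAt_const h2
    filter_upwards [h1, h2'] with z hz hz'
    have h3 := 𝓜.H_eq (y := z) (M := L - 2 + 1) (by
      rwa [show L - 2 + 1 + 1 = L by omega])
    rw [Finset.sum_Icc_succ_top (by omega), 𝓜.sum_corr_telescope hz'.le, corr,
      Nat.add_sub_cancel, show L - 2 + 1 = L - 1 by omega] at h3
    rw [h3, Setup.short, Setup.long, X, ← hL]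
    unfold weylSum
    ring

theorem H_glue {y : ℝ} (hy : 0 < dst y) : 𝓜.H y = 𝓜.G y +
    ((1 - 𝓜.X y y) * weyl (chain 𝓜.H α y) (𝓜.P.short y) +
      𝓜.X y y * weyl (chain 𝓜.H α y) (𝓜.P.long y)) +
    ((1 - 𝓜.X y y) * weyl (chain 𝓜.H (-α) y) (𝓜.P.short y) +
      𝓜.X y y * weyl (chain 𝓜.H (-α) y) (𝓜.P.long y)) :=
  (𝓜.H_eventuallyEq hy).eq_of_nhds

/-- The real-valued diagonal as a glued diagonal. -/
def realDiagonal : GluedDiagonal (𝓜.P.geom 0) absNorm where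
  H := 𝓜.H
  D := 𝓜.G
  Dinv y := (𝓜.G y)⁻¹
  X y := 𝓜.X y y
  Cχ := 𝓜.b.M
  Cg := 3
  lam := 𝓜.lam
  θ := 4 * Real.exp (2 * 3 * (𝓜.P.B + 𝓜.P.C₀)) / 𝓜.lam
  Cχ_nonneg := by linarith [𝓜.b.M_pos]
  Cg_nonneg := by norm_num
  two_le_lam := 𝓜.two_le_lam
  θ_eq := rfl
  θ_le := 𝓜.θ_le
  θ_mul_le := 𝓜.θ_mul_le
  lam_ge := 𝓜.lam_ge
  D_mul y _ := mul_inv_cancel₀ (mul_pos 𝓜.lam_pos (flat_pos _ _)).ne'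
  size_Dinv y hy := by
    change |(𝓜.G y)⁻¹| ≤ Real.exp (3 * dst y ^ (-𝓜.P.σ)) / 𝓜.lam
    have h1 := sin_rpow_le 𝓜.P.σ_pos hy.1
    have h2 : 0 ≤ dst y ^ (-𝓜.P.σ) := Real.rpow_nonneg (dst_nonneg y) _
    have := 𝓜.lam_pos
    rw [G, abs_of_pos (inv_pos.2 (mul_pos 𝓜.lam_pos (flat_pos _ _))), mul_inv, flat,
      ← Real.exp_neg, neg_neg, div_eq_inv_mul]
    gcongr
    linarith
  size_X y _ := by
    change |𝓜.X y y| ≤ 𝓜.b.M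
    rw [X, abs_of_nonneg (𝓜.b.cut_nonneg _ _)]
    exact (𝓜.b.cut_le_one _ _).trans 𝓜.b.M_pos
  glue y hy _ := 𝓜.H_glue hy.1

theorem geom_zero_W {δ x : ℝ} {n : ℕ} (hW : 𝓜.P.W δ x n) : (𝓜.P.geom 0).W δ x n :=
  ⟨hW, fun _ _ _ => dst_nonneg _⟩

theorem transfer_ne_zero {δ : ℝ} (hδ : δ = α ∨ δ = -α) {x : ℝ} {n : ℕ} (hW : 𝓜.P.W δ x n) :
    transfer (chain 𝓜.H δ x) n 0 0 ≠ 0 :=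
  (𝓜.realDiagonal.bounded δ hδ x n (𝓜.geom_zero_W hW)).1.ne_zero

/-- The lower bound for the corner entry of the transfer matrix along admissible chains. -/
theorem transfer_inv_le {δ : ℝ} (hδ : δ = α ∨ δ = -α) {x : ℝ} {n : ℕ} (hW : 𝓜.P.W δ x n) :
    |(transfer (chain 𝓜.H δ x) n 0 0)⁻¹| ≤
      (2 / 𝓜.lam) ^ n * Real.exp (3 * 𝓜.P.B * n) := by
  have h := (𝓜.realDiagonal.bounded δ hδ x n (𝓜.geom_zero_W hW)).2.1.trans
    (𝓜.realDiagonal.prod_η_le δ hδ x n (𝓜.geom_zero_W hW))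
  rw [Ring.inverse_eq_inv'] at h
  exact h

theorem smoothAt_G {y : ℝ} (hy : 0 < dst y) : SmoothAt 𝓜.G y :=
  contDiffAt_const.mul (smoothAt_flat _ hy)

theorem smoothAt_X (y z : ℝ) : SmoothAt (𝓜.X y) z :=
  𝓜.b.smoothAt_cut (𝓜.P.ℓ_pos _) (𝓜.P.ℓ_le _) z

theorem smoothAt_jet_weyl_H {δ : ℝ} (hδ : δ = α ∨ δ = -α) {y : ℝ} {n : ℕ} (hW : 𝓜.P.W δ y n)
    (hs : ∀ k : ℕ, 1 ≤ k → k ≤ n → SmoothAt 𝓜.H (y + k * δ)) :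
    SmoothAt (fun z => weyl (chain 𝓜.H δ z) n) y ∧
      jet (fun z => weyl (chain 𝓜.H δ z) n) y = weyl (chain (jet 𝓜.H) δ y) n :=
  smoothAt_jet_weyl hs (𝓜.transfer_ne_zero hδ hW)

theorem W_short {δ : ℝ} (hδ : δ = α ∨ δ = -α) (y : ℝ) : 𝓜.P.W δ y (𝓜.P.short y) :=
  𝓜.P.W_Q_lev hδ (by omega)

theorem W_long {δ : ℝ} (hδ : δ = α ∨ δ = -α) (y : ℝ) : 𝓜.P.W δ y (𝓜.P.long y) :=
  𝓜.P.W_Q_lev hδ le_rfl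

theorem smoothAt_mix {x w₁ w₂ : ℝ → ℝ} {y : ℝ} (hx : SmoothAt x y) (h₁ : SmoothAt w₁ y)
    (h₂ : SmoothAt w₂ y) : SmoothAt (fun z => (1 - x z) * w₁ z + x z * w₂ z) y :=
  ((contDiffAt_const.sub hx).mul h₁).add (hx.mul h₂)

theorem jet_mix {x w₁ w₂ : ℝ → ℝ} {y : ℝ} (hx : SmoothAt x y) (h₁ : SmoothAt w₁ y)
    (h₂ : SmoothAt w₂ y) : jet (fun z => (1 - x z) * w₁ z + x z * w₂ z) y =
      (1 - jet x y) * jet w₁ y + jet x y * jet w₂ y := by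
  have h0 : SmoothAt (fun z => 1 - x z) y := contDiffAt_const.sub hx
  rw [jet_add (h := fun z => (1 - x z) * w₁ z) (h' := fun z => x z * w₂ z) (h0.mul h₁) (hx.mul h₂),
    jet_mul h0 h₁, jet_mul hx h₂, jet_sub contDiffAt_const hx, jet_const, map_one]

theorem smoothAt_H {y : ℝ} (hy : 0 < dst y) : SmoothAt 𝓜.H y := by
  induction hL : 𝓜.P.lev y using Nat.strong_induction_on generalizing y with
  | _ L ih =>
    subst hL
    have hs : ∀ δ, (δ = α ∨ δ = -α) → SmoothAt (fun z => weyl (chain 𝓜.H δ z) (𝓜.P.short y)) y :=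
      fun δ hδ => (𝓜.smoothAt_jet_weyl_H hδ (𝓜.W_short hδ y) fun k h1 h2 =>
        ih _ (𝓜.P.lev_site_lt hδ (by omega) h1 h2) ((𝓜.W_short hδ y).dst_pos h1 h2) rfl).1
    have hl : ∀ δ, (δ = α ∨ δ = -α) → SmoothAt (fun z => weyl (chain 𝓜.H δ z) (𝓜.P.long y)) y :=
      fun δ hδ => (𝓜.smoothAt_jet_weyl_H hδ (𝓜.W_long hδ y) fun k h1 h2 =>
        ih _ (𝓜.P.lev_site_lt hδ le_rfl h1 h2) ((𝓜.W_long hδ y).dst_pos h1 h2) rfl).1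
    refine ContDiffAt.congr_of_eventuallyEq ?_ (𝓜.H_eventuallyEq hy)
    exact ((𝓜.smoothAt_G hy).add
      (smoothAt_mix (𝓜.smoothAt_X y y) (hs _ (Or.inl rfl)) (hl _ (Or.inl rfl)))).add
      (smoothAt_mix (𝓜.smoothAt_X y y) (hs _ (Or.inr rfl)) (hl _ (Or.inr rfl)))

theorem smoothAt_jet_weyl_W {δ : ℝ} (hδ : δ = α ∨ δ = -α) {y : ℝ} {n : ℕ} (hW : 𝓜.P.W δ y n) :
    SmoothAt (fun z => weyl (chain 𝓜.H δ z) n) y ∧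
      jet (fun z => weyl (chain 𝓜.H δ z) n) y = weyl (chain (jet 𝓜.H) δ y) n :=
  𝓜.smoothAt_jet_weyl_H hδ hW fun _ h1 h2 => 𝓜.smoothAt_H (hW.dst_pos h1 h2)

theorem jet_H_glue {y : ℝ} (hy : 0 < dst y) : jet 𝓜.H y = jet 𝓜.G y +
    ((1 - jet (𝓜.X y) y) * weyl (chain (jet 𝓜.H) α y) (𝓜.P.short y) +
      jet (𝓜.X y) y * weyl (chain (jet 𝓜.H) α y) (𝓜.P.long y)) +
    ((1 - jet (𝓜.X y) y) * weyl (chain (jet 𝓜.H) (-α) y) (𝓜.P.short y) +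
      jet (𝓜.X y) y * weyl (chain (jet 𝓜.H) (-α) y) (𝓜.P.long y)) := by
  have hs := fun δ (hδ : δ = α ∨ δ = -α) => 𝓜.smoothAt_jet_weyl_W hδ (𝓜.W_short hδ y)
  have hl := fun δ (hδ : δ = α ∨ δ = -α) => 𝓜.smoothAt_jet_weyl_W hδ (𝓜.W_long hδ y)
  have hX := 𝓜.smoothAt_X y y
  have hp := smoothAt_mix hX (hs _ (Or.inl rfl)).1 (hl _ (Or.inl rfl)).1
  have hm := smoothAt_mix hX (hs _ (Or.inr rfl)).1 (hl _ (Or.inr rfl)).1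
  have hG := 𝓜.smoothAt_G hy
  rw [jet_congr (𝓜.H_eventuallyEq hy), jet_add (hG.add hp) hm, jet_add hG hp,
    jet_mix hX (hs _ (Or.inl rfl)).1 (hl _ (Or.inl rfl)).1,
    jet_mix hX (hs _ (Or.inr rfl)).1 (hl _ (Or.inr rfl)).1,
    (hs _ (Or.inl rfl)).2, (hs _ (Or.inr rfl)).2, (hl _ (Or.inl rfl)).2, (hl _ (Or.inr rfl)).2]

theorem jet_G {y : ℝ} (hy : 0 < dst y) :
    jet 𝓜.G y = PowerSeries.C 𝓜.lam * jet (flat 𝓜.P.σ) y := by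
  rw [show 𝓜.G = fun z => (fun _ => 𝓜.lam) z * flat 𝓜.P.σ z from rfl,
    jet_mul contDiffAt_const (smoothAt_flat _ hy), jet_const]

theorem ℓ_lev_ge {d y : ℝ} (hd : d ≤ dst y) : d / 32 ≤ 𝓜.P.ℓ (𝓜.P.lev y - 1) := by
  rcases Nat.eq_zero_or_pos (𝓜.P.lev y) with h | h
  · rw [h]
    have := 𝓜.P.Q_mul_ℓ 0
    rw [𝓜.P.Q_zero, Nat.cast_one, one_mul] at this
    rw [Nat.zero_sub, this]
    linarith [dst_le_half y]
  · have h1 := 𝓜.P.dst_le_of_lt_lev (y := y) (i := 𝓜.P.lev y - 1) (by omega)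
    have h2 := 𝓜.P.ℓ_pos (𝓜.P.lev y - 1)
    linarith

/-- The Taylor series of the diagonal as a glued diagonal. -/
def jetDiagonal {d ρ : ℝ} (hρ : 0 ≤ ρ) (hd : ρ ≤ 𝓜.b.ρ * (d / 32)) (n : ℕ) :
    GluedDiagonal (𝓜.P.geom d) (jetNorm hρ 𝓜.r_nonneg n) where
  H := jet 𝓜.H
  D := jet 𝓜.G
  Dinv y := PowerSeries.C (𝓜.lam)⁻¹ * jet (fun z => (flat 𝓜.P.σ z)⁻¹) y
  X y := jet (𝓜.X y) y
  Cχ := 𝓜.b.M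
  Cg := 3
  lam := 𝓜.lam
  θ := 4 * Real.exp (2 * 3 * (𝓜.P.B + 𝓜.P.C₀)) / 𝓜.lam
  Cχ_nonneg := by linarith [𝓜.b.M_pos]
  Cg_nonneg := by norm_num
  two_le_lam := 𝓜.two_le_lam
  θ_eq := rfl
  θ_le := 𝓜.θ_le
  θ_mul_le := 𝓜.θ_mul_le
  lam_ge := 𝓜.lam_ge
  D_mul y hy := by
    rw [𝓜.jet_G hy.1]
    have h1 : PowerSeries.C 𝓜.lam * PowerSeries.C (𝓜.lam)⁻¹ = (1 : PowerSeries ℝ) := by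
      rw [← map_mul, mul_inv_cancel₀ 𝓜.lam_pos.ne', map_one]
    have h2 := jet_mul_inv (smoothAt_flat 𝓜.P.σ hy.1) (flat_pos _ _).ne'
    linear_combination (jet (flat 𝓜.P.σ) y * jet (fun z => (flat 𝓜.P.σ z)⁻¹) y) * h1 + h2
  size_Dinv y hy := by
    change jetSize ρ 𝓜.r n _ ≤ Real.exp (3 * dst y ^ (-𝓜.P.σ)) / 𝓜.lam
    have hl := 𝓜.lam_pos
    rw [jetSize_C, abs_of_pos (inv_pos.2 hl), div_eq_inv_mul]
    have h1 : ρ ≤ dst y / 64 := by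
      have a := 𝓜.b.ρ_le
      have c := 𝓜.b.ρ_pos
      have h0 := hy.1
      rcases le_total d 0 with h | h
      · nlinarith
      · nlinarith [hy.2]
    gcongr
    exact jetSize_flat_inv_le 𝓜.P.σ_pos 𝓜.P.σ_lt_one hy.1 𝓜.r_nonneg hρ h1 n
  size_X y hy := by
    refine 𝓜.b.jetSize_cut_le (𝓜.P.ℓ_pos _) (𝓜.P.ℓ_le _) hρ (hd.trans ?_) n y
    have := 𝓜.b.ρ_pos
    gcongr
    exact 𝓜.ℓ_lev_ge hy.2
  glue y hy _ := 𝓜.jet_H_glue hy.1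

end Model

end

section

/-- A smooth function whose derivatives satisfy the bounds defining the Gevrey norm with radius
`1`, with constant `C`. -/
def GevreyBound (s C : ℝ) (f : ℝ → ℝ) : Prop :=
  ContDiff ℝ (⊤ : ℕ∞) f ∧
    ∀ (k : ℕ) (x : ℝ), (1 + (k : ℝ) ^ 2) * |iteratedDeriv k f x| ≤ C * (k.factorial : ℝ) ^ s

namespace GevreyBound

variable {s C C' : ℝ} {f g : ℝ → ℝ}

theorem abs_le (h : GevreyBound s C f) (k : ℕ) (x : ℝ) :
    |iteratedDeriv k f x| ≤ C * (k.factorial : ℝ) ^ s / (1 + (k : ℝ) ^ 2) := by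
  rw [le_div_iff₀ (by positivity), mul_comm]
  exact h.2 k x

theorem gevreySeqR_le (h : GevreyBound s C f) (k : ℕ) : gevreySeqR s 1 f k ≤ C := by
  have hf : (0 : ℝ) < (k.factorial : ℝ) ^ s := by
    have := Nat.factorial_pos k; positivity
  have h1 : supDerivR k f ≤ C * (k.factorial : ℝ) ^ s / (1 + (k : ℝ) ^ 2) := ciSup_le (h.abs_le k)
  rw [gevreySeqR, one_pow, one_mul, div_le_iff₀ hf]
  rwa [le_div_iff₀ (by positivity), mul_comm] at h1

theorem memGevreyR (h : GevreyBound s C f) : MemGevreyR s 1 f := by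
  refine ⟨h.1, fun k => ⟨C * (k.factorial : ℝ) ^ s / (1 + (k : ℝ) ^ 2), ?_⟩, C, ?_⟩
  · rintro _ ⟨x, rfl⟩
    exact h.abs_le k x
  · rintro _ ⟨k, rfl⟩
    exact h.gevreySeqR_le k

theorem gevreyNormR_le (h : GevreyBound s C f) : gevreyNormR s 1 f ≤ 4 * Real.pi ^ 2 / 3 * C :=
  mul_le_mul_of_nonneg_left (ciSup_le h.gevreySeqR_le) (by positivity)

theorem gevreyNormR_nonneg (s : ℝ) (f : ℝ → ℝ) : 0 ≤ gevreyNormR s 1 f := by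
  refine mul_nonneg (by positivity) (Real.iSup_nonneg fun k => ?_)
  have : 0 ≤ supDerivR k f := Real.iSup_nonneg fun x => abs_nonneg _
  rw [gevreySeqR]; positivity

theorem natCast_contDiffAt (h : GevreyBound s C f) (k : ℕ) (x : ℝ) : ContDiffAt ℝ k f x :=
  h.1.contDiffAt.of_le (by exact_mod_cast le_top)

theorem add (h : GevreyBound s C f) (h' : GevreyBound s C' g) :
    GevreyBound s (C + C') (fun x => f x + g x) := by
  refine ⟨h.1.add h'.1, fun k x => ?_⟩
  rw [iteratedDeriv_fun_add (h.natCast_contDiffAt k x) (h'.natCast_contDiffAt k x),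
    add_mul C C']
  refine le_trans ?_ (add_le_add (h.2 k x) (h'.2 k x))
  rw [← mul_add]
  exact mul_le_mul_of_nonneg_left (abs_add_le _ _) (by positivity)

theorem neg (h : GevreyBound s C f) : GevreyBound s C (fun x => -f x) := by
  refine ⟨h.1.neg, fun k x => ?_⟩
  rw [iteratedDeriv_fun_neg, abs_neg]
  exact h.2 k x

theorem const (s c : ℝ) : GevreyBound s |c| (fun _ => c) := by
  refine ⟨contDiff_const, fun k x => ?_⟩
  rw [iteratedDeriv_const]
  split_ifs with h
  · simp [h]
  · rw [abs_zero, mul_zero]; positivity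

theorem tsum {F : ℕ → ℝ → ℝ} {e : ℕ → ℝ} (h : ∀ i, GevreyBound s (e i) (F i))
    (he : Summable e) : GevreyBound s (∑' i, e i) (fun x => ∑' i, F i x) := by
  set w : ℕ → ℕ → ℝ := fun k i => e i * (k.factorial : ℝ) ^ s / (1 + (k : ℝ) ^ 2)
  have hw : ∀ k, Summable (w k) := fun k => (he.mul_right _).div_const _
  have hb : ∀ k i x, ‖iteratedFDeriv ℝ k (F i) x‖ ≤ w k i := fun k i x => by
    rw [norm_iteratedFDeriv_eq_norm_iteratedDeriv, Real.norm_eq_abs]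
    exact (h i).abs_le k x
  refine ⟨contDiff_tsum (N := ⊤) (fun i => (h i).1) (fun k _ => hw k) fun k i x _ => hb k i x,
    fun k x => ?_⟩
  have h1 := iteratedFDeriv_tsum_apply (𝕜 := ℝ) (N := ⊤) (fun i => (h i).1) (fun k _ => hw k)
    (fun k i x _ => hb k i x) (k := k) le_top x
  have h2 : |iteratedDeriv k (fun x => ∑' i, F i x) x| ≤ ∑' i, w k i := by
    rw [← Real.norm_eq_abs, ← norm_iteratedFDeriv_eq_norm_iteratedDeriv, h1]
    exact tsum_of_norm_bounded (hw k).hasSum fun i => hb k i x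
  rw [tsum_div_const, tsum_mul_right, le_div_iff₀ (by positivity)] at h2
  linarith

end GevreyBound

theorem one_add_sq_le (k : ℕ) : 1 + (k : ℝ) ^ 2 ≤ 2 * 2 ^ k := by
  have h : ∀ k : ℕ, 1 + k ^ 2 ≤ 2 * 2 ^ k ∧ 2 * k + 1 ≤ 2 * 2 ^ k := fun k => by
    induction k with
    | zero => simp
    | succ k ih => 
      have h1 : 2 ^ (k + 1) = 2 * 2 ^ k := pow_succ' 2 k
      have h2 := Nat.one_le_two_pow (n := k)
      exact ⟨by rw [h1]; nlinarith [ih.1, ih.2], by rw [h1]; linarith [ih.2]⟩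
  exact_mod_cast (h k).1

theorem one_add_sq_mul_inv_pow_le {ρ a : ℝ} (hρ : 0 < ρ) (ha : 0 < a) (k : ℕ) :
    (1 + (k : ℝ) ^ 2) * ρ⁻¹ ^ k ≤
      2 * Real.exp (a * (2 / ρ) ^ (1 / a)) * (k.factorial : ℝ) ^ a := by
  have hf : (0 : ℝ) < k.factorial := by exact_mod_cast Nat.factorial_pos k
  set t : ℝ := (2 / ρ) ^ (1 / a) with ht
  have ht0 : 0 ≤ t := by positivity
  have h1 : t ^ k / k.factorial ≤ Real.exp t := by
    refine le_trans ?_ (Real.sum_le_exp_of_nonneg ht0 (k + 1))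
    exact Finset.single_le_sum (f := fun i : ℕ => t ^ i / (i.factorial : ℝ))
      (fun i _ => by positivity) (Finset.self_mem_range_succ k)
  have h2 : (t ^ k) ^ a ≤ Real.exp (a * t) * (k.factorial : ℝ) ^ a := by
    rw [mul_comm a, Real.exp_mul, ← Real.mul_rpow (Real.exp_pos _).le hf.le]
    exact Real.rpow_le_rpow (by positivity) ((div_le_iff₀ hf).1 h1) ha.le
  have h3 : (t ^ k) ^ a = (2 / ρ) ^ k := by
    rw [← Real.rpow_natCast, ← Real.rpow_mul ht0, mul_comm, Real.rpow_mul ht0, ht,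
      ← Real.rpow_mul (x := 2 / ρ) (by positivity), one_div_mul_cancel ha.ne',
      Real.rpow_one, Real.rpow_natCast]
  rw [h3, div_eq_mul_inv, mul_pow] at h2
  have h4 := mul_le_mul_of_nonneg_right (one_add_sq_le k) (show 0 ≤ ρ⁻¹ ^ k by positivity)
  linarith

/-- Uniform bounds on the weighted Taylor coefficients of class `1 + r` give Gevrey bounds of
class `1 + r + a` with radius `1`. -/
theorem gevreyBound_of_jetSize {f : ℝ → ℝ} {ρ r a A : ℝ} (hρ : 0 < ρ) (ha : 0 < a)
    (hA : 0 ≤ A) (hs : ∀ x, SmoothAt f x) (h : ∀ n x, jetSize ρ r n (jet f x) ≤ A) :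
    GevreyBound (1 + r + a) (A * (2 * Real.exp (a * (2 / ρ) ^ (1 / a)))) f := by
  refine ⟨contDiff_iff_contDiffAt.2 hs, fun k x => ?_⟩
  have hf : (0 : ℝ) < k.factorial := by exact_mod_cast Nat.factorial_pos k
  have h1 := (abs_coeff_le_jetSize hρ.le r le_rfl (jet f x)).trans (h k x)
  have h2 : |iteratedDeriv k f x| ≤ A * ρ⁻¹ ^ k * (k.factorial : ℝ) ^ (1 + r) := by
    rw [coeff_jet, abs_div, abs_of_pos hf, gevreyWeight, Real.rpow_neg hf.le] at h1
    rw [Real.rpow_add hf, Real.rpow_one, inv_pow]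
    have hr : 0 < (k.factorial : ℝ) ^ r := by positivity
    have hk : 0 < ρ ^ k := by positivity
    field_simp at h1 ⊢
    linarith
  have h3 := one_add_sq_mul_inv_pow_le hρ ha k
  have hr : 0 < (k.factorial : ℝ) ^ (1 + r) := by positivity
  calc (1 + (k : ℝ) ^ 2) * |iteratedDeriv k f x|
      ≤ (1 + (k : ℝ) ^ 2) * (A * ρ⁻¹ ^ k * (k.factorial : ℝ) ^ (1 + r)) := by gcongr
    _ = A * ((1 + (k : ℝ) ^ 2) * ρ⁻¹ ^ k) * (k.factorial : ℝ) ^ (1 + r) := by ring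
    _ ≤ A * (2 * Real.exp (a * (2 / ρ) ^ (1 / a)) * (k.factorial : ℝ) ^ a) *
        (k.factorial : ℝ) ^ (1 + r) := by gcongr
    _ = _ := by rw [Real.rpow_add hf (1 + r) a]; ring

/-- Stretched exponential decay beats stretched exponential growth of smaller order. -/
theorem eventually_mul_exp_le {A b c t : ℝ} (hc : 0 < c) (hb : b < t) (ht : 0 < t) :
    ∀ᶠ x : ℝ in atTop, Real.exp (A * x ^ b) * Real.exp (-(c * x ^ t)) ≤ x⁻¹ := by
  have h0 : (fun x : ℝ => x ^ b) =o[atTop] fun x => x ^ t := by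
    refine (Asymptotics.isLittleO_iff_tendsto' ?_).2
      ((tendsto_rpow_neg_atTop (sub_pos.2 hb)).congr' ?_)
    · filter_upwards [eventually_gt_atTop 0] with x hx h
      exact absurd h (by positivity)
    · filter_upwards [eventually_gt_atTop 0] with x hx
      rw [neg_sub, Real.rpow_sub hx]
  have h1 : (fun x : ℝ => A * x ^ b) =o[atTop] fun x => x ^ t := h0.const_mul_left A
  have h2 : Real.log =o[atTop] fun x => x ^ t := isLittleO_log_rpow_atTop ht
  filter_upwards [(h1.add h2).bound hc, eventually_gt_atTop 0] with x hx hx0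
  rw [Real.norm_of_nonneg (by positivity : 0 ≤ x ^ t)] at hx
  have h3 := (le_abs_self _).trans hx
  rw [← Real.exp_add, ← Real.exp_log (inv_pos.2 hx0), Real.log_inv]
  exact Real.exp_le_exp.2 (by linarith)

end

section

namespace Setup

variable {α : ℝ} (P : Setup α)

/-- The constant in the lower bound for record indices. -/
def c₄ : ℝ := (min 1 (P.F.cD / 2)) ^ (1 / P.β)

theorem c₄_pos : 0 < P.c₄ := by
  have : 0 < min 1 (P.F.cD / 2) := lt_min one_pos (by linarith [P.F.cD_pos])
  unfold c₄; positivity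

theorem σ_le : P.σ ≤ 1 / P.β := by
  have := P.one_lt_β
  unfold σ
  have h : P.β ≤ P.β ^ 3 := by
    calc P.β = P.β ^ 1 := (pow_one _).symm
      _ ≤ P.β ^ 3 := pow_le_pow_right₀ this.le (by norm_num)
  have := P.β_pos
  gcongr

theorem exists_record {δ : ℝ} (hδ : δ = α ∨ δ = -α) {y : ℝ} {i : ℕ}
    (hy : dst y ≤ 4 * P.ℓ (i + 1)) : ∃ k : ℕ, 1 ≤ k ∧ k ≤ P.Q i ∧
      (∀ m : ℕ, 1 ≤ m → m < k → P.Λ (y + m * δ) ≤ P.Λ (y + k * δ)) ∧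
      P.c₄ * (P.Q i : ℝ) ^ P.σ ≤ k := by
  have hβ := P.β_pos
  have hQ := P.one_le_Q i
  have hQ' := P.one_le_Q_cast i
  have he : 0 < min 1 (P.F.cD / 2) := lt_min one_pos (by linarith [P.F.cD_pos])
  have key : ∀ k : ℕ, 1 ≤ k → min 1 (P.F.cD / 2) * P.Q i ≤ (k : ℝ) ^ P.β →
      P.c₄ * (P.Q i : ℝ) ^ P.σ ≤ k := fun k hk h => by
    have h1 := Real.rpow_le_rpow (by positivity) h (show 0 ≤ 1 / P.β by positivity)
    rw [Real.mul_rpow he.le (by positivity), ← Real.rpow_mul (by positivity),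
      mul_one_div_cancel hβ.ne', Real.rpow_one] at h1
    refine le_trans ?_ h1
    exact mul_le_mul_of_nonneg_left (Real.rpow_le_rpow_of_exponent_le hQ' P.σ_le) P.c₄_pos.le
  rcases hQ.eq_or_lt with h | h
  · refine ⟨1, le_rfl, hQ, fun m _ _ => by omega, key 1 le_rfl ?_⟩
    rw [← h]
    simp
  · obtain ⟨k, hk, -⟩ := exists_last_argmax P.Λ δ y (n := P.Q i - 1) (by omega)
    refine ⟨k, hk.1, by have := hk.2.1; omega,
      fun m h1 h2 => hk.2.2 m h1 (by have := hk.2.1; omega), key k hk.1 ?_⟩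
    have h1 := P.record_far hδ (m := P.Q i - 1) (by omega) (fun m h1 h2 =>
      lt_of_lt_of_le (by have := P.ℓ_pos (i + 1); positivity)
        (P.near_dst_ge hδ hy (Nat.le_succ i) h1 (by omega))) hk
    rw [Nat.cast_sub hQ, Nat.cast_one, sub_add_cancel] at h1
    have h2 : 2 * dst y ≤ 1 / P.Q i := by
      have a := P.ℓ_succ_le i
      have b := P.Q_mul_ℓ i
      rw [le_div_iff₀ (by linarith)]
      nlinarith
    have hk0 : (0 : ℝ) < k := by exact_mod_cast hk.1
    have h3 : P.F.cD / (k : ℝ) ^ P.β ≤ 2 / P.Q i := by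
      refine h1.trans ?_
      rw [show (2 : ℝ) / P.Q i = 1 / P.Q i + 1 / P.Q i by ring]
      linarith
    rw [div_le_div_iff₀ (by positivity) (by linarith)] at h3
    have h4 := min_le_right (1 : ℝ) (P.F.cD / 2)
    nlinarith

end Setup

namespace Model

variable {α : ℝ} (𝓜 : Model α)

/-- The radius of the Taylor estimates at scale `i`. -/
def radius (i : ℕ) : ℝ := 𝓜.b.ρ * (7 / 8 * 𝓜.P.ℓ i)

theorem radius_pos (i : ℕ) : 0 < 𝓜.radius i := by
  have h1 := 𝓜.b.ρ_pos
  have h2 := 𝓜.P.ℓ_pos i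
  unfold radius; positivity

theorem radius_le {i j : ℕ} (h : j ≤ i) : 𝓜.radius i ≤ 𝓜.b.ρ * 𝓜.P.ℓ j := by
  have h1 := 𝓜.b.ρ_pos
  have h2 := 𝓜.P.ℓ_pos i
  have h3 := 𝓜.P.ℓ_anti h
  unfold radius
  gcongr
  linarith

theorem radius_le_div (i : ℕ) : 𝓜.radius i ≤ 𝓜.P.ℓ i / 64 := by
  have h1 := 𝓜.radius_le (le_refl i)
  have h2 := 𝓜.b.ρ_le
  have h3 := 𝓜.P.ℓ_pos i
  nlinarith

theorem smoothAt_jetSize_zero {f : ℝ → ℝ} {y : ℝ} (h : f =ᶠ[nhds y] fun _ => 0) :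
    SmoothAt f y ∧ ∀ ρ r n, jetSize ρ r n (jet f y) = 0 := by
  refine ⟨contDiffAt_const.congr_of_eventuallyEq h, fun ρ r n => ?_⟩
  rw [jet_congr h, jet_const]
  simp [jetSize]

theorem smoothAt_jetSize_corr (i : ℕ) (y : ℝ) : SmoothAt (𝓜.corr 𝓜.H (i + 1)) y ∧
    ∀ n, jetSize (𝓜.radius (i + 1)) 𝓜.r n (jet (𝓜.corr 𝓜.H (i + 1)) y) ≤
      8 * 𝓜.b.M * Real.exp (-(𝓜.P.c₄ / 2 * (𝓜.P.Q i : ℝ) ^ 𝓜.P.σ)) := by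
  have hℓ := 𝓜.P.ℓ_pos (i + 1)
  have hM := 𝓜.b.M_pos
  rcases lt_or_ge (2 * 𝓜.P.ℓ (i + 1)) (dst y) with hy | hy
  · have h := smoothAt_jetSize_zero (f := 𝓜.corr 𝓜.H (i + 1)) (y := y) (by
      filter_upwards [continuousAt_const.eventually_lt continuous_dst.continuousAt hy] with z hz
      exact 𝓜.corr_eq_zero hz.le)
    refine ⟨h.1, fun n => ?_⟩
    rw [h.2]; positivity
  · have hy4 : dst y ≤ 4 * 𝓜.P.ℓ (i + 1) := by linarith
    have hw : ∀ δ, (δ = α ∨ δ = -α) → ∀ i' ≤ i + 1, _ := fun δ hδ i' hi' =>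
      𝓜.smoothAt_jet_weyl_W hδ (𝓜.P.near_W hδ hy4 hi')
    have hp := Or.inl (b := α = -α) (rfl : α = α)
    have hm := Or.inr (a := -α = α) (rfl : -α = -α)
    have hc := 𝓜.b.smoothAt_cut hℓ (𝓜.P.ℓ_le _) y
    have hS : ∀ i' ≤ i + 1, SmoothAt (weylSum α 𝓜.H (𝓜.P.Q i' - 1)) y := fun i' hi' =>
      (hw _ hp i' hi').1.add (hw _ hm i' hi').1
    have hJ : ∀ i' ≤ i + 1, jet (weylSum α 𝓜.H (𝓜.P.Q i' - 1)) y =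
        weyl (chain (jet 𝓜.H) α y) (𝓜.P.Q i' - 1) +
          weyl (chain (jet 𝓜.H) (-α) y) (𝓜.P.Q i' - 1) := fun i' hi' => by
      rw [← (hw _ hp i' hi').2, ← (hw _ hm i' hi').2]
      exact jet_add (hw _ hp i' hi').1 (hw _ hm i' hi').1
    have h1 := hS (i + 1) le_rfl
    have h0 := hS i (Nat.le_succ i)
    refine ⟨hc.mul (h1.sub h0), fun n => ?_⟩
    have e : jet (𝓜.corr 𝓜.H (i + 1)) y = jet (𝓜.b.cut (𝓜.P.ℓ (i + 1))) y *
        (jet (weylSum α 𝓜.H (𝓜.P.Q (i + 1) - 1)) y - jet (weylSum α 𝓜.H (𝓜.P.Q i - 1)) y) := by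
      rw [← jet_sub h1 h0]
      exact jet_mul hc (h1.sub h0)
    have hρ := (𝓜.radius_pos (i + 1)).le
    have hd : 𝓜.radius (i + 1) ≤ 𝓜.b.ρ * (28 * 𝓜.P.ℓ (i + 1) / 32) := by
      unfold radius; exact le_of_eq (by ring)
    set N := jetNorm hρ 𝓜.r_nonneg n
    set 𝒮 := 𝓜.jetDiagonal hρ hd n
    have hrec : ∀ δ, (δ = α ∨ δ = -α) → N.size (weyl (chain (jet 𝓜.H) δ y) (𝓜.P.Q (i + 1) - 1) -
        weyl (chain (jet 𝓜.H) δ y) (𝓜.P.Q i - 1)) ≤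
          4 * Real.exp (-(𝓜.P.c₄ / 2 * (𝓜.P.Q i : ℝ) ^ 𝓜.P.σ)) := fun δ hδ => by
      obtain ⟨k, hk1, hkQ, hk, hkc⟩ := 𝓜.P.exists_record hδ hy4
      have hg : ∀ i' ≤ i + 1, (𝓜.P.geom (28 * 𝓜.P.ℓ (i + 1))).W δ y (𝓜.P.Q i' - 1) :=
        fun i' hi' => ⟨𝓜.P.near_W hδ hy4 hi', fun k h1 h2 =>
          𝓜.P.near_dst_ge hδ hy4 hi' h1 (by have := 𝓜.P.one_le_Q i'; omega)⟩
      have hQQ := 𝓜.P.Q_mono (Nat.le_succ i)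
      have h := 𝒮.size_weyl_sub_record_le δ hδ y _ _ (hg _ le_rfl) (hg i (Nat.le_succ i)) k hk1
        (by simp only [Nat.succ_eq_add_one] at hQQ; omega) (by omega) hk
      refine h.trans ?_
      have hθ0 : 0 ≤ 𝒮.θ := by
        change 0 ≤ 4 * Real.exp (2 * 3 * (𝓜.P.B + 𝓜.P.C₀)) / 𝓜.lam
        have := 𝓜.lam_pos
        positivity
      have hθ : 𝒮.θ ≤ Real.exp (-(1 / 2)) :=
        𝒮.θ_le.trans (by linarith [Real.add_one_le_exp (-(1 / 2 : ℝ))])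
      have hθk := pow_le_pow_left₀ hθ0 hθ k
      rw [← Real.exp_nat_mul] at hθk
      refine mul_le_mul_of_nonneg_left (hθk.trans (Real.exp_le_exp.2 ?_)) (by norm_num)
      linarith
    have hcut : N.size (jet (𝓜.b.cut (𝓜.P.ℓ (i + 1))) y) ≤ 𝓜.b.M :=
      𝓜.b.jetSize_cut_le hℓ (𝓜.P.ℓ_le _) hρ (𝓜.radius_le le_rfl) n y
    change N.size _ ≤ _
    rw [e, hJ (i + 1) le_rfl, hJ i (Nat.le_succ i), add_sub_add_comm]
    refine (N.size_mul _ _).trans ?_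
    have h2 := (N.size_add _ _).trans (add_le_add (hrec _ hp) (hrec _ hm))
    refine (mul_le_mul hcut h2 (N.size_nonneg _) (by linarith)).trans (le_of_eq (by ring))

theorem smoothAt_jetSize_mul_G {X : ℝ → ℝ} {ρ A u w : ℝ} (hX : ∀ y, SmoothAt X y) (hρ : 0 ≤ ρ)
    (hA : 0 ≤ A) (hu : 0 < u) (hρu : ρ ≤ u / 64)
    (hXA : ∀ n y, jetSize ρ 𝓜.r n (jet X y) ≤ A) (hXu : ∀ y, dst y ≤ u → X y = 0)
    (hXw : ∀ y, w ≤ dst y → X y = 0) (y : ℝ) : SmoothAt (fun z => X z * 𝓜.G z) y ∧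
      ∀ n, jetSize ρ 𝓜.r n (jet (fun z => X z * 𝓜.G z) y) ≤
        A * (2 * 𝓜.lam * Real.exp (-(w ^ (-𝓜.P.σ) / 16))) := by
  have hl := 𝓜.lam_pos
  have zero : (X =ᶠ[nhds y] fun _ => 0) → _ := fun h =>
    smoothAt_jetSize_zero (f := fun z => X z * 𝓜.G z) (y := y) (by
      filter_upwards [h] with z hz; rw [hz, zero_mul])
  rcases lt_or_ge (dst y) u with hyu | hyu
  · have h := zero (by
      filter_upwards [continuous_dst.continuousAt.eventually_lt continuousAt_const hyu] with z hz
      exact hXu z hz.le)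
    exact ⟨h.1, fun n => by rw [h.2]; positivity⟩
  rcases lt_or_ge w (dst y) with hyw | hyw
  · have h := zero (by
      filter_upwards [continuousAt_const.eventually_lt continuous_dst.continuousAt hyw] with z hz
      exact hXw z hz.le)
    exact ⟨h.1, fun n => by rw [h.2]; positivity⟩
  have hy0 := hu.trans_le hyu
  refine ⟨(hX y).mul (𝓜.smoothAt_G hy0), fun n => ?_⟩
  rw [jet_mul (hX y) (𝓜.smoothAt_G hy0), 𝓜.jet_G hy0]
  refine (jetSize_mul hρ 𝓜.r_nonneg n _ _).trans ?_
  rw [jetSize_C, abs_of_pos hl]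
  refine mul_le_mul (hXA n y) ?_ (mul_nonneg hl.le (jetSize_nonneg hρ _ _ _)) hA
  have h1 := jetSize_flat_le 𝓜.P.σ_pos 𝓜.P.σ_lt_one hy0 𝓜.r_nonneg hρ (by linarith) n
  have h2 : w ^ (-𝓜.P.σ) ≤ dst y ^ (-𝓜.P.σ) :=
    Real.rpow_le_rpow_of_nonpos hy0 hyw (neg_nonpos.2 𝓜.P.σ_pos.le)
  have h3 : Real.exp (-(dst y ^ (-𝓜.P.σ) / 16)) ≤ Real.exp (-(w ^ (-𝓜.P.σ) / 16)) :=
    Real.exp_le_exp.2 (by linarith)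
  nlinarith

theorem smoothAt_jetSize_sub {f g : ℝ → ℝ} {ρ r A A' y : ℝ} (hρ : 0 ≤ ρ)
    (hf : SmoothAt f y ∧ ∀ n, jetSize ρ r n (jet f y) ≤ A)
    (hg : SmoothAt g y ∧ ∀ n, jetSize ρ r n (jet g y) ≤ A') :
    SmoothAt (fun z => f z - g z) y ∧ ∀ n, jetSize ρ r n (jet (fun z => f z - g z) y) ≤ A + A' := by
  refine ⟨hf.1.sub hg.1, fun n => ?_⟩
  rw [jet_sub hf.1 hg.1, sub_eq_add_neg]
  refine (jetSize_add hρ _ _ _ _).trans ?_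
  rw [jetSize_neg]
  exact add_le_add (hf.2 n) (hg.2 n)

/-- The diagonal cut off at scale `m`. -/
def partialDiag (m : ℕ) (z : ℝ) : ℝ :=
  (1 - 𝓜.b.cut (𝓜.P.ℓ m) z) * 𝓜.G z + ∑ i ∈ Finset.Icc 1 m, 𝓜.corr 𝓜.H i z

/-- The difference of consecutive cut-off diagonals. -/
def increment (i : ℕ) (z : ℝ) : ℝ :=
  𝓜.corr 𝓜.H (i + 1) z + (𝓜.b.cut (𝓜.P.ℓ i) z - 𝓜.b.cut (𝓜.P.ℓ (i + 1)) z) * 𝓜.G z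

theorem partialDiag_succ (m : ℕ) (z : ℝ) :
    𝓜.partialDiag (m + 1) z = 𝓜.partialDiag m z + 𝓜.increment m z := by
  rw [partialDiag, partialDiag, increment, Finset.sum_Icc_succ_top (by omega)]
  ring

theorem partialDiag_eq_sum (m : ℕ) (z : ℝ) :
    𝓜.partialDiag m z = 𝓜.partialDiag 0 z + ∑ i ∈ Finset.range m, 𝓜.increment i z := by
  induction m with
  | zero => simp
  | succ m ih => rw [partialDiag_succ, ih, Finset.sum_range_succ, add_assoc]

theorem smoothAt_jetSize_partialDiag_zero (y : ℝ) : SmoothAt (𝓜.partialDiag 0) y ∧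
    ∀ n, jetSize (𝓜.radius 0) 𝓜.r n (jet (𝓜.partialDiag 0) y) ≤
      (1 + 𝓜.b.M) * (2 * 𝓜.lam * Real.exp (-((1 : ℝ) ^ (-𝓜.P.σ) / 16))) := by
  have hρ := (𝓜.radius_pos 0).le
  have hX := fun y => smoothAt_jetSize_sub (f := fun _ => 1) (g := 𝓜.b.cut (𝓜.P.ℓ 0))
    (r := 𝓜.r) (A := 1) (y := y) hρ
    ⟨contDiffAt_const, fun n => by rw [jet_const, map_one, jetSize_one]⟩
    ⟨𝓜.b.smoothAt_cut (𝓜.P.ℓ_pos 0) (𝓜.P.ℓ_le 0) y, fun n =>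
      𝓜.b.jetSize_cut_le (𝓜.P.ℓ_pos 0) (𝓜.P.ℓ_le 0) hρ (𝓜.radius_le le_rfl) n y⟩
  have h := 𝓜.smoothAt_jetSize_mul_G (w := 1) (fun y => (hX y).1) hρ
    (by linarith [𝓜.b.M_pos]) (𝓜.P.ℓ_pos 0) (𝓜.radius_le_div 0) (fun n y => (hX y).2 n)
    (fun y hy => by rw [𝓜.b.cut_eq_one (𝓜.P.ℓ_pos 0) hy, sub_self])
    (fun y hy => by linarith [dst_le_half y]) y
  have e : 𝓜.partialDiag 0 = fun z => (1 - 𝓜.b.cut (𝓜.P.ℓ 0) z) * 𝓜.G z := by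
    funext z; simp [partialDiag]
  rw [e]
  exact h

/-- The constant in the decay of the increments. -/
def incConst : ℝ := 8 * 𝓜.b.M + (𝓜.b.M + 𝓜.b.M) * (2 * 𝓜.lam)

/-- The rate in the decay of the increments. -/
def incRate : ℝ := min (𝓜.P.c₄ / 2) (1 / 16)

theorem incRate_pos : 0 < 𝓜.incRate := lt_min (by linarith [𝓜.P.c₄_pos]) (by norm_num)

theorem incConst_nonneg : 0 ≤ 𝓜.incConst := by
  have h1 := 𝓜.b.M_pos
  have h2 := 𝓜.lam_pos
  unfold incConst; positivity

theorem smoothAt_jetSize_increment (i : ℕ) (y : ℝ) : SmoothAt (𝓜.increment i) y ∧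
    ∀ n, jetSize (𝓜.radius (i + 1)) 𝓜.r n (jet (𝓜.increment i) y) ≤
      𝓜.incConst * Real.exp (-(𝓜.incRate * (𝓜.P.Q i : ℝ) ^ 𝓜.P.σ)) := by
  have hρ := (𝓜.radius_pos (i + 1)).le
  have hl := 𝓜.lam_pos
  have hM := 𝓜.b.M_pos
  have hcut : ∀ j ≤ i + 1, ∀ y, SmoothAt (𝓜.b.cut (𝓜.P.ℓ j)) y ∧
      ∀ n, jetSize (𝓜.radius (i + 1)) 𝓜.r n (jet (𝓜.b.cut (𝓜.P.ℓ j)) y) ≤ 𝓜.b.M :=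
    fun j hj y => ⟨𝓜.b.smoothAt_cut (𝓜.P.ℓ_pos j) (𝓜.P.ℓ_le j) y, fun n =>
      𝓜.b.jetSize_cut_le (𝓜.P.ℓ_pos j) (𝓜.P.ℓ_le j) hρ (𝓜.radius_le hj) n y⟩
  have hX := fun y => smoothAt_jetSize_sub hρ (hcut i (Nat.le_succ i) y) (hcut (i + 1) le_rfl y)
  have hℓ := 𝓜.P.ℓ_anti (Nat.le_succ i)
  have h1 := 𝓜.smoothAt_jetSize_mul_G (w := 2 * 𝓜.P.ℓ i) (fun y => (hX y).1) hρ
    (by linarith) (𝓜.P.ℓ_pos (i + 1)) (𝓜.radius_le_div _) (fun n y => (hX y).2 n)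
    (fun y hy => by
      rw [𝓜.b.cut_eq_one (𝓜.P.ℓ_pos _) hy, 𝓜.b.cut_eq_one (𝓜.P.ℓ_pos _) (hy.trans hℓ), sub_self])
    (fun y hy => by
      rw [𝓜.b.cut_eq_zero (𝓜.P.ℓ_pos _) hy,
        𝓜.b.cut_eq_zero (ℓ := 𝓜.P.ℓ (i + 1)) (𝓜.P.ℓ_pos _)
          (le_trans (mul_le_mul_of_nonneg_left hℓ (by norm_num)) hy), sub_self]) y
  have h2 := 𝓜.smoothAt_jetSize_corr i y
  refine ⟨h2.1.add h1.1, fun n => ?_⟩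
  rw [show 𝓜.increment i = fun z => 𝓜.corr 𝓜.H (i + 1) z +
    (𝓜.b.cut (𝓜.P.ℓ i) z - 𝓜.b.cut (𝓜.P.ℓ (i + 1)) z) * 𝓜.G z from rfl, jet_add h2.1 h1.1]
  refine (jetSize_add hρ _ _ _ _).trans ((add_le_add (h2.2 n) (h1.2 n)).trans ?_)
  have hQσ : 0 ≤ (𝓜.P.Q i : ℝ) ^ 𝓜.P.σ := by positivity
  have e1 : Real.exp (-(𝓜.P.c₄ / 2 * (𝓜.P.Q i : ℝ) ^ 𝓜.P.σ)) ≤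
      Real.exp (-(𝓜.incRate * (𝓜.P.Q i : ℝ) ^ 𝓜.P.σ)) := by
    have := mul_le_mul_of_nonneg_right (min_le_left (𝓜.P.c₄ / 2) (1 / 16)) hQσ
    exact Real.exp_le_exp.2 (neg_le_neg this)
  have e2 : (𝓜.P.Q i : ℝ) ^ 𝓜.P.σ ≤ (2 * 𝓜.P.ℓ i) ^ (-𝓜.P.σ) := by
    have hq := 𝓜.P.one_le_Q_cast i
    have a := 𝓜.P.ℓ_pos i
    have b := 𝓜.P.Q_mul_ℓ i
    rw [Real.rpow_neg (by positivity), ← Real.inv_rpow (by positivity)]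
    refine Real.rpow_le_rpow (by positivity) ?_ 𝓜.P.σ_pos.le
    rw [le_inv_comm₀ (by positivity) (by positivity), inv_eq_one_div, le_div_iff₀ (by positivity)]
    nlinarith
  have e3 : Real.exp (-((2 * 𝓜.P.ℓ i) ^ (-𝓜.P.σ) / 16)) ≤
      Real.exp (-(𝓜.incRate * (𝓜.P.Q i : ℝ) ^ 𝓜.P.σ)) := by
    have := mul_le_mul_of_nonneg_right (min_le_right (𝓜.P.c₄ / 2) (1 / 16)) hQσ
    exact Real.exp_le_exp.2 (neg_le_neg (this.trans (by linarith)))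
  have h3 := mul_le_mul_of_nonneg_left e1 (show 0 ≤ 8 * 𝓜.b.M by linarith)
  have h4 := mul_le_mul_of_nonneg_left e3
    (show 0 ≤ (𝓜.b.M + 𝓜.b.M) * (2 * 𝓜.lam) by positivity)
  unfold incConst
  linarith

end Model

end

section

namespace Model

variable {α : ℝ} (𝓜 : Model α)

/-- The Gevrey bound of the increments. -/
def incBound (a : ℝ) (i : ℕ) : ℝ :=
  𝓜.incConst * Real.exp (-(𝓜.incRate * (𝓜.P.Q i : ℝ) ^ 𝓜.P.σ)) *
    (2 * Real.exp (a * (2 / 𝓜.radius (i + 1)) ^ (1 / a)))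

theorem incBound_nonneg (a : ℝ) (i : ℕ) : 0 ≤ 𝓜.incBound a i := by
  have := 𝓜.incConst_nonneg
  unfold incBound; positivity

theorem gevreyBound_increment {a : ℝ} (ha : 0 < a) (i : ℕ) :
    GevreyBound (1 + 𝓜.r + a) (𝓜.incBound a i) (𝓜.increment i) :=
  gevreyBound_of_jetSize (𝓜.radius_pos _) ha
    (mul_nonneg 𝓜.incConst_nonneg (Real.exp_pos _).le)
    (fun x => (𝓜.smoothAt_jetSize_increment i x).1)
    fun n x => (𝓜.smoothAt_jetSize_increment i x).2 n

theorem tendsto_Q : Tendsto (fun i => (𝓜.P.Q i : ℝ)) atTop atTop := by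
  refine tendsto_natCast_atTop_atTop.comp (tendsto_atTop_mono 𝓜.P.pow_le_Q ?_)
  exact tendsto_pow_atTop_atTop_of_one_lt (by norm_num)

theorem summable_incBound {a : ℝ} (ha : 𝓜.P.β ^ 4 < a) : Summable (𝓜.incBound a) := by
  have hβ := 𝓜.P.β_pos
  have ha0 : 0 < a := lt_trans (by positivity) ha
  have hρ := 𝓜.b.ρ_pos
  have hCQ := 𝓜.P.F.one_le_CQ
  set D : ℝ := 2 * (64 * 8 / 7) / 𝓜.b.ρ * 𝓜.P.F.CQ
  have hD : 0 < D := by positivity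
  have h1 : ∀ i, (2 / 𝓜.radius (i + 1)) ^ (1 / a) ≤
      D ^ (1 / a) * (𝓜.P.Q i : ℝ) ^ (𝓜.P.β / a) := fun i => by
    have hq := 𝓜.P.Q_pos i
    have hq1 := 𝓜.P.Q_pos (i + 1)
    have hr : 2 / 𝓜.radius (i + 1) ≤ D * (𝓜.P.Q i : ℝ) ^ 𝓜.P.β := by
      have e : 2 / 𝓜.radius (i + 1) = 2 * (64 * 8 / 7) / 𝓜.b.ρ * 𝓜.P.Q (i + 1) := by
        unfold radius Setup.ℓ; field_simp
      rw [e, mul_assoc _ 𝓜.P.F.CQ]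
      exact mul_le_mul_of_nonneg_left (𝓜.P.F.Q_growth i) (by positivity)
    have := Real.rpow_le_rpow (by have := 𝓜.radius_pos (i + 1); positivity) hr
      (show 0 ≤ 1 / a by positivity)
    rwa [Real.mul_rpow hD.le (by positivity), ← Real.rpow_mul hq.le, mul_one_div] at this
  have hb : 𝓜.P.β / a < 𝓜.P.σ := by
    unfold Setup.σ
    rw [div_lt_div_iff₀ ha0 (by positivity)]
    linarith [show 𝓜.P.β * 𝓜.P.β ^ 3 = 𝓜.P.β ^ 4 by ring]
  have h2 := 𝓜.tendsto_Q.eventually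
    (eventually_mul_exp_le (A := a * D ^ (1 / a)) 𝓜.incRate_pos hb 𝓜.P.σ_pos)
  have hg : Summable fun i : ℕ => 2 * 𝓜.incConst * (1 / 3 : ℝ) ^ i :=
    (summable_geometric_of_lt_one (by norm_num) (by norm_num)).mul_left _
  refine Summable.of_norm_bounded_eventually_nat hg ?_
  filter_upwards [h2] with i hi
  have hC := 𝓜.incConst_nonneg
  have h3 : ((𝓜.P.Q i : ℝ))⁻¹ ≤ (1 / 3) ^ i := by
    rw [one_div, inv_pow]
    exact inv_anti₀ (by positivity) (by exact_mod_cast 𝓜.P.pow_le_Q i)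
  have h4 : Real.exp (a * (2 / 𝓜.radius (i + 1)) ^ (1 / a)) ≤
      Real.exp (a * D ^ (1 / a) * (𝓜.P.Q i : ℝ) ^ (𝓜.P.β / a)) := by
    refine Real.exp_le_exp.2 ?_
    rw [mul_assoc]
    exact mul_le_mul_of_nonneg_left (h1 i) ha0.le
  rw [Real.norm_of_nonneg (𝓜.incBound_nonneg a i), incBound]
  calc _ ≤ 𝓜.incConst * Real.exp (-(𝓜.incRate * (𝓜.P.Q i : ℝ) ^ 𝓜.P.σ)) *
        (2 * Real.exp (a * D ^ (1 / a) * (𝓜.P.Q i : ℝ) ^ (𝓜.P.β / a))) := by gcongr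
    _ = 2 * 𝓜.incConst * (Real.exp (a * D ^ (1 / a) * (𝓜.P.Q i : ℝ) ^ (𝓜.P.β / a)) *
        Real.exp (-(𝓜.incRate * (𝓜.P.Q i : ℝ) ^ 𝓜.P.σ))) := by ring
    _ ≤ _ := by gcongr; exact hi.trans h3

/-- The limit of the cut-off diagonals. -/
def limitDiag (z : ℝ) : ℝ := 𝓜.partialDiag 0 z + ∑' i, 𝓜.increment i z

theorem gevreyBound_partialDiag_zero {a : ℝ} (ha : 0 < a) :
    ∃ C, GevreyBound (1 + 𝓜.r + a) C (𝓜.partialDiag 0) :=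
  ⟨_, gevreyBound_of_jetSize (𝓜.radius_pos 0) ha (by
    have := 𝓜.b.M_pos; have := 𝓜.lam_pos; positivity)
    (fun x => (𝓜.smoothAt_jetSize_partialDiag_zero x).1)
    fun n x => (𝓜.smoothAt_jetSize_partialDiag_zero x).2 n⟩

theorem gevreyBound_partialDiag {a : ℝ} (ha : 0 < a) (m : ℕ) :
    ∃ C, GevreyBound (1 + 𝓜.r + a) C (𝓜.partialDiag m) := by
  induction m with
  | zero => exact 𝓜.gevreyBound_partialDiag_zero ha
  | succ m ih =>
    obtain ⟨C, hC⟩ := ih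
    refine ⟨C + 𝓜.incBound a m, ?_⟩
    rw [funext (𝓜.partialDiag_succ m)]
    exact hC.add (𝓜.gevreyBound_increment ha m)

theorem param_pos {a : ℝ} (ha : 𝓜.P.β ^ 4 < a) : 0 < a :=
  lt_trans (by have := 𝓜.P.β_pos; positivity) ha

theorem gevreyBound_limitDiag {a : ℝ} (ha : 𝓜.P.β ^ 4 < a) :
    ∃ C, GevreyBound (1 + 𝓜.r + a) C 𝓜.limitDiag := by
  obtain ⟨C, hC⟩ := 𝓜.gevreyBound_partialDiag_zero (𝓜.param_pos ha)
  exact ⟨_, hC.add (GevreyBound.tsum (𝓜.gevreyBound_increment (𝓜.param_pos ha))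
    (𝓜.summable_incBound ha))⟩

theorem summable_increment {a : ℝ} (ha : 𝓜.P.β ^ 4 < a) (z : ℝ) :
    Summable fun i => 𝓜.increment i z := by
  refine Summable.of_norm_bounded (𝓜.summable_incBound ha) fun i => ?_
  have := (𝓜.gevreyBound_increment (𝓜.param_pos ha) i).2 0 z
  simpa using this

theorem limitDiag_sub_partialDiag {a : ℝ} (ha : 𝓜.P.β ^ 4 < a) (m : ℕ) (z : ℝ) :
    𝓜.limitDiag z - 𝓜.partialDiag m z = ∑' i, 𝓜.increment (i + m) z := by
  rw [limitDiag, 𝓜.partialDiag_eq_sum m, ← (𝓜.summable_increment ha z).sum_add_tsum_nat_add m]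
  ring

theorem gevreyBound_limitDiag_sub {a : ℝ} (ha : 𝓜.P.β ^ 4 < a) (m : ℕ) : GevreyBound (1 + 𝓜.r + a)
    (∑' i, 𝓜.incBound a (i + m)) (fun z => 𝓜.limitDiag z - 𝓜.partialDiag m z) := by
  rw [funext (𝓜.limitDiag_sub_partialDiag ha m)]
  exact GevreyBound.tsum (fun i => 𝓜.gevreyBound_increment (𝓜.param_pos ha) (i + m))
    ((summable_nat_add_iff m).2 (𝓜.summable_incBound ha))

theorem tendsto_tail (a : ℝ) : Tendsto (fun m => ∑' i, 𝓜.incBound a (i + m)) atTop (nhds 0) :=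
  tendsto_sum_nat_add _

theorem tendsto_partialDiag {a : ℝ} (ha : 𝓜.P.β ^ 4 < a) (z : ℝ) :
    Tendsto (fun m => 𝓜.partialDiag m z) atTop (nhds (𝓜.limitDiag z)) := by
  rw [funext fun m => 𝓜.partialDiag_eq_sum m z]
  exact (𝓜.summable_increment ha z).hasSum.tendsto_sum_nat.const_add _

theorem partialDiag_eq_H {m : ℕ} {z : ℝ} (hz : 2 * 𝓜.P.ℓ m < dst z) :
    𝓜.partialDiag m z = 𝓜.H z := by
  have h1 := 𝓜.P.ℓ_anti (Nat.le_succ m)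
  rw [partialDiag, 𝓜.b.cut_eq_zero (𝓜.P.ℓ_pos m) hz.le, 𝓜.H_eq (M := m) (by
    simp only [Nat.succ_eq_add_one] at h1; linarith)]
  ring

theorem partialDiag_eq_weylSum {m : ℕ} {z : ℝ} (hz : dst z ≤ 𝓜.P.ℓ m) :
    𝓜.partialDiag m z = weylSum α 𝓜.H (𝓜.P.Q m - 1) z := by
  rw [partialDiag, 𝓜.b.cut_eq_one (𝓜.P.ℓ_pos m) hz, 𝓜.sum_corr_telescope hz]
  ring

theorem limitDiag_eq_H {a : ℝ} (ha : 𝓜.P.β ^ 4 < a) {z : ℝ} (hz : 0 < dst z) :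
    𝓜.limitDiag z = 𝓜.H z := by
  obtain ⟨M, hM⟩ := 𝓜.P.exists_ℓ_lt hz
  refine tendsto_nhds_unique (𝓜.tendsto_partialDiag ha z) (tendsto_const_nhds.congr' ?_)
  filter_upwards [eventually_ge_atTop M] with m hm
  have := 𝓜.P.ℓ_anti hm
  rw [𝓜.partialDiag_eq_H (by linarith)]

theorem partialDiag_periodic (m : ℕ) : Function.Periodic (𝓜.partialDiag m) 1 := fun z => by
  rw [partialDiag, partialDiag, 𝓜.b.cut_periodic, 𝓜.G_periodic]
  simp only [𝓜.corr_periodic 𝓜.H_periodic _ z]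

theorem limitDiag_periodic : Function.Periodic 𝓜.limitDiag 1 := fun z => by
  have h : ∀ i, 𝓜.increment i (z + 1) = 𝓜.increment i z := fun i => by
    rw [increment, increment, 𝓜.corr_periodic 𝓜.H_periodic, 𝓜.b.cut_periodic, 𝓜.b.cut_periodic,
      𝓜.G_periodic]
  rw [limitDiag, limitDiag, 𝓜.partialDiag_periodic]
  simp only [h]

theorem abs_weyl_le {δ : ℝ} (hδ : δ = α ∨ δ = -α) {x : ℝ} {n : ℕ} (hW : 𝓜.P.W δ x n) :
    |weyl (chain 𝓜.H δ x) n| ≤ 2 := by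
  have h := 𝓜.realDiagonal.size_weyl_sub_record_le δ hδ x n 0 (𝓜.geom_zero_W hW)
    (𝓜.geom_zero_W (𝓜.P.W_zero δ x)) 1 le_rfl (by omega) le_rfl (fun m h1 h2 => by omega)
  rw [weyl_zero, sub_zero, pow_one] at h
  have h2 := 𝓜.realDiagonal.θ_le
  exact h.trans (by linarith)

theorem abs_weylSum_le {y : ℝ} {i i' : ℕ} (hy : dst y ≤ 4 * 𝓜.P.ℓ i) (hi : i' ≤ i) :
    |weylSum α 𝓜.H (𝓜.P.Q i' - 1) y| ≤ 4 := by
  have h1 := 𝓜.abs_weyl_le (Or.inl rfl) (𝓜.P.near_W (Or.inl rfl) hy hi)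
  have h2 := 𝓜.abs_weyl_le (Or.inr rfl) (𝓜.P.near_W (Or.inr rfl) hy hi)
  exact (abs_add_le _ _).trans (by linarith)

theorem abs_sum_corr_le (m : ℕ) (y : ℝ) : |∑ i ∈ Finset.Icc 1 m, 𝓜.corr 𝓜.H i y| ≤ 12 := by
  induction m with
  | zero => simp
  | succ m ih =>
    rw [Finset.sum_Icc_succ_top (by omega)]
    rcases lt_or_ge (2 * 𝓜.P.ℓ (m + 1)) (dst y) with hy | hy
    · rwa [𝓜.corr_eq_zero hy.le, add_zero]
    · have h1 := 𝓜.P.ℓ_succ_le m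
      have hℓ := 𝓜.P.ℓ_pos (m + 1)
      have h2 := 𝓜.abs_weylSum_le (i := m + 1) (i' := m) (y := y) (by linarith) (by omega)
      have h3 := 𝓜.abs_weylSum_le (i := m + 1) (y := y) (by linarith) le_rfl
      have h4 := 𝓜.b.cut_nonneg (𝓜.P.ℓ (m + 1)) y
      have h5 := 𝓜.b.cut_le_one (𝓜.P.ℓ (m + 1)) y
      rw [𝓜.sum_corr_telescope (by linarith), corr, Nat.add_sub_cancel]
      refine (abs_add_le _ _).trans ?_
      rw [abs_mul, abs_of_nonneg h4]
      have h6 := abs_sub (weylSum α 𝓜.H (𝓜.P.Q (m + 1) - 1) y) (weylSum α 𝓜.H (𝓜.P.Q m - 1) y)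
      nlinarith [abs_nonneg (weylSum α 𝓜.H (𝓜.P.Q (m + 1) - 1) y - weylSum α 𝓜.H (𝓜.P.Q m - 1) y)]

theorem abs_partialDiag_le (m : ℕ) (z : ℝ) : |𝓜.partialDiag m z| ≤ 2 * 𝓜.lam := by
  have hl := 𝓜.lam_pos
  have h0 := 𝓜.lam_ge
  have hM := 𝓜.b.M_pos
  have h1 := 𝓜.abs_sum_corr_le m z
  have hG0 : 0 < 𝓜.G z := mul_pos hl (flat_pos _ _)
  have hG : 𝓜.G z ≤ 𝓜.lam := by
    have : flat 𝓜.P.σ z ≤ 1 := Real.exp_le_one_iff.2 (neg_nonpos.2 (by positivity))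
    unfold G; nlinarith
  have h4 := 𝓜.b.cut_nonneg (𝓜.P.ℓ m) z
  have h5 := 𝓜.b.cut_le_one (𝓜.P.ℓ m) z
  have h6 : |(1 - 𝓜.b.cut (𝓜.P.ℓ m) z) * 𝓜.G z| ≤ 𝓜.lam := by
    rw [abs_of_nonneg (mul_nonneg (by linarith) hG0.le)]; nlinarith
  exact (abs_add_le _ _).trans (by linarith)

end Model

end

section

theorem opNorm_nonneg (M : Matrix (Fin 2) (Fin 2) ℝ) : 0 ≤ opNorm M := norm_nonneg _

theorem opNorm_mul_le (M N : Matrix (Fin 2) (Fin 2) ℝ) :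
    opNorm (M * N) ≤ opNorm M * opNorm N := by
  unfold opNorm
  rw [map_mul]
  exact norm_mul_le _ _

theorem opNorm_one : opNorm 1 = 1 := by
  unfold opNorm
  rw [map_one]
  exact norm_one

theorem sq_add_sq_le_opNorm_sq (M : Matrix (Fin 2) (Fin 2) ℝ) (j : Fin 2) :
    M 0 j ^ 2 + M 1 j ^ 2 ≤ opNorm M ^ 2 := by
  have h := (Matrix.toEuclideanCLM (𝕜 := ℝ) M).le_opNorm (EuclideanSpace.single j 1)
  rw [PiLp.norm_single, norm_one, mul_one] at h
  have h2 := pow_le_pow_left₀ (norm_nonneg _) h 2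
  rw [EuclideanSpace.norm_sq_eq, Fin.sum_univ_two] at h2
  rw [opNorm]
  simpa [Matrix.mulVec_single] using h2

theorem abs_entry_le_opNorm (M : Matrix (Fin 2) (Fin 2) ℝ) (i j : Fin 2) :
    |M i j| ≤ opNorm M := by
  refine abs_le_of_sq_le_sq ?_ (opNorm_nonneg M)
  have h := sq_add_sq_le_opNorm_sq M j
  fin_cases i
  · simp only [Fin.zero_eta]; nlinarith [sq_nonneg (M 1 j)]
  · simp only [Fin.mk_one]; nlinarith [sq_nonneg (M 0 j)]

theorem one_le_opNorm {M : Matrix (Fin 2) (Fin 2) ℝ} (h : M.det = 1) : 1 ≤ opNorm M := by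
  rw [Matrix.det_fin_two] at h
  have h0 := sq_add_sq_le_opNorm_sq M 0
  have h1 := sq_add_sq_le_opNorm_sq M 1
  have hn := opNorm_nonneg M
  have h2 : (1 : ℝ) ≤ (M 0 0 ^ 2 + M 1 0 ^ 2) * (M 0 1 ^ 2 + M 1 1 ^ 2) := by
    nlinarith [sq_nonneg (M 0 0 * M 0 1 + M 1 0 * M 1 1)]
  have h3 : 1 ≤ opNorm M ^ 2 * opNorm M ^ 2 :=
    h2.trans (mul_le_mul h0 h1 (by positivity) (by positivity))
  by_contra! hc
  have h4 : opNorm M ^ 2 < 1 := by nlinarith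
  nlinarith [sq_nonneg (opNorm M)]

theorem opNorm_eq_sum (M : Matrix (Fin 2) (Fin 2) ℝ) : opNorm M = ‖∑ i : Fin 2, ∑ j : Fin 2,
    M i j • Matrix.toEuclideanCLM (𝕜 := ℝ) (n := Fin 2) (Matrix.single i j 1)‖ := by
  unfold opNorm
  conv_lhs => rw [Matrix.matrix_eq_sum_single M]
  simp only [map_sum, ← map_smul, Matrix.smul_single, smul_eq_mul, mul_one]

theorem continuous_opNorm {X : Type*} [TopologicalSpace X] {F : X → Matrix (Fin 2) (Fin 2) ℝ}
    (h : ∀ i j, Continuous fun x => F x i j) : Continuous fun x => opNorm (F x) := by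
  simp only [opNorm_eq_sum]
  exact continuous_norm.comp (continuous_finsetSum _ fun i _ => continuous_finsetSum _ fun j _ =>
    (h i j).smul continuous_const)

theorem opNorm_le_sum (M : Matrix (Fin 2) (Fin 2) ℝ) :
    opNorm M ≤ |M 0 0| + |M 0 1| + |M 1 0| + |M 1 1| := by
  refine ContinuousLinearMap.opNorm_le_bound _ (by positivity) fun x => ?_
  have hx : ∀ j, |x j| ≤ ‖x‖ := fun j => PiLp.norm_apply_le x j
  have hx0 := hx 0
  have hx1 := hx 1
  set y := Matrix.toEuclideanCLM (𝕜 := ℝ) M x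
  have hy : ∀ i, y i = M i 0 * x 0 + M i 1 * x 1 := fun i => by
    simp [y, Matrix.mulVec, dotProduct, Fin.sum_univ_two]
  have hyi : ∀ i, |y i| ≤ (|M i 0| + |M i 1|) * ‖x‖ := fun i => by
    rw [hy, add_mul]
    refine (abs_add_le _ _).trans (add_le_add ?_ ?_) <;> rw [abs_mul] <;> gcongr
  have hn : ‖y‖ ≤ |y 0| + |y 1| := by
    refine abs_le_of_sq_le_sq' ?_ (by positivity) |>.2
    rw [EuclideanSpace.norm_sq_eq, Fin.sum_univ_two, Real.norm_eq_abs, Real.norm_eq_abs]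
    nlinarith [abs_nonneg (y 0), abs_nonneg (y 1)]
  linarith [hyi 0, hyi 1]

section Cocycle

variable {α : ℝ} {f : ℝ → ℝ}

theorem transfer_real_det (a : ℕ → ℝ) (n : ℕ) : (transfer a n).det = 1 := transfer_det a n

theorem cocIter_schrodMat (α E : ℝ) (f : ℝ → ℝ) (n : ℕ) (x : ℝ) :
    cocIter α (schrodMat E fun y => E - f y) n x = transfer (chain f α (x - α)) n := by
  induction n with
  | zero => rfl
  | succ n ih =>
    rw [cocIter, transfer, ih, schrodMat, stepM, chain, sub_sub_cancel]
    congr 5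
    push_cast
    ring

/-- The logarithm of the norm of the transfer matrix. -/
def logNorm (α : ℝ) (f : ℝ → ℝ) (n : ℕ) (x : ℝ) : ℝ :=
  Real.log (opNorm (transfer (chain f α x) n))

/-- The integrated logarithm of the norm of the transfer matrix. -/
def logInt (α : ℝ) (f : ℝ → ℝ) (n : ℕ) : ℝ := ∫ x in (0 : ℝ)..1, logNorm α f n x

theorem logNorm_nonneg (α : ℝ) (f : ℝ → ℝ) (n : ℕ) (x : ℝ) : 0 ≤ logNorm α f n x :=
  Real.log_nonneg (one_le_opNorm (transfer_real_det _ _))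

theorem chain_periodic (hp : Function.Periodic f 1) (x : ℝ) :
    chain f α (x + 1) = chain f α x := funext fun k => by
  rw [chain, chain, show x + 1 + k * α = x + k * α + 1 by ring, hp]

theorem logNorm_periodic (hp : Function.Periodic f 1) (n : ℕ) :
    Function.Periodic (logNorm α f n) 1 := fun x => by
  rw [logNorm, logNorm, chain_periodic hp]

theorem continuous_transfer (hf : Continuous f) (n : ℕ) (i j : Fin 2) :
    Continuous fun x => transfer (chain f α x) n i j := by
  induction n generalizing i with
  | zero => exact continuous_const
  | succ n ih =>
    fin_cases i
    · simp only [Fin.zero_eta, transfer_succ_zero]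
      exact ((hf.comp (continuous_id.add continuous_const)).mul (ih 0)).sub (ih 1)
    · simp only [Fin.mk_one, transfer_succ_one]
      exact ih 0

theorem continuous_logNorm (hf : Continuous f) (n : ℕ) : Continuous (logNorm α f n) :=
  (continuous_opNorm (continuous_transfer hf n)).log fun _ =>
    (one_pos.trans_le (one_le_opNorm (transfer_real_det _ _))).ne'

theorem integral_shift {φ : ℝ → ℝ} (hp : Function.Periodic φ 1) (t : ℝ) :
    ∫ x in (0 : ℝ)..1, φ (x + t) = ∫ x in (0 : ℝ)..1, φ x := by
  rw [intervalIntegral.integral_comp_add_right, zero_add]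
  have := hp.intervalIntegral_add_eq t 0
  rwa [zero_add, add_comm t] at this

theorem logNorm_add_le (m n : ℕ) (x : ℝ) :
    logNorm α f (m + n) x ≤ logNorm α f m x + logNorm α f n (x + m * α) := by
  have h1 := one_le_opNorm (transfer_real_det (chain f α x) m)
  have h2 := one_le_opNorm (transfer_real_det (chain f α (x + m * α)) n)
  have h3 := one_le_opNorm (transfer_real_det (chain f α x) (m + n))
  unfold logNorm
  rw [← Real.log_mul (by positivity) (by positivity)]
  refine Real.log_le_log (by positivity) ?_
  rw [transfer_add, chain_shift, mul_comm (opNorm _)]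
  exact opNorm_mul_le _ _

theorem logInt_subadditive (hf : Continuous f) (hp : Function.Periodic f 1) :
    Subadditive (logInt α f) := fun m n => by
  have hc := fun n => continuous_logNorm (α := α) hf n
  have hs : Continuous fun x => logNorm α f n (x + m * α) :=
    (hc n).comp (continuous_id.add continuous_const)
  rw [logInt, logInt, logInt, ← integral_shift (logNorm_periodic hp n) (m * α),
    ← intervalIntegral.integral_add ((hc m).intervalIntegrable _ _) (hs.intervalIntegrable _ _)]
  exact intervalIntegral.integral_mono_on zero_le_one ((hc _).intervalIntegrable _ _)
    (((hc m).add hs).intervalIntegrable _ _) fun x _ => logNorm_add_le m n x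

theorem logInt_nonneg (n : ℕ) : 0 ≤ logInt α f n :=
  intervalIntegral.integral_nonneg zero_le_one fun x _ => logNorm_nonneg α f n x

theorem bddBelow_logInt : BddBelow (Set.range fun n => logInt α f n / n) :=
  ⟨0, by rintro _ ⟨n, rfl⟩; exact div_nonneg (logInt_nonneg n) (Nat.cast_nonneg n)⟩

theorem lyap_eq_lim (E : ℝ) (hf : Continuous f) (hp : Function.Periodic f 1) :
    lyap α (schrodMat E fun y => E - f y) = (logInt_subadditive (α := α) hf hp).lim := by
  refine Tendsto.limsup_eq
    (((logInt_subadditive (α := α) hf hp).tendsto_lim bddBelow_logInt).congr fun n => ?_)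
  have h : ∫ x in (0 : ℝ)..1, Real.log (opNorm (cocIter α (schrodMat E fun y => E - f y) n x)) =
      ∫ x in (0 : ℝ)..1, logNorm α f n (x + -α) := by
    simp only [cocIter_schrodMat, logNorm, ← sub_eq_add_neg]
  rw [h, integral_shift (logNorm_periodic hp n), div_eq_inv_mul, logInt]

theorem lyap_le (E : ℝ) (hf : Continuous f) (hp : Function.Periodic f 1) {n : ℕ} (hn : n ≠ 0) :
    lyap α (schrodMat E fun y => E - f y) ≤ logInt α f n / n := by
  rw [lyap_eq_lim E hf hp]
  exact Subadditive.lim_le_div _ bddBelow_logInt hn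

theorem le_lyap (E : ℝ) (hf : Continuous f) (hp : Function.Periodic f 1) {c : ℝ}
    (h : ∀ n : ℕ, 1 ≤ n → c * n ≤ logInt α f n) :
    c ≤ lyap α (schrodMat E fun y => E - f y) := by
  rw [lyap_eq_lim E hf hp]
  refine ge_of_tendsto ((logInt_subadditive (α := α) hf hp).tendsto_lim bddBelow_logInt) ?_
  filter_upwards [eventually_ge_atTop 1] with n hn
  rw [le_div_iff₀ (by exact_mod_cast hn)]
  exact h n hn

end Cocycle

/-- The indicator of the points closer than `ε` to the integers. -/
def near (ε : ℝ) : ℝ → ℝ := Set.indicator {x | dst x < ε} fun _ => 1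

theorem near_nonneg (ε x : ℝ) : 0 ≤ near ε x := Set.indicator_nonneg (fun _ _ => zero_le_one) x

theorem near_eq_one {ε x : ℝ} (h : dst x < ε) : near ε x = 1 :=
  Set.indicator_of_mem (s := {x | dst x < ε}) (a := x) h _

theorem near_eq_zero {ε x : ℝ} (h : ¬ dst x < ε) : near ε x = 0 :=
  Set.indicator_of_notMem (s := {x | dst x < ε}) (a := x) h _

theorem near_periodic (ε : ℝ) : Function.Periodic (near ε) 1 := fun x => by
  by_cases h : dst x < ε
  · rw [near_eq_one h, near_eq_one (by rwa [dst_periodic x])]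
  · rw [near_eq_zero h, near_eq_zero (by rwa [dst_periodic x])]

theorem measurable_near (ε : ℝ) : Measurable (near ε) :=
  measurable_const.indicator (isOpen_lt continuous_dst continuous_const).measurableSet

theorem intervalIntegrable_near (ε t a b : ℝ) :
    IntervalIntegrable (fun x => near ε (x + t)) volume a b := by
  refine (intervalIntegrable_const (c := (1 : ℝ))).mono_fun
    ((measurable_near ε).comp (measurable_id.add_const t)).aestronglyMeasurable
    (ae_of_all _ fun x => ?_)
  change ‖near ε (x + t)‖ ≤ ‖(1 : ℝ)‖
  by_cases h : dst (x + t) < ε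
  · rw [near_eq_one h]
  · rw [near_eq_zero h, norm_zero, norm_one]
    exact zero_le_one

theorem integral_near {ε : ℝ} (h0 : 0 ≤ ε) (h1 : ε ≤ 1 / 2) (t : ℝ) :
    ∫ x in (0 : ℝ)..1, near ε (x + t) = 2 * ε := by
  rw [integral_shift (near_periodic ε)]
  have h2 := (near_periodic ε).intervalIntegral_add_eq 0 (-(1 / 2))
  rw [zero_add] at h2
  rw [h2, intervalIntegral.integral_of_le (by norm_num)]
  have h3 : ∫ x in Set.Ioc (-(1 / 2)) (-(1 / 2) + 1), near ε x =
      ∫ x in Set.Ioc (-(1 / 2) : ℝ) (-(1 / 2) + 1),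
        Set.indicator (Set.Ioo (-ε) ε) (fun _ => 1) x := by
    rw [integral_Ioc_eq_integral_Ioo, integral_Ioc_eq_integral_Ioo]
    refine setIntegral_congr_fun measurableSet_Ioo fun x hx => ?_
    have hd : dst x = |x| := dst_eq_abs (abs_lt.2 ⟨hx.1, by linarith [hx.2]⟩)
    by_cases h : x ∈ Set.Ioo (-ε) ε
    · rw [near_eq_one (by rw [hd]; exact abs_lt.2 h), Set.indicator_of_mem h]
    · rw [near_eq_zero (by rw [hd, abs_lt]; exact h), Set.indicator_of_notMem h]
  have h4 : Set.Ioo (-ε) ε ⊆ Set.Ioc (-(1 / 2)) (-(1 / 2) + 1) :=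
    fun x hx => ⟨by linarith [hx.1], by linarith [hx.2]⟩
  rw [h3, setIntegral_indicator measurableSet_Ioo, setIntegral_const, smul_eq_mul, mul_one,
    Set.inter_eq_right.2 h4,
    Real.volume_real_Ioo_of_le (by linarith)]
  ring

end

section

theorem opNorm_transfer_le {α : ℝ} {f : ℝ → ℝ} {D : ℝ} (hD : 2 ≤ D) (hf : ∀ z, |f z| ≤ 2 * D)
    (n : ℕ) (x : ℝ) : opNorm (transfer (chain f α x) n) ≤ (4 * D) ^ n := by
  induction n with
  | zero => rw [transfer, opNorm_one, pow_zero]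
  | succ n ih =>
    rw [transfer, pow_succ']
    refine (opNorm_mul_le _ _).trans (mul_le_mul ?_ ih (opNorm_nonneg _) (by positivity))
    refine (opNorm_le_sum _).trans ?_
    have := hf (x + (n + 1 : ℕ) * α)
    simp only [stepM, chain, Matrix.of_apply, Matrix.cons_val', Matrix.cons_val_zero,
      Matrix.cons_val_one, Matrix.cons_val_fin_one, abs_neg, abs_one, abs_zero]
    linarith

theorem logNorm_le {α : ℝ} {f : ℝ → ℝ} {D : ℝ} (hD : 2 ≤ D) (hf : ∀ z, |f z| ≤ 2 * D)
    (n : ℕ) (x : ℝ) : logNorm α f n x ≤ n * Real.log (4 * D) := by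
  rw [← Real.log_pow]
  exact Real.log_le_log (one_pos.trans_le (one_le_opNorm (transfer_real_det _ _)))
    (opNorm_transfer_le hD hf n x)

/-- A resonant window: the entry on the diagonal cancels both Weyl functions. -/
theorem opNorm_resonant_le {R L : Matrix (Fin 2) (Fin 2) ℝ} {A q e : ℝ} (hR : R.det = 1)
    (hL : L.det = 1) (hR0 : R 0 0 ≠ 0) (hL0 : L 0 0 ≠ 0) (hRA : ∀ i j, |R i j| ≤ A)
    (hLA : ∀ i j, |L i j| ≤ A) (hRq : |(R 0 0)⁻¹| ≤ q) (hLq : |(L 0 0)⁻¹| ≤ q)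
    (he : e = -(R 0 1) * (R 0 0)⁻¹ + L 1 0 * (L 0 0)⁻¹) :
    opNorm (R * stepM e * L) ≤ 4 * (A * q) := by
  rw [Matrix.det_fin_two] at hR hL
  have hA : 0 ≤ A := (abs_nonneg _).trans (hRA 0 0)
  have h00 : (R * stepM e * L) 0 0 = 0 := by
    simp only [stepM, Matrix.mul_apply, Fin.sum_univ_two, Matrix.of_apply, Matrix.cons_val',
      Matrix.cons_val_zero, Matrix.cons_val_one, Matrix.cons_val_fin_one, he]
    field_simp
    ring
  have h01 : (R * stepM e * L) 0 1 = -(R 0 0 * (L 0 0)⁻¹) := by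
    simp only [stepM, Matrix.mul_apply, Fin.sum_univ_two, Matrix.of_apply, Matrix.cons_val',
      Matrix.cons_val_zero, Matrix.cons_val_one, Matrix.cons_val_fin_one, he]
    field_simp
    linear_combination -(R 0 0) * hL
  have h10 : (R * stepM e * L) 1 0 = L 0 0 * (R 0 0)⁻¹ := by
    simp only [stepM, Matrix.mul_apply, Fin.sum_univ_two, Matrix.of_apply, Matrix.cons_val',
      Matrix.cons_val_zero, Matrix.cons_val_one, Matrix.cons_val_fin_one, he]
    field_simp
    linear_combination L 0 0 * hR
  have h11 : (R * stepM e * L) 1 1 = L 0 1 * (R 0 0)⁻¹ - R 1 0 * (L 0 0)⁻¹ := by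
    simp only [stepM, Matrix.mul_apply, Fin.sum_univ_two, Matrix.of_apply, Matrix.cons_val',
      Matrix.cons_val_zero, Matrix.cons_val_one, Matrix.cons_val_fin_one, he]
    field_simp
    linear_combination L 0 0 * L 0 1 * hR - R 0 0 * R 1 0 * hL
  have hm : ∀ a b : ℝ, |a| ≤ A → |b| ≤ q → |a * b| ≤ A * q := fun a b ha hb => by
    rw [abs_mul]
    exact mul_le_mul ha hb (abs_nonneg _) hA
  refine (opNorm_le_sum _).trans ?_
  rw [h00, h01, h10, h11, abs_neg, abs_zero]
  have := abs_sub (L 0 1 * (R 0 0)⁻¹) (R 1 0 * (L 0 0)⁻¹)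
  linarith [hm _ _ (hRA 0 0) hLq, hm _ _ (hLA 0 0) hRq, hm _ _ (hLA 0 1) hRq,
    hm _ _ (hRA 1 0) hLq]

namespace Model

variable {α : ℝ} (𝓜 : Model α)

/-- The growth rate along admissible chains. -/
def rate : ℝ := Real.log (𝓜.lam / 2) - 3 * 𝓜.P.B

theorem le_logNorm_of_W {a : ℝ} (ha : 𝓜.P.β ^ 4 < a) {x : ℝ} {n : ℕ} (hW : 𝓜.P.W α x n) :
    n * 𝓜.rate ≤ logNorm α 𝓜.limitDiag n x := by
  have hl := 𝓜.lam_pos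
  have h0 := 𝓜.transfer_ne_zero (Or.inl rfl) hW
  have h1 := 𝓜.transfer_inv_le (Or.inl rfl) hW
  have hc : transfer (chain 𝓜.limitDiag α x) n = transfer (chain 𝓜.H α x) n :=
    transfer_congr fun k hk hkn => 𝓜.limitDiag_eq_H ha (hW.dst_pos hk hkn)
  have h2 := Real.log_le_log (abs_pos.2 (inv_ne_zero h0)) h1
  rw [abs_inv, Real.log_inv, Real.log_mul (by positivity) (by positivity), Real.log_pow,
    Real.log_exp] at h2
  have h3 : Real.log (2 / 𝓜.lam) = -Real.log (𝓜.lam / 2) := by rw [← Real.log_inv, inv_div]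
  rw [h3] at h2
  have h4 := Real.log_le_log (abs_pos.2 h0) (abs_entry_le_opNorm _ 0 0)
  rw [logNorm, hc, rate]
  linarith

theorem le_logNorm {a : ℝ} (ha : 𝓜.P.β ^ 4 < a) (hr : 0 ≤ 𝓜.rate) (x : ℝ) (n : ℕ) :
    n * 𝓜.rate * (1 - ∑ k ∈ Finset.range n,
      (near (𝓜.P.c / ((k + 1 : ℕ) : ℝ) ^ 𝓜.P.β) (x + (k + 1 : ℕ) * α) +
        near (𝓜.P.c / ((n - k : ℕ) : ℝ) ^ 𝓜.P.β) (x + (k + 1 : ℕ) * α))) ≤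
      logNorm α 𝓜.limitDiag n x := by
  have hn : 0 ≤ n * 𝓜.rate := by positivity
  have ht : ∀ k ∈ Finset.range n, 0 ≤
      near (𝓜.P.c / ((k + 1 : ℕ) : ℝ) ^ 𝓜.P.β) (x + (k + 1 : ℕ) * α) +
        near (𝓜.P.c / ((n - k : ℕ) : ℝ) ^ 𝓜.P.β) (x + (k + 1 : ℕ) * α) := fun k _ =>
    add_nonneg (near_nonneg _ _) (near_nonneg _ _)
  by_cases hW : 𝓜.P.W α x n
  · have := 𝓜.le_logNorm_of_W ha hW
    nlinarith [mul_nonneg hn (Finset.sum_nonneg ht)]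
  · refine le_trans (mul_nonpos_of_nonneg_of_nonpos hn (sub_nonpos.2 ?_))
      (logNorm_nonneg _ _ _ _)
    simp only [Setup.W, not_forall] at hW
    obtain ⟨k, hk1, hkn, hk⟩ := hW
    obtain ⟨j, rfl⟩ : ∃ j, k = j + 1 := ⟨k - 1, by omega⟩
    refine le_trans ?_ (Finset.single_le_sum ht (Finset.mem_range.2 (show j < n by omega)))
    rw [not_and_or, not_le, not_le, show n + 1 - (j + 1) = n - j by omega] at hk
    rcases hk with h | h
    · rw [near_eq_one h]; linarith [near_nonneg (𝓜.P.c / ((n - j : ℕ) : ℝ) ^ 𝓜.P.β)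
        (x + (j + 1 : ℕ) * α)]
    · rw [near_eq_one h]; linarith [near_nonneg (𝓜.P.c / ((j + 1 : ℕ) : ℝ) ^ 𝓜.P.β)
        (x + (j + 1 : ℕ) * α)]

theorem continuous_limitDiag {a : ℝ} (ha : 𝓜.P.β ^ 4 < a) : Continuous 𝓜.limitDiag :=
  (𝓜.gevreyBound_limitDiag ha).choose_spec.1.continuous

theorem continuous_partialDiag (m : ℕ) : Continuous (𝓜.partialDiag m) :=
  (𝓜.gevreyBound_partialDiag one_pos m).choose_spec.1.continuous

theorem le_lyap_limitDiag {a : ℝ} (ha : 𝓜.P.β ^ 4 < a) (hr : 0 ≤ 𝓜.rate)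
    (hS : ∀ n : ℕ, ∑ k ∈ Finset.range n, 𝓜.P.c / ((k + 1 : ℕ) : ℝ) ^ 𝓜.P.β ≤ 1 / 768) (E : ℝ) :
    191 / 192 * 𝓜.rate ≤ lyap α (schrodMat E fun y => E - 𝓜.limitDiag y) := by
  have hc := 𝓜.continuous_limitDiag ha
  refine le_lyap E hc 𝓜.limitDiag_periodic fun n hn => ?_
  have hε : ∀ k : ℕ, 1 ≤ k → 0 ≤ 𝓜.P.c / (k : ℝ) ^ 𝓜.P.β ∧
      𝓜.P.c / (k : ℝ) ^ 𝓜.P.β ≤ 1 / 2 := fun k hk => by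
    refine ⟨(𝓜.P.c_div_pos hk).le, ?_⟩
    have h1 : 1 ≤ (k : ℝ) ^ 𝓜.P.β := Real.one_le_rpow (by exact_mod_cast hk) 𝓜.P.β_pos.le
    refine (div_le_self 𝓜.P.c_pos.le h1).trans ?_
    linarith [𝓜.P.cD_le, 𝓜.P.c_le]
  set g : ℕ → ℝ → ℝ := fun k x =>
    near (𝓜.P.c / ((k + 1 : ℕ) : ℝ) ^ 𝓜.P.β) (x + (k + 1 : ℕ) * α) +
        near (𝓜.P.c / ((n - k : ℕ) : ℝ) ^ 𝓜.P.β) (x + (k + 1 : ℕ) * α) with hg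
  have hgi : ∀ k, IntervalIntegrable (g k) volume 0 1 := fun k =>
    (intervalIntegrable_near _ _ 0 1).add (intervalIntegrable_near _ _ 0 1)
  have hsi : IntervalIntegrable (fun x => ∑ k ∈ Finset.range n, g k x) volume 0 1 := by
    have := IntervalIntegrable.sum (μ := volume) (a := 0) (b := 1) (Finset.range n)
      fun k _ => hgi k
    rwa [Finset.sum_fn] at this
  have hle : ∫ x in (0 : ℝ)..1, n * 𝓜.rate * (1 - ∑ k ∈ Finset.range n, g k x) ≤
      logInt α 𝓜.limitDiag n :=
    intervalIntegral.integral_mono_on zero_le_one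
      ((intervalIntegrable_const.sub hsi).const_mul _)
      ((continuous_logNorm hc n).intervalIntegrable _ _) fun x _ => 𝓜.le_logNorm ha hr x n
  refine le_trans ?_ hle
  rw [intervalIntegral.integral_const_mul, intervalIntegral.integral_sub intervalIntegrable_const
    hsi, intervalIntegral.integral_finsetSum fun k _ => hgi k, intervalIntegral.integral_const]
  have hgk : ∀ k ∈ Finset.range n, ∫ x in (0 : ℝ)..1, g k x =
      2 * (𝓜.P.c / ((k + 1 : ℕ) : ℝ) ^ 𝓜.P.β) +
        2 * (𝓜.P.c / ((n - 1 - k + 1 : ℕ) : ℝ) ^ 𝓜.P.β) := fun k hk => by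
    have hkn := Finset.mem_range.1 hk
    rw [hg, show n - 1 - k + 1 = n - k by omega]
    have e1 := hε (k + 1) (by omega)
    have e2 := hε (n - k) (by omega)
    simp only
    rw [intervalIntegral.integral_add (intervalIntegrable_near _ _ 0 1)
      (intervalIntegrable_near _ _ 0 1), integral_near e1.1 e1.2, integral_near e2.1 e2.2]
  rw [Finset.sum_congr rfl hgk, Finset.sum_add_distrib, ← Finset.mul_sum, ← Finset.mul_sum,
    Finset.sum_range_reflect (fun k => 𝓜.P.c / ((k + 1 : ℕ) : ℝ) ^ 𝓜.P.β) n]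
  have hn' : 0 ≤ n * 𝓜.rate := by positivity
  have := mul_le_mul_of_nonneg_left (hS n) hn'
  simp only [sub_zero, smul_eq_mul, mul_one]
  linarith

/-- The logarithmic loss on a resonant window, per site. -/
def loss : ℝ := 3 * 𝓜.P.B + Real.log 8

theorem logNorm_window_le {m : ℕ} {z : ℝ} (hz : dst z ≤ 𝓜.P.ℓ m) :
    logNorm α (𝓜.partialDiag m) (𝓜.P.Q m - 1 + 1 + (𝓜.P.Q m - 1)) (z - 𝓜.P.Q m * α) ≤
      𝓜.P.Q m * 𝓜.loss := by
  have hl := 𝓜.lam_pos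
  have hℓ := 𝓜.P.ℓ_pos m
  have hQ := 𝓜.P.one_le_Q m
  obtain ⟨N, hN⟩ : ∃ N, 𝓜.P.Q m = N + 1 := ⟨𝓜.P.Q m - 1, by omega⟩
  have hz4 : dst z ≤ 4 * 𝓜.P.ℓ m := by linarith
  have hW : ∀ δ, δ = α ∨ δ = -α → 𝓜.P.W δ z N := fun δ hδ => by
    have := 𝓜.P.near_W hδ hz4 le_rfl
    rwa [hN, Nat.add_sub_cancel] at this
  have hH : ∀ δ, δ = α ∨ δ = -α → ∀ k, 1 ≤ k → k ≤ N →
      𝓜.partialDiag m (z + k * δ) = 𝓜.H (z + k * δ) := fun δ hδ k h1 h2 => by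
    have := 𝓜.P.near_dst_ge hδ hz4 le_rfl h1 (show k < 𝓜.P.Q m by omega)
    exact 𝓜.partialDiag_eq_H (by linarith)
  have hfz := 𝓜.partialDiag_eq_weylSum hz
  rw [hN, Nat.add_sub_cancel] at *
  set f := 𝓜.partialDiag m
  set w := z - (N + 1 : ℕ) * α with hw
  set R := transfer (chain f α z) N with hR
  set L := transfer (chain f α w) N with hL
  have hRH : transfer (chain 𝓜.H α z) N = R :=
    (transfer_congr fun k h1 h2 => hH α (Or.inl rfl) k h1 h2).symm
  have hb : ∀ k, 1 ≤ k → k ≤ N → chain 𝓜.H (-α) z k = chain f α w (N + 1 - k) :=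
    fun k h1 h2 => by
      rw [chain, chain, ← hH (-α) (Or.inr rfl) k h1 h2, hw]
      congr 1
      push_cast [Nat.cast_sub (show k ≤ N + 1 by omega)]
      ring
  have hLr := transfer_reverse (chain f α w) (chain 𝓜.H (-α) z) N hb
  have hL00 : transfer (chain 𝓜.H (-α) z) N 0 0 = L 0 0 := by rw [hLr]; rfl
  have hR0 := 𝓜.transfer_ne_zero (Or.inl rfl) (hW α (Or.inl rfl))
  have hRq := 𝓜.transfer_inv_le (Or.inl rfl) (hW α (Or.inl rfl))
  have hL0 := 𝓜.transfer_ne_zero (Or.inr rfl) (hW (-α) (Or.inr rfl))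
  have hLq := 𝓜.transfer_inv_le (Or.inr rfl) (hW (-α) (Or.inr rfl))
  rw [hRH] at hR0 hRq
  rw [hL00] at hL0 hLq
  rw [weylSum, weyl, hRH, weyl_reverse (chain f α w) (chain 𝓜.H (-α) z) N hb,
    Ring.inverse_eq_inv'] at hfz
  have hA := fun x i j => (abs_entry_le_opNorm _ i j).trans
    (opNorm_transfer_le (α := α) 𝓜.two_le_lam (𝓜.abs_partialDiag_le m) N x)
  have key := opNorm_resonant_le (transfer_real_det _ N) (transfer_real_det _ N) hR0 hL0 (hA z)
    (hA w) hRq hLq hfz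
  have hsplit : transfer (chain f α w) (N + 1 + N) = R * stepM (f z) * L := by
    rw [transfer_split, chain_shift, ← mul_assoc]
    have e : w + (N + 1 : ℕ) * α = z := by rw [hw]; ring
    rw [e, chain, e]
  rw [logNorm, hsplit]
  have hpos := one_pos.trans_le (one_le_opNorm (transfer_real_det (chain f α w) (N + 1 + N)))
  rw [hsplit] at hpos
  refine (Real.log_le_log hpos key).trans ?_
  have e : (4 * 𝓜.lam) ^ N * ((2 / 𝓜.lam) ^ N * Real.exp (3 * 𝓜.P.B * N)) =
      8 ^ N * Real.exp (3 * 𝓜.P.B * N) := by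
    rw [← mul_assoc, ← mul_pow]
    congr 2
    field_simp
    norm_num
  rw [e, Real.log_mul (by norm_num) (by positivity), Real.log_mul (by positivity) (by positivity),
    Real.log_pow, Real.log_exp, loss]
  have h48 : Real.log 4 ≤ Real.log 8 := Real.log_le_log (by norm_num) (by norm_num)
  have := 𝓜.P.B_pos
  push_cast
  linarith

theorem logNorm_block_le (m : ℕ) (x : ℝ) :
    logNorm α (𝓜.partialDiag m) (3 * 𝓜.P.Q m) x ≤
      3 * 𝓜.P.Q m * Real.log (4 * 𝓜.lam) + 𝓜.P.Q m * 𝓜.loss -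
        𝓜.P.Q m * Real.log (4 * 𝓜.lam) *
          ∑ k ∈ Finset.range (𝓜.P.Q m), near (𝓜.P.ℓ m) (x + (𝓜.P.Q m + k) * α) := by
  have hl := 𝓜.two_le_lam
  have hℓ := 𝓜.P.ℓ_pos m
  have hQ := 𝓜.P.one_le_Q m
  have hQ' := 𝓜.P.one_le_Q_cast m
  have hLg : 0 ≤ Real.log (4 * 𝓜.lam) := Real.log_nonneg (by linarith)
  have hloss : 0 ≤ 𝓜.loss := by
    have := 𝓜.P.B_pos
    have := Real.log_nonneg (show (1 : ℝ) ≤ 8 by norm_num)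
    unfold loss
    positivity
  have htriv := fun n x => logNorm_le (α := α) hl (𝓜.abs_partialDiag_le m) n x
  by_cases hv : ∃ k ∈ Finset.range (𝓜.P.Q m), dst (x + (𝓜.P.Q m + k) * α) < 𝓜.P.ℓ m
  · obtain ⟨k, hk, hd⟩ := hv
    have hkQ := Finset.mem_range.1 hk
    have hsum : ∑ k ∈ Finset.range (𝓜.P.Q m), near (𝓜.P.ℓ m) (x + (𝓜.P.Q m + k) * α) = 1 := by
      rw [Finset.sum_eq_single_of_mem k hk, near_eq_one hd]
      intro j hj hjk
      have hjQ := Finset.mem_range.1 hj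
      refine near_eq_zero (not_lt.2 ?_)
      rcases lt_or_gt_of_ne hjk with h | h
      · have := 𝓜.P.near_dst_ge (Or.inr rfl) (show dst (x + (𝓜.P.Q m + k) * α) ≤ 4 * 𝓜.P.ℓ m by
          linarith) le_rfl (show 1 ≤ k - j by omega) (by omega)
        rw [Nat.cast_sub h.le, show x + (𝓜.P.Q m + k) * α + ((k : ℝ) - j) * -α =
          x + (𝓜.P.Q m + j) * α by ring] at this
        linarith
      · have := 𝓜.P.near_dst_ge (Or.inl rfl) (show dst (x + (𝓜.P.Q m + k) * α) ≤ 4 * 𝓜.P.ℓ m by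
          linarith) le_rfl (show 1 ≤ j - k by omega) (by omega)
        rw [Nat.cast_sub h.le, show x + (𝓜.P.Q m + k) * α + ((j : ℝ) - k) * α =
          x + (𝓜.P.Q m + j) * α by ring] at this
        linarith
    have hwin := 𝓜.logNorm_window_le hd.le
    rw [show x + (𝓜.P.Q m + k) * α - 𝓜.P.Q m * α = x + k * α by ring] at hwin
    have h1 := logNorm_add_le (α := α) (f := 𝓜.partialDiag m) k
      (𝓜.P.Q m - 1 + 1 + (𝓜.P.Q m - 1) + (𝓜.P.Q m + 1 - k)) x
    have h2 := logNorm_add_le (α := α) (f := 𝓜.partialDiag m) (𝓜.P.Q m - 1 + 1 + (𝓜.P.Q m - 1))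
      (𝓜.P.Q m + 1 - k) (x + k * α)
    rw [show k + (𝓜.P.Q m - 1 + 1 + (𝓜.P.Q m - 1) + (𝓜.P.Q m + 1 - k)) = 3 * 𝓜.P.Q m by omega]
      at h1
    have h3 := htriv k x
    have h4 := htriv (𝓜.P.Q m + 1 - k)
      (x + k * α + ((𝓜.P.Q m - 1 + 1 + (𝓜.P.Q m - 1) : ℕ) : ℝ) * α)
    rw [Nat.cast_sub (by omega)] at h4
    push_cast at h4
    rw [hsum]
    have h5 : 0 ≤ ((𝓜.P.Q m : ℝ) - 1) * Real.log (4 * 𝓜.lam) := mul_nonneg (by linarith) hLg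
    push_cast at h2
    linarith
  · have hsum : ∑ k ∈ Finset.range (𝓜.P.Q m), near (𝓜.P.ℓ m) (x + (𝓜.P.Q m + k) * α) = 0 :=
      Finset.sum_eq_zero fun k hk => near_eq_zero fun h => hv ⟨k, hk, h⟩
    have h1 := htriv (3 * 𝓜.P.Q m) x
    rw [hsum]
    push_cast at h1
    have : 0 ≤ 𝓜.P.Q m * 𝓜.loss := by positivity
    linarith

theorem lyap_partialDiag_le (m : ℕ) (E : ℝ) :
    lyap α (schrodMat E fun y => E - 𝓜.partialDiag m y) ≤
      95 / 96 * Real.log (4 * 𝓜.lam) + 𝓜.loss / 3 := by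
  have hc := 𝓜.continuous_partialDiag m
  have hQ := 𝓜.P.one_le_Q m
  have hQ' := 𝓜.P.Q_pos m
  refine (lyap_le E hc (𝓜.partialDiag_periodic m) (show 3 * 𝓜.P.Q m ≠ 0 by omega)).trans ?_
  rw [div_le_iff₀ (by push_cast; positivity)]
  set g : ℕ → ℝ → ℝ := fun k x => near (𝓜.P.ℓ m) (x + (𝓜.P.Q m + k) * α) with hg
  have hgi : ∀ k, IntervalIntegrable (g k) volume 0 1 := fun k => intervalIntegrable_near _ _ 0 1
  have hsi : IntervalIntegrable (fun x => ∑ k ∈ Finset.range (𝓜.P.Q m), g k x) volume 0 1 := by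
    have := IntervalIntegrable.sum (μ := volume) (a := 0) (b := 1) (Finset.range (𝓜.P.Q m))
      fun k _ => hgi k
    rwa [Finset.sum_fn] at this
  have hle : logInt α (𝓜.partialDiag m) (3 * 𝓜.P.Q m) ≤ ∫ x in (0 : ℝ)..1,
      (3 * 𝓜.P.Q m * Real.log (4 * 𝓜.lam) + 𝓜.P.Q m * 𝓜.loss -
        𝓜.P.Q m * Real.log (4 * 𝓜.lam) * ∑ k ∈ Finset.range (𝓜.P.Q m), g k x) :=
    intervalIntegral.integral_mono_on zero_le_one
      ((continuous_logNorm hc _).intervalIntegrable _ _)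
      (intervalIntegrable_const.sub (hsi.const_mul _)) fun x _ => 𝓜.logNorm_block_le m x
  refine hle.trans ?_
  rw [intervalIntegral.integral_sub intervalIntegrable_const (hsi.const_mul _),
    intervalIntegral.integral_const_mul, intervalIntegral.integral_finsetSum fun k _ => hgi k,
    intervalIntegral.integral_const]
  have hgk : ∀ k ∈ Finset.range (𝓜.P.Q m), ∫ x in (0 : ℝ)..1, g k x = 2 * 𝓜.P.ℓ m :=
    fun k _ => integral_near (𝓜.P.ℓ_pos m).le (by linarith [𝓜.P.ℓ_le m]) _
  rw [Finset.sum_congr rfl hgk, Finset.sum_const, Finset.card_range, nsmul_eq_mul,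
    show (𝓜.P.Q m : ℝ) * (2 * 𝓜.P.ℓ m) = 1 / 32 by linarith [𝓜.P.Q_mul_ℓ m]]
  simp only [sub_zero, smul_eq_mul]
  push_cast
  linarith

end Model

end

theorem exists_odd_inv_lt {ε : ℝ} (hε : 0 < ε) : ∃ p : ℕ, Odd p ∧ 1 / (p : ℝ) < ε := by
  obtain ⟨n, hn⟩ := exists_nat_one_div_lt hε
  refine ⟨2 * n + 1, ⟨n, rfl⟩, lt_of_le_of_lt ?_ hn⟩
  push_cast
  exact one_div_le_one_div_of_le (by positivity) (by linarith [(Nat.cast_nonneg n : (0 : ℝ) ≤ n)])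

theorem exists_one_lt_pow_four_lt {a : ℝ} (ha : 1 < a) : ∃ β : ℝ, 1 < β ∧ β ^ 4 < a := by
  refine ⟨a ^ (1 / 5 : ℝ), Real.one_lt_rpow ha (by norm_num), ?_⟩
  rw [← Real.rpow_natCast, ← Real.rpow_mul (by linarith)]
  exact Real.rpow_lt_self_of_one_lt ha (by norm_num)

theorem exists_setup {α β : ℝ} (F : FreqData α β) (hβ : 1 < β) : ∃ P : Setup α, P.β = β ∧
    ∀ n : ℕ, ∑ k ∈ Finset.range n, P.c / ((k + 1 : ℕ) : ℝ) ^ P.β ≤ 1 / 768 := by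
  have hs : Summable fun k : ℕ => 1 / ((k + 1 : ℕ) : ℝ) ^ β :=
    (summable_nat_add_iff 1).2 (Real.summable_one_div_nat_rpow.2 hβ)
  have hnn : ∀ k : ℕ, 0 ≤ 1 / ((k + 1 : ℕ) : ℝ) ^ β := fun k => by positivity
  set S := ∑' k : ℕ, 1 / ((k + 1 : ℕ) : ℝ) ^ β
  have hS : 0 ≤ S := tsum_nonneg hnn
  have hD := F.cD_pos
  refine ⟨⟨β, hβ, F, min (F.cD / 8) (1 / (768 * (S + 1))), lt_min (by positivity) (by positivity),
    min_le_left _ _⟩, rfl, fun n => ?_⟩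
  calc ∑ k ∈ Finset.range n, min (F.cD / 8) (1 / (768 * (S + 1))) / ((k + 1 : ℕ) : ℝ) ^ β
      ≤ ∑ k ∈ Finset.range n, 1 / (768 * (S + 1)) * (1 / ((k + 1 : ℕ) : ℝ) ^ β) := by
        refine Finset.sum_le_sum fun k _ => ?_
        rw [div_eq_mul_one_div]
        exact mul_le_mul_of_nonneg_right (min_le_right _ _) (hnn k)
    _ ≤ 1 / (768 * (S + 1)) * (S + 1) := by
        rw [← Finset.mul_sum]
        refine mul_le_mul_of_nonneg_left ?_ (by positivity)
        linarith [hs.sum_le_tsum (Finset.range n) fun k _ => hnn k]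
    _ = 1 / 768 := by field_simp

/-- For a large coupling constant the growth rate along admissible chains exceeds the loss caused
by the resonances. -/
theorem exists_model {α r : ℝ} (P : Setup α) (hr : 0 ≤ r) (b : Bump r) : ∃ 𝓜 : Model α, 𝓜.P = P ∧
    𝓜.r = r ∧ 0 ≤ 𝓜.rate ∧
      95 / 96 * Real.log (4 * 𝓜.lam) + 𝓜.loss / 3 < 191 / 192 * 𝓜.rate := by
  set e := 4 * Real.exp (2 * 3 * (P.B + P.C₀)) with he
  have hlog := Real.tendsto_log_atTop
  obtain ⟨D, h1, h2, h3, h4, h5, h6⟩ := ((eventually_ge_atTop (2 : ℝ)).and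
    ((eventually_ge_atTop (16 * (1 + 2 * b.M))).and ((eventually_ge_atTop (2 * e)).and
    ((eventually_ge_atTop (e * Real.exp (3 * P.C₃))).and
    ((hlog.eventually_ge_atTop (Real.log 2 + 3 * P.B)).and
    (hlog.eventually_gt_atTop (192 * (95 / 96 * Real.log 4 + (3 * P.B + Real.log 8) / 3 +
      191 / 192 * (Real.log 2 + 3 * P.B))))))))).exists
  have hD : 0 < D := by linarith
  refine ⟨⟨P, r, hr, b, D, h1, h2, ?_, ?_⟩, rfl, rfl, ?_, ?_⟩
  · rw [← he, div_le_iff₀ hD]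
    linarith
  · rw [← he, div_mul_eq_mul_div, div_le_one hD]
    exact h4
  · rw [Model.rate, Real.log_div hD.ne' two_ne_zero]
    linarith
  · simp only [Model.rate, Model.loss]
    rw [Real.log_div hD.ne' two_ne_zero, Real.log_mul four_ne_zero hD.ne']
    linarith

/-- Discontinuity of the Lyapunov exponent of Schrödinger cocycles in the potential, in the
Gevrey class `G^s(S¹, ℝ)` with `s > 2`, for any fixed strong Diophantine frequency `α`
(i.e. `q_{n+1} ≤ γ⁻¹ q_n (log q_n)^τ`) and any fixed energy `E`. -/
theorem statement5 (α : ℝ) (hα : Irrational α)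
    (hSDC : ∃ γ : ℝ, 0 < γ ∧ ∃ τ : ℝ, 0 < τ ∧ ∀ᶠ n in atTop,
      (cfq α (n + 1) : ℝ) ≤ γ⁻¹ * (cfq α n : ℝ) * (Real.log (cfq α n : ℝ)) ^ τ)
    (E : ℝ) (s : ℝ) (hs : 2 < s) :
    ∃ v₀ : ℝ → ℝ, ∃ K : ℝ, 0 < K ∧ ∃ v : ℕ → ℝ → ℝ,
      Function.Periodic v₀ 1 ∧ MemGevreyR s K v₀ ∧
      (∀ j, Function.Periodic (v j) 1 ∧ MemGevreyR s K (v j)) ∧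
      Tendsto (fun j : ℕ => gevreyNormR s K (fun x => v j x - v₀ x)) atTop (nhds 0) ∧
      ¬ Tendsto (fun j : ℕ => lyap α (schrodMat E (v j))) atTop
          (nhds (lyap α (schrodMat E v₀))) := by
  obtain ⟨p, hp, hps⟩ := exists_odd_inv_lt (sub_pos.2 hs)
  obtain ⟨β, hβ, hβa⟩ := exists_one_lt_pow_four_lt (show 1 < s - 1 - 1 / (p : ℝ) by linarith)
  obtain ⟨F⟩ := exists_freqData hα hSDC hβ
  obtain ⟨P, hPβ, hS⟩ := exists_setup F hβ
  obtain ⟨b⟩ := exists_bump hp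
  obtain ⟨𝓜, rfl, hr, hrate, hgap⟩ := exists_model P (by positivity) b
  have ha : 𝓜.P.β ^ 4 < s - 1 - 1 / (p : ℝ) := by rwa [hPβ]
  have hsr : 1 + 𝓜.r + (s - 1 - 1 / (p : ℝ)) = s := by rw [hr]; ring
  have hmem : ∀ f : ℝ → ℝ, (∃ C, GevreyBound (1 + 𝓜.r + (s - 1 - 1 / (p : ℝ))) C f) →
      MemGevreyR s 1 fun x => E - f x := fun f ⟨C, hC⟩ => by
    rw [hsr] at hC
    have := ((GevreyBound.const s E).add hC.neg).memGevreyR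
    simpa only [← sub_eq_add_neg] using this
  refine ⟨fun x => E - 𝓜.limitDiag x, 1, one_pos, fun j x => E - 𝓜.partialDiag j x,
    fun x => by simp only [𝓜.limitDiag_periodic x], hmem _ (𝓜.gevreyBound_limitDiag ha),
    fun j => ⟨fun x => by simp only [𝓜.partialDiag_periodic j x],
      hmem _ (𝓜.gevreyBound_partialDiag (𝓜.param_pos ha) j)⟩, ?_, fun h => ?_⟩
  · have h0 := (𝓜.tendsto_tail (s - 1 - 1 / (p : ℝ))).const_mul (4 * Real.pi ^ 2 / 3)
    rw [mul_zero] at h0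
    refine squeeze_zero (fun j => GevreyBound.gevreyNormR_nonneg _ _) (fun j => ?_) h0
    have hb := 𝓜.gevreyBound_limitDiag_sub ha j
    rw [hsr] at hb
    simp only [sub_sub_sub_cancel_left]
    exact hb.gevreyNormR_le
  · have h1 := le_of_tendsto' h fun j => 𝓜.lyap_partialDiag_le j E
    linarith [𝓜.le_lyap_limitDiag ha hrate hS E]
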